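/- arXiv:2509.17578 — 4 statements merged into one kernel-verified Lean document; each statement's English description precedes it below -/
import Mathlib

section
/- Let p ≥ 2 be an even integer and K ≥ 1 a constant with (K² − 1) b_p c_p < 1. Suppose f = u + iv is a harmonic K-quasiregular mapping on the unit disk 𝔻 with u in h^p and cos(p(arg f(0) − π/2)) ≤ 0. Then ‖v‖_p ≤ c(K,p) ‖u‖_p, where c(K,p)^p = (a_p + (K² − 1) b_p c_p)/(1 − (K² − 1) b_p c_p). -/
open Complex MeasureTheory Set

/-- Integral mean `M_p(r,f)` of a function on the unit disk. -/
noncomputable def Mp {E : Type*} [NormedAddCommGroup E] (p r : ℝ) (f : ℂ → E) : ℝ :=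
  ((1 / (2 * Real.pi)) *
    ∫ θ in (0:ℝ)..(2 * Real.pi), ‖f ((r : ℂ) * Complex.exp ((θ : ℂ) * Complex.I))‖ ^ p) ^ (1 / p)

/-- Hardy-type norm `‖f‖_p = sup_{0 ≤ r < 1} M_p(r,f)`. -/
noncomputable def hardyNorm {E : Type*} [NormedAddCommGroup E] (p : ℝ) (f : ℂ → E) : ℝ :=
  sSup ((fun r => Mp p r f) '' Ico (0:ℝ) 1)

/-- Membership in the Hardy-type space `h^p` / `H^p_g`. -/
def MemHp {E : Type*} [NormedAddCommGroup E] (p : ℝ) (f : ℂ → E) : Prop :=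
  BddAbove ((fun r => Mp p r f) '' Ico (0:ℝ) 1)

/-- `a_p = cot^p(π/(2p))`. -/
noncomputable def aP (p : ℝ) : ℝ := Real.cot (Real.pi / (2 * p)) ^ p

/-- `b_p = 2 cos^p(π/(2p)) csc(π/p)`. -/
noncomputable def bP (p : ℝ) : ℝ :=
  2 * Real.cos (Real.pi / (2 * p)) ^ p * (Real.sin (Real.pi / p))⁻¹

/-- `m_p = csc^p(π/(2p))`. -/
noncomputable def mP (p : ℝ) : ℝ := (Real.sin (Real.pi / (2 * p)))⁻¹ ^ p

/-- `n_p = cot(π/(2p))`. -/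
noncomputable def nP (p : ℝ) : ℝ := Real.cot (Real.pi / (2 * p))

/-- `c_p = 1` for `2 ≤ p ≤ 4` and `c_p = 2^{(p-4)/2}` for `p ≥ 4`. -/
noncomputable def cP (p : ℝ) : ℝ := if p ≤ 4 then 1 else (2:ℝ) ^ ((p - 4) / 2)


theorem sin_mul_div_sin_pow_antitoneOn (q : ℕ) :
    AntitoneOn (fun s : ℝ => Real.sin (q * s) / Real.sin s ^ q)
      (Ioc 0 (Real.pi / (q + 1))) := by
  have hq : (0:ℝ) < q + 1 := by positivity
  have hpos : ∀ s ∈ Ioc (0:ℝ) (Real.pi / (q + 1)), s < Real.pi → 0 < Real.sin s := fun s hs h =>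
    Real.sin_pos_of_pos_of_lt_pi hs.1 h
  rcases Nat.eq_zero_or_pos q with rfl | hq1
  · simp [AntitoneOn]
  have hlt : Real.pi / (q + 1) < Real.pi :=
    div_lt_self Real.pi_pos (by have : (0:ℝ) < q := by exact_mod_cast hq1
                                linarith)
  have hder : ∀ s ∈ Ioc (0:ℝ) (Real.pi / (q + 1)),
      HasDerivAt (fun s : ℝ => Real.sin (q * s) / Real.sin s ^ q)
        ((Real.cos (q * s) * (q * 1) * Real.sin s ^ q -
          Real.sin (q * s) * (q * Real.sin s ^ (q - 1) * Real.cos s)) / (Real.sin s ^ q) ^ 2) s := by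
    intro s hs
    have h0 := hpos s hs (hs.2.trans_lt hlt)
    exact (((hasDerivAt_id s).const_mul (q:ℝ)).sin).div ((Real.hasDerivAt_sin s).pow q)
      (pow_pos h0 q).ne'
  refine antitoneOn_of_deriv_nonpos (convex_Ioc _ _)
    (fun s hs => (hder s hs).continuousAt.continuousWithinAt)
    (fun s hs => (hder s (interior_subset hs)).differentiableAt.differentiableWithinAt) ?_
  intro s hs
  replace hs := interior_subset hs
  rw [(hder s hs).deriv]
  have h0 := hpos s hs (hs.2.trans_lt hlt)
  refine div_nonpos_of_nonpos_of_nonneg ?_ (by positivity)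
  obtain ⟨k, rfl⟩ : ∃ k, q = k + 1 := ⟨q - 1, by omega⟩
  have hk : 0 ≤ Real.sin (k * s) := by
    refine Real.sin_nonneg_of_nonneg_of_le_pi (by have := hs.1; positivity) ?_
    have := hs.2
    rw [le_div_iff₀ hq] at this
    push_cast at this
    nlinarith [hs.1]
  have e : Real.sin (k * s) = Real.sin ((k + 1 : ℕ) * s) * Real.cos s
      - Real.cos ((k + 1 : ℕ) * s) * Real.sin s := by
    rw [← Real.sin_sub]; congr 1; push_cast; ring
  have : Real.cos ((k + 1 : ℕ) * s) * ((k + 1 : ℕ) * 1) * Real.sin s ^ (k + 1) -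
      Real.sin ((k + 1 : ℕ) * s) * ((k + 1 : ℕ) * Real.sin s ^ (k + 1 - 1) * Real.cos s) =
      -((k + 1 : ℕ) * Real.sin s ^ k * Real.sin (k * s)) := by
    rw [e, Nat.add_sub_cancel]; ring
  rw [this, neg_nonpos]
  positivity

/-- Pichorides-type trigonometric inequality on the first quadrant. -/
theorem cos_pow_le_of_mem_Icc {q : ℕ} (hq : 1 ≤ q) {a b γ s : ℝ}
    (hγ : γ = Real.pi / (2 * (q + 1)))
    (hb : b = Real.cos γ ^ q / Real.sin γ) (ha : a = (Real.cos γ / Real.sin γ) ^ (q + 1))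
    (hs : s ∈ Icc 0 (Real.pi / 2)) :
    Real.cos s ^ (q + 1) ≤ a * Real.sin s ^ (q + 1) + b * Real.cos ((q + 1) * s) := by
  have hq1 : (1:ℝ) ≤ q := by exact_mod_cast hq
  have hpi := Real.pi_pos
  have hγ0 : 0 < γ := by rw [hγ]; positivity
  have hγ4 : γ ≤ Real.pi / 4 := by
    rw [hγ]; exact div_le_div_of_nonneg_left hpi.le (by norm_num) (by linarith)
  have hγq : (q + 1) * γ = Real.pi / 2 := by rw [hγ]; field_simp
  have hγ2 : 2 * γ = Real.pi / (q + 1) := by rw [hγ]; field_simp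
  have hsin : 0 < Real.sin γ := Real.sin_pos_of_pos_of_lt_pi hγ0 (by linarith)
  have hcos : 0 < Real.cos γ := Real.cos_pos_of_mem_Ioo ⟨by linarith, by linarith⟩
  have hb0 : 0 < b := by rw [hb]; positivity
  have ha0 : 0 < a := by rw [ha]; positivity
  have hab : a * Real.sin γ ^ q = b * Real.cos γ := by
    rw [ha, hb, div_pow]; field_simp; ring
  have hsq : Real.sin (q * γ) = Real.cos γ := by
    rw [← Real.sin_pi_div_two_sub]; congr 1; linarith
  have hcos2 : 1 ≤ 2 * Real.cos γ ^ 2 := by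
    have := Real.cos_nonneg_of_mem_Icc (x := 2 * γ) ⟨by linarith, by linarith⟩
    rw [Real.cos_two_mul] at this; linarith
  have hcrude : b ≤ a * Real.sin (2 * γ) ^ q := by
    have h2 : (1:ℝ) ≤ 2 * Real.cos γ := by nlinarith [Real.cos_le_one γ]
    obtain ⟨k, rfl⟩ : ∃ k, q = k + 1 := ⟨q - 1, by omega⟩
    have : a * Real.sin (2 * γ) ^ (k + 1) =
        b * (2 * Real.cos γ ^ 2 * (2 * Real.cos γ) ^ k) := by
      rw [Real.sin_two_mul]
      calc a * (2 * Real.sin γ * Real.cos γ) ^ (k + 1)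
          = (a * Real.sin γ ^ (k + 1)) * (2 * Real.cos γ) ^ (k + 1) := by ring
        _ = _ := by rw [hab]; ring
    rw [this]
    exact le_mul_of_one_le_right hb0.le (one_le_mul_of_one_le_of_one_le hcos2 (one_le_pow₀ h2))
  have hanti := sin_mul_div_sin_pow_antitoneOn q
  have hsinpos : ∀ t, 0 < t → t ≤ Real.pi / 2 → 0 < Real.sin t := fun t h1 h2 =>
    Real.sin_pos_of_pos_of_lt_pi h1 (by linarith)
  have hlow : ∀ t ∈ Ioc 0 γ, a * Real.sin t ^ q ≤ b * Real.sin (q * t) := by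
    intro t ht
    have := hanti (a := t) (b := γ) ⟨ht.1, by linarith [ht.2]⟩ ⟨hγ0, by linarith⟩ ht.2
    have ht0 := hsinpos t ht.1 (by linarith [ht.2])
    simp only at this
    rw [hsq, div_le_div_iff₀ (by positivity) (by positivity)] at this
    have h3 : 0 < Real.sin γ ^ q := by positivity
    refine le_of_mul_le_mul_right ?_ h3
    calc a * Real.sin t ^ q * Real.sin γ ^ q = b * (Real.cos γ * Real.sin t ^ q) := by
          rw [mul_right_comm, hab]; ring
      _ ≤ b * (Real.sin (q * t) * Real.sin γ ^ q) := by gcongr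
      _ = _ := by ring
  have hhigh : ∀ t, γ ≤ t → t ≤ Real.pi / 2 → b * Real.sin (q * t) ≤ a * Real.sin t ^ q := by
    intro t ht ht'
    have ht0 := hsinpos t (by linarith) ht'
    rcases le_total t (2 * γ) with h2 | h2
    · have := hanti (a := γ) (b := t) ⟨hγ0, by linarith⟩ ⟨by linarith, by linarith⟩ ht
      simp only at this
      rw [hsq, div_le_div_iff₀ (by positivity) (by positivity)] at this
      have h3 : 0 < Real.sin γ ^ q := by positivity
      refine le_of_mul_le_mul_right ?_ h3
      calc b * Real.sin (q * t) * Real.sin γ ^ q = b * (Real.sin (q * t) * Real.sin γ ^ q) := by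
            ring
        _ ≤ b * (Real.cos γ * Real.sin t ^ q) := by gcongr
        _ = _ := by rw [mul_right_comm a, hab]; ring
    · have hm : Real.sin (2 * γ) ≤ Real.sin t :=
        Real.sin_le_sin_of_le_of_le_pi_div_two (by linarith) ht' h2
      have h20 := hsinpos (2 * γ) (by linarith) (by linarith)
      calc b * Real.sin (q * t) ≤ b * 1 := by gcongr; exact Real.sin_le_one _
        _ ≤ a * Real.sin (2 * γ) ^ q := by linarith
        _ ≤ _ := by gcongr
  rcases eq_or_lt_of_le hs.2 with rfl | hs2
  · have h1 : b ≤ a := hcrude.trans (mul_le_of_le_one_right ha0.le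
      (pow_le_one₀ (hsinpos (2 * γ) (by linarith) (by linarith)).le (Real.sin_le_one _)))
    rw [Real.cos_pi_div_two, Real.sin_pi_div_two, zero_pow (by omega), one_pow]
    nlinarith [Real.neg_one_le_cos ((q + 1) * (Real.pi / 2))]
  set H : ℝ → ℝ := fun t =>
    (a * Real.sin t ^ (q + 1) + b * Real.cos ((q + 1) * t)) / Real.cos t ^ (q + 1) with hH
  have hcospos : ∀ t ∈ Ico 0 (Real.pi / 2), 0 < Real.cos t := fun t ht =>
    Real.cos_pos_of_mem_Ioo ⟨by linarith [ht.1], ht.2⟩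
  have hder : ∀ t ∈ Ico 0 (Real.pi / 2), HasDerivAt H
      ((q + 1) * (a * Real.sin t ^ q - b * Real.sin (q * t)) / Real.cos t ^ (q + 2)) t := by
    intro t ht
    have h0 := hcospos t ht
    have := ((((Real.hasDerivAt_sin t).pow (q + 1)).const_mul a).add
      ((((hasDerivAt_id t).const_mul ((q:ℝ) + 1)).cos).const_mul b)).div
      ((Real.hasDerivAt_cos t).pow (q + 1)) (pow_pos h0 _).ne'
    refine this.congr_deriv ?_
    have e : Real.sin (q * t) = Real.sin ((q + 1) * t) * Real.cos t
        - Real.cos ((q + 1) * t) * Real.sin t := by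
      rw [← Real.sin_sub]; congr 1; ring
    simp only [Nat.add_sub_cancel, Pi.add_apply, Pi.pow_apply, id]
    rw [e, div_eq_div_iff (by positivity) (by positivity)]
    have hs2 : Real.sin t ^ 2 = 1 - Real.cos t ^ 2 := by rw [← Real.sin_sq_add_cos_sq t]; ring
    push_cast
    linear_combination ((q:ℝ) + 1) * a * Real.sin t ^ q * Real.cos t ^ (2 * q + 2) * hs2
  have hone : H γ = 1 := by
    simp only [hH]
    rw [hγq, Real.cos_pi_div_two, ha, div_pow]
    field_simp
    simp
  have h1 : 1 ≤ H s := by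
    rw [← hone]
    rcases le_total s γ with h | h
    · refine antitoneOn_of_deriv_nonpos (convex_Icc 0 γ) (fun t ht => (hder t
        ⟨ht.1, by linarith [ht.2]⟩).continuousAt.continuousWithinAt) (fun t ht => (hder t ?_
        ).differentiableAt.differentiableWithinAt) ?_ ⟨hs.1, h⟩ ⟨hγ0.le, le_rfl⟩ h
      · have := interior_subset ht; exact ⟨this.1, by linarith [this.2]⟩
      · intro t ht
        rw [interior_Icc] at ht
        have ht' : t ∈ Ico 0 (Real.pi / 2) := ⟨ht.1.le, by linarith [ht.2]⟩
        rw [(hder t ht').deriv]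
        have := hcospos t ht'
        have := hlow t ⟨ht.1, ht.2.le⟩
        exact div_nonpos_of_nonpos_of_nonneg
          (mul_nonpos_of_nonneg_of_nonpos (by positivity) (by linarith)) (by positivity)
    · refine monotoneOn_of_deriv_nonneg (convex_Icc γ s) (fun t ht => (hder t
        ⟨by linarith [ht.1], by linarith [ht.2]⟩).continuousAt.continuousWithinAt)
        (fun t ht => (hder t ?_
        ).differentiableAt.differentiableWithinAt) ?_ ⟨le_rfl, h⟩ ⟨h, le_rfl⟩ h
      · have := interior_subset ht; exact ⟨by linarith [this.1], by linarith [this.2]⟩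
      · intro t ht
        rw [interior_Icc] at ht
        have ht' : t ∈ Ico 0 (Real.pi / 2) := ⟨by linarith [ht.1], by linarith [ht.2]⟩
        rw [(hder t ht').deriv]
        have := hcospos t ht'
        have := hhigh t ht.1.le ht'.2.le
        exact div_nonneg (mul_nonneg (by positivity) (by linarith)) (by positivity)
  have h0 := hcospos s ⟨hs.1, hs2⟩
  rwa [hH, le_div_iff₀ (by positivity), one_mul] at h1

theorem cos_pow_le_sin_pow_add {n : ℕ} (hn : 1 ≤ n) {a b γ : ℝ}
    (hγ : γ = Real.pi / (2 * (2 * n)))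
    (hb : b = Real.cos γ ^ (2 * n - 1) / Real.sin γ)
    (ha : a = (Real.cos γ / Real.sin γ) ^ (2 * n)) (s : ℝ) :
    Real.cos s ^ (2 * n) ≤ a * Real.sin s ^ (2 * n) + b * Real.cos (2 * n * s) := by
  obtain ⟨q, hq⟩ : ∃ q, 2 * n = q + 1 := ⟨2 * n - 1, by omega⟩
  have hqr : (2 * n : ℝ) = q + 1 := by exact_mod_cast hq
  have h0 : 0 ≤ Real.arcsin |Real.sin s| := Real.arcsin_nonneg.2 (abs_nonneg _)
  have := cos_pow_le_of_mem_Icc (q := q) (by omega) (a := a) (b := b) (γ := γ)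
    (s := Real.arcsin |Real.sin s|) (by rw [hγ, hqr]) (by rw [hb, hq, Nat.add_sub_cancel])
    (by rw [ha, hq]) ⟨h0, Real.arcsin_le_pi_div_two _⟩
  have e1 : Real.sin (Real.arcsin |Real.sin s|) = |Real.sin s| :=
    Real.sin_arcsin (by linarith [abs_nonneg (Real.sin s)]) (Real.abs_sin_le_one s)
  have e2 : Real.cos (Real.arcsin |Real.sin s|) ^ 2 = Real.cos s ^ 2 := by
    rw [Real.cos_sq', e1, sq_abs, Real.cos_sq']
  have e3 : Real.cos (2 * n * Real.arcsin |Real.sin s|) = Real.cos (2 * n * s) := by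
    have h2 : Real.cos (2 * Real.arcsin |Real.sin s|) = Real.cos (2 * s) := by
      rw [Real.cos_two_mul, Real.cos_two_mul, e2]
    have T := fun x : ℝ => Polynomial.Chebyshev.T_real_cos x (n : ℤ)
    have T1 := T (2 * Real.arcsin |Real.sin s|)
    have T2 := T (2 * s)
    rw [h2] at T1
    rw [T1] at T2
    push_cast at T2
    rw [mul_comm 2 (n:ℝ), mul_assoc, mul_assoc, T2]
  rwa [← hqr, ← hq, e1, e3, pow_mul, e2, ← pow_mul, (even_two_mul n).pow_abs] at this

/-- Homogeneous form of the Pichorides-type inequality for even exponents. -/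
theorem re_pow_le_im_pow_add {n : ℕ} (hn : 1 ≤ n) {a b γ : ℝ}
    (hγ : γ = Real.pi / (2 * (2 * n)))
    (hb : b = Real.cos γ ^ (2 * n - 1) / Real.sin γ)
    (ha : a = (Real.cos γ / Real.sin γ) ^ (2 * n)) (w : ℂ) :
    w.re ^ (2 * n) ≤ a * w.im ^ (2 * n) + b * (w ^ (2 * n)).re := by
  have h := mul_le_mul_of_nonneg_left (cos_pow_le_sin_pow_add hn hγ hb ha w.arg)
    (pow_nonneg (norm_nonneg w) (2 * n))
  have e1 : w.re = ‖w‖ * Real.cos w.arg := (Complex.norm_mul_cos_arg w).symm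
  have e2 : w.im = ‖w‖ * Real.sin w.arg := (Complex.norm_mul_sin_arg w).symm
  have e3 : (w ^ (2 * n)).re = ‖w‖ ^ (2 * n) * Real.cos (2 * n * w.arg) := by
    conv_lhs => rw [← Complex.norm_mul_exp_arg_mul_I w]
    rw [mul_pow, ← Complex.exp_nat_mul, ← Complex.ofReal_pow, Complex.re_ofReal_mul]
    congr 1
    rw [← Complex.exp_ofReal_mul_I_re]
    congr 2
    push_cast; ring
  rw [e3]
  calc w.re ^ (2 * n) = ‖w‖ ^ (2 * n) * Real.cos w.arg ^ (2 * n) := by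
        conv_lhs => rw [e1]
        rw [mul_pow]
    _ ≤ _ := h
    _ = _ := by
      conv_rhs => rw [e2]
      rw [mul_pow]; ring

/-- Differentiation under the integral sign for jointly continuous data on a strip. -/
theorem hasDerivAt_intervalIntegral_of_continuousOn {F F₁ : ℝ → ℝ → ℝ} {l u a b : ℝ}
    (hF : ContinuousOn (fun x : ℝ × ℝ => F x.1 x.2) (Ioo l u ×ˢ univ))
    (hF₁ : ContinuousOn (fun x : ℝ × ℝ => F₁ x.1 x.2) (Ioo l u ×ˢ univ))
    (hd : ∀ r ∈ Ioo l u, ∀ t, HasDerivAt (fun r => F r t) (F₁ r t) r) {r : ℝ}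
    (hr : r ∈ Ioo l u) :
    HasDerivAt (fun r => ∫ t in a..b, F r t) (∫ t in a..b, F₁ r t) r := by
  have slice : ∀ {G : ℝ → ℝ → ℝ}, ContinuousOn (fun x : ℝ × ℝ => G x.1 x.2) (Ioo l u ×ˢ univ) →
      ∀ r ∈ Ioo l u, Continuous (G r) := by
    intro G hG r hr
    rw [← continuousOn_univ]
    exact hG.comp (f := fun t : ℝ => (r, t)) (by fun_prop) fun t _ => ⟨hr, mem_univ _⟩
  obtain ⟨δ, hδ, hsub⟩ := Metric.nhds_basis_closedBall.mem_iff.1 (Ioo_mem_nhds hr.1 hr.2)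
  have hK : IsCompact (Metric.closedBall r δ ×ˢ uIcc a b) :=
    (isCompact_closedBall r δ).prod isCompact_uIcc
  obtain ⟨C, hC⟩ := hK.exists_bound_of_continuousOn
    (hF₁.mono (prod_mono hsub (subset_univ _)))
  refine (intervalIntegral.hasDerivAt_integral_of_dominated_loc_of_deriv_le
    (F := F) (F' := F₁) (bound := fun _ => C) (Metric.closedBall_mem_nhds r hδ) ?_ ?_ ?_ ?_ ?_ ?_).2
  · filter_upwards [Ioo_mem_nhds hr.1 hr.2] with x hx
    exact (slice hF x hx).aestronglyMeasurable
  · exact (slice hF r hr).intervalIntegrable _ _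
  · exact (slice hF₁ r hr).aestronglyMeasurable
  · exact Filter.Eventually.of_forall fun t ht x hx => hC (x, t) ⟨hx, uIoc_subset_uIcc ht⟩
  · exact intervalIntegrable_const
  · exact Filter.Eventually.of_forall fun t ht x hx => hd x (hsub hx) t

/-- The super-mean-value property in polar coordinates: if `r ∂ᵣW + r² ∂ᵣ²W + ∂ₜ²W ≤ 0`
then circular means do not exceed the value at the centre. -/
theorem integral_circle_le_of_polar_laplacian_nonpos {W W₁ W₂ T₁ T₂ : ℝ → ℝ → ℝ} {w₀ : ℝ}
    (hW : ContinuousOn (fun x : ℝ × ℝ => W x.1 x.2) (Ioo (-1) 1 ×ˢ univ))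
    (hW₁ : ContinuousOn (fun x : ℝ × ℝ => W₁ x.1 x.2) (Ioo (-1) 1 ×ˢ univ))
    (hW₂ : ContinuousOn (fun x : ℝ × ℝ => W₂ x.1 x.2) (Ioo (-1) 1 ×ˢ univ))
    (hT₂ : ∀ r ∈ Ioo (-1 : ℝ) 1, Continuous (T₂ r))
    (d₁ : ∀ r ∈ Ioo (-1 : ℝ) 1, ∀ t, HasDerivAt (fun r => W r t) (W₁ r t) r)
    (d₂ : ∀ r ∈ Ioo (-1 : ℝ) 1, ∀ t, HasDerivAt (fun r => W₁ r t) (W₂ r t) r)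
    (e₂ : ∀ r ∈ Ioo (-1 : ℝ) 1, ∀ t, HasDerivAt (T₁ r) (T₂ r t) t)
    (hper : ∀ r ∈ Ioo (-1 : ℝ) 1, T₁ r (2 * Real.pi) = T₁ r 0)
    (h0 : ∀ t, W 0 t = w₀)
    (hlap : ∀ r ∈ Ioo (0 : ℝ) 1, ∀ t, r * W₁ r t + r ^ 2 * W₂ r t + T₂ r t ≤ 0)
    {r : ℝ} (hr : r ∈ Ico (0 : ℝ) 1) :
    ∫ t in (0:ℝ)..(2 * Real.pi), W r t ≤ 2 * Real.pi * w₀ := by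
  have slice : ∀ {G : ℝ → ℝ → ℝ},
      ContinuousOn (fun x : ℝ × ℝ => G x.1 x.2) (Ioo (-1) 1 ×ˢ univ) →
      ∀ r ∈ Ioo (-1 : ℝ) 1, Continuous (G r) := by
    intro G hG r hr
    rw [← continuousOn_univ]
    exact hG.comp (f := fun t : ℝ => (r, t)) (by fun_prop) fun t _ => ⟨hr, mem_univ _⟩
  set φ : ℝ → ℝ := fun r => ∫ t in (0:ℝ)..(2 * Real.pi), W r t with hφ
  set φ₁ : ℝ → ℝ := fun r => ∫ t in (0:ℝ)..(2 * Real.pi), W₁ r t with hφ₁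
  set φ₂ : ℝ → ℝ := fun r => ∫ t in (0:ℝ)..(2 * Real.pi), W₂ r t with hφ₂
  have D₁ : ∀ r ∈ Ioo (-1 : ℝ) 1, HasDerivAt φ (φ₁ r) r := fun r hr =>
    hasDerivAt_intervalIntegral_of_continuousOn hW hW₁ d₁ hr
  have D₂ : ∀ r ∈ Ioo (-1 : ℝ) 1, HasDerivAt φ₁ (φ₂ r) r := fun r hr =>
    hasDerivAt_intervalIntegral_of_continuousOn hW₁ hW₂ d₂ hr
  have hsub : ∀ r ∈ Ico (0 : ℝ) 1, r ∈ Ioo (-1 : ℝ) 1 := fun r hr => ⟨by linarith [hr.1], hr.2⟩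
  have Dψ : ∀ r ∈ Ioo (-1 : ℝ) 1, HasDerivAt (fun r => r * φ₁ r) (φ₁ r + r * φ₂ r) r := by
    intro r hr
    exact ((hasDerivAt_id r).mul (D₂ r hr)).congr_deriv (by simp)
  have hψ : AntitoneOn (fun r => r * φ₁ r) (Ico 0 1) := by
    refine antitoneOn_of_deriv_nonpos (convex_Ico 0 1)
      (fun r hr => (Dψ r (hsub r hr)).continuousAt.continuousWithinAt)
      (fun r hr => (Dψ r (hsub r (interior_subset hr))).differentiableAt.differentiableWithinAt) ?_
    intro r hr
    rw [interior_Ico] at hr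
    have hr' := hsub r ⟨hr.1.le, hr.2⟩
    rw [(Dψ r hr').deriv]
    have hT : ∫ t in (0:ℝ)..(2 * Real.pi), T₂ r t = 0 := by
      rw [intervalIntegral.integral_eq_sub_of_hasDerivAt (fun t _ => e₂ r hr' t)
        ((hT₂ r hr').intervalIntegrable _ _), hper r hr', sub_self]
    have i1 := ((slice hW₁ r hr').const_mul r).intervalIntegrable (μ := volume) 0 (2 * Real.pi)
    have i2 := ((slice hW₂ r hr').const_mul (r ^ 2)).intervalIntegrable (μ := volume)
      0 (2 * Real.pi)
    have i3 := (hT₂ r hr').intervalIntegrable (μ := volume) 0 (2 * Real.pi)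
    have key : r * (φ₁ r + r * φ₂ r) =
        ∫ t in (0:ℝ)..(2 * Real.pi), (r * W₁ r t + r ^ 2 * W₂ r t + T₂ r t) := by
      rw [intervalIntegral.integral_add (i1.add i2) i3, intervalIntegral.integral_add i1 i2, hT,
        intervalIntegral.integral_const_mul, intervalIntegral.integral_const_mul]
      ring
    have : r * (φ₁ r + r * φ₂ r) ≤ 0 := by
      rw [key]
      have := intervalIntegral.integral_mono_on (μ := volume) (by positivity : 0 ≤ 2 * Real.pi)
        ((i1.add i2).add i3) intervalIntegrable_const (fun t _ => hlap r hr t)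
      simpa using this
    exact nonpos_of_mul_nonpos_right this hr.1
  have hφ₁0 : ∀ r ∈ Ioo (0 : ℝ) 1, φ₁ r ≤ 0 := by
    intro r hr
    have := hψ (a := 0) (b := r) ⟨le_rfl, one_pos⟩ ⟨hr.1.le, hr.2⟩ hr.1.le
    simp only [zero_mul] at this
    exact nonpos_of_mul_nonpos_right this hr.1
  have hanti : AntitoneOn φ (Ico 0 1) := by
    refine antitoneOn_of_deriv_nonpos (convex_Ico 0 1)
      (fun r hr => (D₁ r (hsub r hr)).continuousAt.continuousWithinAt)
      (fun r hr => (D₁ r (hsub r (interior_subset hr))).differentiableAt.differentiableWithinAt) ?_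
    intro r hr
    rw [interior_Ico] at hr
    rw [(D₁ r (hsub r ⟨hr.1.le, hr.2⟩)).deriv]
    exact hφ₁0 r hr
  have := hanti (a := 0) (b := r) ⟨le_rfl, one_pos⟩ hr hr.1
  simpa [hφ, h0] using this

theorem re_conj_pow_laplacian_le {k : ℕ} {κ : ℝ} (a b w : ℂ) (hκ : 0 ≤ κ)
    (hab : 4 * (‖a‖ * ‖b‖) ≤ κ * (‖a‖ - ‖b‖) ^ 2) :
    (w ^ (2 * k) * (4 * (a * (starRingEnd ℂ) b))).re ≤
      κ * 2 ^ (k - 1) * (w.re ^ (2 * k) * ‖a + b‖ ^ 2 + w.im ^ (2 * k) * ‖a - b‖ ^ 2) := by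
  have h1 : (w ^ (2 * k) * (4 * (a * (starRingEnd ℂ) b))).re ≤
      ‖w‖ ^ (2 * k) * (4 * (‖a‖ * ‖b‖)) := by
    refine (Complex.re_le_norm _).trans_eq ?_
    simp
  have h2 : ‖w‖ ^ (2 * k) ≤ 2 ^ (k - 1) * (w.re ^ (2 * k) + w.im ^ (2 * k)) := by
    rw [pow_mul, pow_mul, pow_mul, Complex.sq_norm, Complex.normSq_apply, ← pow_two, ← pow_two]
    exact add_pow_le (sq_nonneg _) (sq_nonneg _) k
  have h3 : (‖a‖ - ‖b‖) ^ 2 ≤ ‖a + b‖ ^ 2 := by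
    rw [sq_le_sq, abs_norm]
    simpa using abs_norm_sub_norm_le a (-b)
  have h4 : (‖a‖ - ‖b‖) ^ 2 ≤ ‖a - b‖ ^ 2 := by
    rw [sq_le_sq, abs_norm]
    exact abs_norm_sub_norm_le a b
  have p1 : 0 ≤ w.re ^ (2 * k) := (even_two_mul k).pow_nonneg _
  have p2 : 0 ≤ w.im ^ (2 * k) := (even_two_mul k).pow_nonneg _
  calc _ ≤ ‖w‖ ^ (2 * k) * (4 * (‖a‖ * ‖b‖)) := h1
    _ ≤ (2 ^ (k - 1) * (w.re ^ (2 * k) + w.im ^ (2 * k))) * (κ * (‖a‖ - ‖b‖) ^ 2) := by gcongr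
    _ = κ * 2 ^ (k - 1) *
        (w.re ^ (2 * k) * (‖a‖ - ‖b‖) ^ 2 + w.im ^ (2 * k) * (‖a‖ - ‖b‖) ^ 2) := by ring
    _ ≤ _ := by gcongr

/-- The potential `Re w^(m+2) - ε ((Re w)^(m+2) + (Im w)^(m+2))`. -/
noncomputable def powPotential (m : ℕ) (ε : ℝ) (w : ℂ) : ℝ :=
  (w ^ (m + 2)).re - ε * (w.re ^ (m + 2) + w.im ^ (m + 2))

/-- First derivative of `powPotential` along a curve through `w` with velocity `w₁`. -/
noncomputable def powPotentialDeriv (m : ℕ) (ε : ℝ) (w w₁ : ℂ) : ℝ :=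
  (m + 2) * ((w ^ (m + 1) * w₁).re - ε * (w.re ^ (m + 1) * w₁.re + w.im ^ (m + 1) * w₁.im))

/-- Second derivative of `powPotential` along a curve through `w` with velocity `w₁` and
acceleration `w₂`. -/
noncomputable def powPotentialDeriv₂ (m : ℕ) (ε : ℝ) (w w₁ w₂ : ℂ) : ℝ :=
  (m + 2) * (((m + 1) * (w ^ m * w₁ ^ 2).re + (w ^ (m + 1) * w₂).re) -
    ε * (((m + 1) * (w.re ^ m * w₁.re ^ 2) + w.re ^ (m + 1) * w₂.re) +
      ((m + 1) * (w.im ^ m * w₁.im ^ 2) + w.im ^ (m + 1) * w₂.im)))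

theorem hasDerivAt_re_comp {w : ℝ → ℂ} {w₁ : ℂ} {x : ℝ} (h : HasDerivAt w w₁ x) :
    HasDerivAt (fun x => (w x).re) w₁.re x :=
  Complex.reCLM.hasFDerivAt.comp_hasDerivAt x h

theorem hasDerivAt_im_comp {w : ℝ → ℂ} {w₁ : ℂ} {x : ℝ} (h : HasDerivAt w w₁ x) :
    HasDerivAt (fun x => (w x).im) w₁.im x :=
  Complex.imCLM.hasFDerivAt.comp_hasDerivAt x h

theorem hasDerivAt_powPotential (m : ℕ) (ε : ℝ) {w : ℝ → ℂ} {w₁ : ℂ} {x : ℝ}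
    (h : HasDerivAt w w₁ x) :
    HasDerivAt (fun x => powPotential m ε (w x)) (powPotentialDeriv m ε (w x) w₁) x := by
  refine ((hasDerivAt_re_comp (h.pow (m + 2))).sub
    ((((hasDerivAt_re_comp h).pow (m + 2)).add
      ((hasDerivAt_im_comp h).pow (m + 2))).const_mul ε)).congr_deriv ?_
  have e : ((m + 2 : ℕ) : ℂ) * w x ^ (m + 1) * w₁ =
      ((m + 2 : ℝ) : ℂ) * (w x ^ (m + 1) * w₁) := by push_cast; ring
  simp only [show m + 2 - 1 = m + 1 from rfl, powPotentialDeriv]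
  rw [e, Complex.re_ofReal_mul]
  push_cast
  ring

theorem hasDerivAt_powPotentialDeriv (m : ℕ) (ε : ℝ) {w w₁ : ℝ → ℂ} {w₂ : ℂ} {x : ℝ}
    (h : HasDerivAt w (w₁ x) x) (h₁ : HasDerivAt w₁ w₂ x) :
    HasDerivAt (fun x => powPotentialDeriv m ε (w x) (w₁ x))
      (powPotentialDeriv₂ m ε (w x) (w₁ x) w₂) x := by
  refine (((hasDerivAt_re_comp ((h.pow (m + 1)).mul h₁)).sub
    (((((hasDerivAt_re_comp h).pow (m + 1)).mul (hasDerivAt_re_comp h₁)).add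
      (((hasDerivAt_im_comp h).pow (m + 1)).mul (hasDerivAt_im_comp h₁))).const_mul ε)).const_mul
      ((m:ℝ) + 2)).congr_deriv ?_
  have e : ((m + 1 : ℕ) : ℂ) * w x ^ m * w₁ x * w₁ x =
      ((m + 1 : ℝ) : ℂ) * (w x ^ m * w₁ x ^ 2) := by push_cast; ring
  simp only [Nat.add_sub_cancel, powPotentialDeriv₂, Pi.pow_apply]
  rw [e, Complex.add_re, Complex.re_ofReal_mul]
  push_cast
  ring

theorem polar_laplacian_powPotential (m : ℕ) (ε r : ℝ) {w w₁ w₂ v v₂ : ℂ}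
    (h : r * w₁ + r ^ 2 * w₂ + v₂ = 0) :
    r * powPotentialDeriv m ε w w₁ + r ^ 2 * powPotentialDeriv₂ m ε w w₁ w₂ +
        powPotentialDeriv₂ m ε w v v₂ =
      (m + 2) * (m + 1) * ((w ^ m * ((r * w₁) ^ 2 + v ^ 2)).re -
        ε * (w.re ^ m * ((r * w₁).re ^ 2 + v.re ^ 2) + w.im ^ m * ((r * w₁).im ^ 2 + v.im ^ 2))) := by
  have hre : r * w₁.re + r ^ 2 * w₂.re + v₂.re = 0 := by
    have := congrArg Complex.re h
    simpa [← Complex.ofReal_pow] using this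
  have him : r * w₁.im + r ^ 2 * w₂.im + v₂.im = 0 := by
    have := congrArg Complex.im h
    simpa [← Complex.ofReal_pow] using this
  have e1 : (w ^ m * ((r * w₁) ^ 2 + v ^ 2)).re =
      r ^ 2 * (w ^ m * w₁ ^ 2).re + (w ^ m * v ^ 2).re := by
    rw [← Complex.re_ofReal_mul, ← Complex.add_re]; congr 1; push_cast; ring
  have e2 : r * (w ^ (m + 1) * w₁).re + r ^ 2 * (w ^ (m + 1) * w₂).re +
      (w ^ (m + 1) * v₂).re = 0 := by
    rw [← Complex.re_ofReal_mul, ← Complex.re_ofReal_mul, ← Complex.add_re, ← Complex.add_re]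
    have : (r : ℂ) * (w ^ (m + 1) * w₁) + ((r ^ 2 : ℝ) : ℂ) * (w ^ (m + 1) * w₂) +
        w ^ (m + 1) * v₂ = w ^ (m + 1) * (r * w₁ + r ^ 2 * w₂ + v₂) := by push_cast; ring
    rw [this, h]; simp
  rw [e1, Complex.re_ofReal_mul, Complex.im_ofReal_mul]
  simp only [powPotentialDeriv, powPotentialDeriv₂]
  linear_combination ((m:ℝ) + 2) * e2 - ((m:ℝ) + 2) * ε * w.re ^ (m + 1) * hre -
    ((m:ℝ) + 2) * ε * w.im ^ (m + 1) * him

/-- Circular means of the potential of a harmonic mapping with small analytic distortion. -/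
theorem integral_powPotential_le {k : ℕ} {κ : ℝ} (hκ : 0 ≤ κ) {h g : ℂ → ℂ}
    (hh : DifferentiableOn ℂ h (Metric.ball 0 1)) (hg : DifferentiableOn ℂ g (Metric.ball 0 1))
    (hqr : ∀ z ∈ Metric.ball (0 : ℂ) 1,
      4 * (‖deriv h z‖ * ‖deriv g z‖) ≤ κ * (‖deriv h z‖ - ‖deriv g z‖) ^ 2)
    {r : ℝ} (hr : r ∈ Ico (0 : ℝ) 1) :
    ∫ t in (0:ℝ)..(2 * Real.pi), powPotential (2 * k) (κ * 2 ^ (k - 1))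
        (h (r * Complex.exp (t * I)) + (starRingEnd ℂ) (g (r * Complex.exp (t * I)))) ≤
      2 * Real.pi * powPotential (2 * k) (κ * 2 ^ (k - 1)) (h 0 + (starRingEnd ℂ) (g 0)) := by
  set ε : ℝ := κ * 2 ^ (k - 1) with hε
  set z : ℝ → ℝ → ℂ := fun r t => r * Complex.exp (t * I) with hz
  have hzb : ∀ r ∈ Ioo (-1 : ℝ) 1, ∀ t, z r t ∈ Metric.ball (0 : ℂ) 1 := by
    intro r hr t
    simpa [hz, Complex.norm_exp_ofReal_mul_I] using abs_lt.2 hr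
  have hzc : ContinuousOn (fun x : ℝ × ℝ => z x.1 x.2) (Ioo (-1) 1 ×ˢ univ) := by
    simp only [hz]; fun_prop
  have hcomp : ∀ {G : ℂ → ℂ}, DifferentiableOn ℂ G (Metric.ball 0 1) →
      ContinuousOn (fun x : ℝ × ℝ => G (z x.1 x.2)) (Ioo (-1) 1 ×ˢ univ) := fun hG =>
    hG.continuousOn.comp hzc fun x hx => hzb x.1 hx.1 x.2
  have hh₁ := hh.deriv Metric.isOpen_ball
  have hh₂ := hh₁.deriv Metric.isOpen_ball
  have hg₁ := hg.deriv Metric.isOpen_ball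
  have hg₂ := hg₁.deriv Metric.isOpen_ball
  have zr : ∀ r t, HasDerivAt (fun r => z r t) (Complex.exp (t * I)) r := by
    intro r t
    simpa [hz] using (Complex.ofRealCLM.hasDerivAt (x := r)).mul_const (Complex.exp (t * I))
  have et : ∀ t : ℝ, HasDerivAt (fun t : ℝ => Complex.exp (t * I)) (Complex.exp (t * I) * I) t := by
    intro t
    simpa using ((Complex.ofRealCLM.hasDerivAt (x := t)).mul_const I).cexp
  have zt : ∀ r t, HasDerivAt (z r) (z r t * I) t := by
    intro r t
    simpa [hz, mul_assoc] using (et t).const_mul (r : ℂ)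
  have cr : ∀ {G : ℂ → ℂ}, DifferentiableOn ℂ G (Metric.ball 0 1) → ∀ r ∈ Ioo (-1 : ℝ) 1, ∀ t,
      HasDerivAt (fun r => G (z r t)) (deriv G (z r t) * Complex.exp (t * I)) r := by
    intro G hG r hr t
    exact ((hG.differentiableAt (Metric.isOpen_ball.mem_nhds
      (hzb r hr t))).hasDerivAt.comp r (zr r t))
  have ct : ∀ {G : ℂ → ℂ}, DifferentiableOn ℂ G (Metric.ball 0 1) → ∀ r ∈ Ioo (-1 : ℝ) 1, ∀ t,
      HasDerivAt (fun t => G (z r t)) (deriv G (z r t) * (z r t * I)) t := by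
    intro G hG r hr t
    exact ((hG.differentiableAt (Metric.isOpen_ball.mem_nhds
      (hzb r hr t))).hasDerivAt.comp t (zt r t))
  set w : ℝ → ℝ → ℂ := fun r t => h (z r t) + (starRingEnd ℂ) (g (z r t)) with hw
  set w₁ : ℝ → ℝ → ℂ := fun r t => deriv h (z r t) * Complex.exp (t * I) +
    (starRingEnd ℂ) (deriv g (z r t) * Complex.exp (t * I)) with hw₁
  set w₂ : ℝ → ℝ → ℂ := fun r t =>
    deriv (deriv h) (z r t) * Complex.exp (t * I) * Complex.exp (t * I) +
    (starRingEnd ℂ) (deriv (deriv g) (z r t) * Complex.exp (t * I) * Complex.exp (t * I)) with hw₂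
  set v : ℝ → ℝ → ℂ := fun r t => deriv h (z r t) * (z r t * I) +
    (starRingEnd ℂ) (deriv g (z r t) * (z r t * I)) with hv
  set v₂ : ℝ → ℝ → ℂ := fun r t =>
    (deriv (deriv h) (z r t) * (z r t * I) * (z r t * I) + deriv h (z r t) * (z r t * I * I)) +
    (starRingEnd ℂ) (deriv (deriv g) (z r t) * (z r t * I) * (z r t * I) +
      deriv g (z r t) * (z r t * I * I)) with hv₂
  have conjd : ∀ {G : ℝ → ℂ} {G' : ℂ} {x : ℝ}, HasDerivAt G G' x →
      HasDerivAt (fun x => (starRingEnd ℂ) (G x)) ((starRingEnd ℂ) G') x := fun hG =>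
    (Complex.conjCLE : ℂ →L[ℝ] ℂ).hasFDerivAt.comp_hasDerivAt _ hG
  have dw : ∀ r ∈ Ioo (-1 : ℝ) 1, ∀ t, HasDerivAt (fun r => w r t) (w₁ r t) r := fun r hr t =>
    (cr hh r hr t).add (conjd (cr hg r hr t))
  have dw₁ : ∀ r ∈ Ioo (-1 : ℝ) 1, ∀ t, HasDerivAt (fun r => w₁ r t) (w₂ r t) r := fun r hr t =>
    ((cr hh₁ r hr t).mul_const _).add (conjd ((cr hg₁ r hr t).mul_const _))
  have dv : ∀ r ∈ Ioo (-1 : ℝ) 1, ∀ t, HasDerivAt (w r) (v r t) t := fun r hr t =>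
    (ct hh r hr t).add (conjd (ct hg r hr t))
  have dv₁ : ∀ r ∈ Ioo (-1 : ℝ) 1, ∀ t, HasDerivAt (v r) (v₂ r t) t := fun r hr t =>
    ((ct hh₁ r hr t).mul ((zt r t).mul_const I)).add
      (conjd ((ct hg₁ r hr t).mul ((zt r t).mul_const I)))
  have cw : ContinuousOn (fun x : ℝ × ℝ => w x.1 x.2) (Ioo (-1) 1 ×ˢ univ) :=
    (hcomp hh).add (Complex.continuous_conj.comp_continuousOn (hcomp hg))
  have contE : ContinuousOn (fun x : ℝ × ℝ => Complex.exp (x.2 * I)) (Ioo (-1 : ℝ) 1 ×ˢ univ) := by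
    fun_prop
  have cw₁ : ContinuousOn (fun x : ℝ × ℝ => w₁ x.1 x.2) (Ioo (-1) 1 ×ˢ univ) :=
    ((hcomp hh₁).mul contE).add (Complex.continuous_conj.comp_continuousOn ((hcomp hg₁).mul contE))
  have cw₂ : ContinuousOn (fun x : ℝ × ℝ => w₂ x.1 x.2) (Ioo (-1) 1 ×ˢ univ) :=
    (((hcomp hh₂).mul contE).mul contE).add
      (Complex.continuous_conj.comp_continuousOn (((hcomp hg₂).mul contE).mul contE))
  have slice : ∀ {G : ℂ → ℂ}, DifferentiableOn ℂ G (Metric.ball 0 1) → ∀ r ∈ Ioo (-1 : ℝ) 1,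
      Continuous fun t => G (z r t) := by
    intro G hG r hr
    rw [← continuousOn_univ]
    exact (hcomp hG).comp (f := fun t : ℝ => (r, t)) (by fun_prop) fun t _ => ⟨hr, mem_univ _⟩
  refine integral_circle_le_of_polar_laplacian_nonpos
    (W := fun r t => powPotential (2 * k) ε (w r t))
    (W₁ := fun r t => powPotentialDeriv (2 * k) ε (w r t) (w₁ r t))
    (W₂ := fun r t => powPotentialDeriv₂ (2 * k) ε (w r t) (w₁ r t) (w₂ r t))
    (T₁ := fun r t => powPotentialDeriv (2 * k) ε (w r t) (v r t))
    (T₂ := fun r t => powPotentialDeriv₂ (2 * k) ε (w r t) (v r t) (v₂ r t))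
    ?_ ?_ ?_ ?_ ?_ ?_ ?_ ?_ ?_ ?_ hr
  · unfold powPotential
    fun_prop
  · unfold powPotentialDeriv
    fun_prop
  · unfold powPotentialDeriv₂
    fun_prop
  · intro r hr
    have c0 := slice hh r hr
    have c1 := slice hh₁ r hr
    have c2 := slice hh₂ r hr
    have d0 := slice hg r hr
    have d1 := slice hg₁ r hr
    have d2 := slice hg₂ r hr
    have cz : Continuous fun t => z r t := by simp only [hz]; fun_prop
    have q0 : Continuous fun t => w r t := c0.add (Complex.continuous_conj.comp d0)
    have q1 : Continuous fun t => v r t := by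
      simp only [hv]
      exact (c1.mul (cz.mul_const I)).add (Complex.continuous_conj.comp (d1.mul (cz.mul_const I)))
    have q2 : Continuous fun t => v₂ r t := by
      simp only [hv₂]
      fun_prop
    unfold powPotentialDeriv₂
    fun_prop
  · exact fun r hr t => hasDerivAt_powPotential _ _ (dw r hr t)
  · exact fun r hr t => hasDerivAt_powPotentialDeriv _ _ (w := fun r => w r t)
      (w₁ := fun r => w₁ r t) (dw r hr t) (dw₁ r hr t)
  · exact fun r hr t => hasDerivAt_powPotentialDeriv _ _ (dv r hr t) (dv₁ r hr t)
  · intro r _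
    have : z r (2 * Real.pi) = z r 0 := by
      simp [hz, Complex.exp_two_pi_mul_I]
    simp only [hw, hv, this]
  · intro t
    simp [hw, hz]
  · intro r hr t
    have hr' : r ∈ Ioo (-1 : ℝ) 1 := ⟨by linarith [hr.1], hr.2⟩
    have hs : (r : ℂ) * w₁ r t + (r : ℂ) ^ 2 * w₂ r t + v₂ r t = 0 := by
      simp only [hw₁, hw₂, hv₂, hz, map_add, map_mul, Complex.conj_ofReal, Complex.conj_I]
      ring_nf
      simp only [Complex.I_sq]
      ring
    have := polar_laplacian_powPotential (2 * k) ε r (w := w r t) (v := v r t) hs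
    rw [this]
    set a := z r t * deriv h (z r t) with ha
    set b := z r t * deriv g (z r t) with hb
    have ew : (r : ℂ) * w₁ r t = a + (starRingEnd ℂ) b := by
      simp only [hw₁, ha, hb, hz, map_mul, Complex.conj_ofReal]; ring
    have ev : v r t = I * a - I * (starRingEnd ℂ) b := by
      simp only [hv, ha, hb, map_mul, Complex.conj_I]; ring
    have e1 : (r * w₁ r t) ^ 2 + v r t ^ 2 = 4 * (a * (starRingEnd ℂ) b) := by
      rw [ew, ev]; ring_nf; simp only [Complex.I_sq]; ring
    have e2 : (r * w₁ r t).re ^ 2 + (v r t).re ^ 2 = ‖a + b‖ ^ 2 := by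
      rw [ew, ev, Complex.sq_norm, Complex.normSq_apply]; simp; ring
    have e3 : (r * w₁ r t).im ^ 2 + (v r t).im ^ 2 = ‖a - b‖ ^ 2 := by
      rw [ew, ev, Complex.sq_norm, Complex.normSq_apply]; simp; ring
    have hab : 4 * (‖a‖ * ‖b‖) ≤ κ * (‖a‖ - ‖b‖) ^ 2 := by
      have := mul_le_mul_of_nonneg_left (hqr _ (hzb r hr' t)) (sq_nonneg ‖z r t‖)
      rw [ha, hb, norm_mul (z r t), norm_mul (z r t)]
      linarith
    have key := re_conj_pow_laplacian_le (k := k) a b (w r t) hκ hab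
    rw [e1, e2, e3]
    exact mul_nonpos_of_nonneg_of_nonpos (by positivity) (by linarith)

theorem four_mul_le_of_quasiregular {x y K : ℝ} (hx : 0 ≤ x) (hy : 0 ≤ y)
    (h : (x + y) ^ 2 ≤ K * (x ^ 2 - y ^ 2)) :
    4 * (x * y) ≤ (K ^ 2 - 1) * (x - y) ^ 2 := by
  rcases (add_nonneg hx hy).eq_or_lt with h0 | h0
  · obtain rfl : x = 0 := by linarith
    obtain rfl : y = 0 := by linarith
    simp
  have h1 : x + y ≤ K * (x - y) := by
    refine le_of_mul_le_mul_left ?_ h0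
    linarith
  have h2 := pow_le_pow_left₀ h0.le h1 2
  linarith

/-- The circle-wise form of the Riesz-type inequality for the harmonic mapping `h + conj g`. -/
theorem integral_im_pow_le {k : ℕ} {K a b γ r : ℝ} (hK : 1 ≤ K) {h g : ℂ → ℂ}
    (hγ : γ = Real.pi / (2 * (2 * (k + 1 : ℕ))))
    (hb : b = Real.cos γ ^ (2 * (k + 1) - 1) / Real.sin γ)
    (ha : a = (Real.cos γ / Real.sin γ) ^ (2 * (k + 1))) (hb0 : 0 ≤ b)
    (hh : DifferentiableOn ℂ h (Metric.ball 0 1)) (hg : DifferentiableOn ℂ g (Metric.ball 0 1))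
    (hqr : ∀ z ∈ Metric.ball (0:ℂ) 1,
      (‖deriv h z‖ + ‖deriv g z‖) ^ 2 ≤ K * (‖deriv h z‖ ^ 2 - ‖deriv g z‖ ^ 2))
    (h0 : ((-I * (h 0 + (starRingEnd ℂ) (g 0))) ^ (2 * (k + 1))).re ≤ 0)
    (hr : r ∈ Ico (0:ℝ) 1) {F : ℝ → ℂ}
    (hF : F = fun t : ℝ =>
      h (r * Complex.exp (t * I)) + (starRingEnd ℂ) (g (r * Complex.exp (t * I)))) :
    (1 - (K ^ 2 - 1) * b * 2 ^ (k - 1)) * ∫ t in (0:ℝ)..(2 * Real.pi), (F t).im ^ (2 * (k + 1)) ≤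
      (a + (K ^ 2 - 1) * b * 2 ^ (k - 1)) *
        ∫ t in (0:ℝ)..(2 * Real.pi), (F t).re ^ (2 * (k + 1)) := by
  have hκ : 0 ≤ K ^ 2 - 1 := by nlinarith
  have hFc : Continuous F := by
    have hz : ∀ t : ℝ, (r : ℂ) * Complex.exp (t * I) ∈ Metric.ball (0 : ℂ) 1 := by
      intro t
      simpa [Complex.norm_exp_ofReal_mul_I, abs_of_nonneg hr.1] using hr.2
    have c := hh.continuousOn.comp_continuous (f := fun t : ℝ => (r : ℂ) * Complex.exp (t * I))
      (by fun_prop) hz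
    have d := hg.continuousOn.comp_continuous (f := fun t : ℝ => (r : ℂ) * Complex.exp (t * I))
      (by fun_prop) hz
    rw [hF]
    exact c.add (Complex.continuous_conj.comp d)
  have hrot : ∀ z : ℂ, -I * h z + (starRingEnd ℂ) (I * g z) =
      -I * (h z + (starRingEnd ℂ) (g z)) := by
    intro z; rw [map_mul, Complex.conj_I]; ring
  have hS := integral_powPotential_le (k := k) hκ (hh.const_mul (-I)) (hg.const_mul I)
    (fun z hz => by
      have := four_mul_le_of_quasiregular (norm_nonneg _) (norm_nonneg _) (hqr z hz)
      simpa [deriv_const_mul_field] using this) hr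
  simp only [hrot] at hS
  set ε : ℝ := (K ^ 2 - 1) * 2 ^ (k - 1) with hε
  have hε0 : 0 ≤ ε := by positivity
  have hev : ∀ x : ℝ, (-x) ^ (2 * (k + 1)) = x ^ (2 * (k + 1)) := (even_two_mul _).neg_pow
  have hre : ∀ w : ℂ, (-I * w).re = w.im := by intro w; simp
  have him : ∀ w : ℂ, (-I * w).im = -w.re := by intro w; simp
  have hpot : ∀ w : ℂ, powPotential (2 * k) ε (-I * w) = ((-I * w) ^ (2 * (k + 1))).re -
      ε * (w.im ^ (2 * (k + 1)) + w.re ^ (2 * (k + 1))) := by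
    intro w
    unfold powPotential
    rw [hre, him, show 2 * k + 2 = 2 * (k + 1) from rfl, hev]
  have hcent : powPotential (2 * k) ε (-I * (h 0 + (starRingEnd ℂ) (g 0))) ≤ 0 := by
    rw [hpot]
    have := (even_two_mul (k + 1)).pow_nonneg (h 0 + (starRingEnd ℂ) (g 0)).im
    have := (even_two_mul (k + 1)).pow_nonneg (h 0 + (starRingEnd ℂ) (g 0)).re
    have : 0 ≤ ε * ((h 0 + (starRingEnd ℂ) (g 0)).im ^ (2 * (k + 1)) +
      (h 0 + (starRingEnd ℂ) (g 0)).re ^ (2 * (k + 1))) := by positivity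
    linarith
  have hS' : ∫ t in (0:ℝ)..(2 * Real.pi), powPotential (2 * k) ε (-I * F t) ≤ 0 := by
    rw [hF]
    exact hS.trans (mul_nonpos_of_nonneg_of_nonpos (by positivity) hcent)
  have hpt : ∀ t, (1 - ε * b) * (F t).im ^ (2 * (k + 1)) ≤
      (a + ε * b) * (F t).re ^ (2 * (k + 1)) + b * powPotential (2 * k) ε (-I * F t) := by
    intro t
    have := re_pow_le_im_pow_add (n := k + 1) (by omega) hγ hb ha (-I * F t)
    rw [hre, him, hev] at this
    rw [hpot]
    linarith
  have i1 : IntervalIntegrable (fun t => (F t).re ^ (2 * (k + 1))) volume 0 (2 * Real.pi) :=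
    Continuous.intervalIntegrable (by fun_prop) _ _
  have i2 : IntervalIntegrable (fun t => (F t).im ^ (2 * (k + 1))) volume 0 (2 * Real.pi) :=
    Continuous.intervalIntegrable (by fun_prop) _ _
  have i3 : IntervalIntegrable (fun t => powPotential (2 * k) ε (-I * F t)) volume
      0 (2 * Real.pi) :=
    Continuous.intervalIntegrable (by unfold powPotential; fun_prop) _ _
  have := intervalIntegral.integral_mono_on (μ := volume) (by positivity : 0 ≤ 2 * Real.pi)
    (i2.const_mul (1 - ε * b)) ((i1.const_mul (a + ε * b)).add (i3.const_mul b))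
    (fun t _ => hpt t)
  rw [intervalIntegral.integral_add (i1.const_mul _) (i3.const_mul _),
    intervalIntegral.integral_const_mul, intervalIntegral.integral_const_mul,
    intervalIntegral.integral_const_mul] at this
  have e : (K ^ 2 - 1) * b * 2 ^ (k - 1) = ε * b := by rw [hε]; ring
  rw [e]
  linarith [mul_nonpos_of_nonneg_of_nonpos hb0 hS']

theorem neg_I_mul_pow_re (N : ℕ) (w : ℂ) :
    ((-I * w) ^ N).re = ‖w‖ ^ N * Real.cos (N * (w.arg - Real.pi / 2)) := by
  have h : -I * w = (‖w‖ : ℂ) * Complex.exp (((w.arg - Real.pi / 2 : ℝ) : ℂ) * I) := by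
    conv_lhs => rw [← Complex.norm_mul_exp_arg_mul_I w]
    have : -I = Complex.exp (-(Real.pi / 2 * I)) := by
      rw [Complex.exp_neg, Complex.exp_pi_div_two_mul_I, Complex.inv_I]
    rw [this, mul_left_comm, ← Complex.exp_add]
    congr 2
    push_cast; ring
  rw [h, mul_pow, ← Complex.exp_nat_mul, ← Complex.ofReal_pow, Complex.re_ofReal_mul]
  congr 1
  rw [← Complex.exp_ofReal_mul_I_re]
  congr 2
  push_cast; ring

theorem cP_two_mul_add_one (k : ℕ) : cP (2 * (k + 1 : ℕ)) = 2 ^ (k - 1) := by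
  unfold cP
  split_ifs with h
  · have : k ≤ 1 := by
      have : 2 * (k + 1) ≤ 4 := by exact_mod_cast h
      omega
    rw [Nat.sub_eq_zero_of_le this, pow_zero]
  · have h1 : 1 ≤ k := by
      by_contra hk
      obtain rfl : k = 0 := by omega
      norm_num at h
    rw [← Real.rpow_natCast]
    congr 1
    push_cast [Nat.cast_sub h1]
    ring

theorem aP_natCast (N : ℕ) : aP N =
    (Real.cos (Real.pi / (2 * N)) / Real.sin (Real.pi / (2 * N))) ^ N := by
  rw [aP, Real.cot_eq_cos_div_sin, Real.rpow_natCast]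

theorem bP_natCast {N : ℕ} (hN : 2 ≤ N) : bP N =
    Real.cos (Real.pi / (2 * N)) ^ (N - 1) / Real.sin (Real.pi / (2 * N)) ∧ 0 ≤ bP N := by
  have hN' : (2:ℝ) ≤ N := by exact_mod_cast hN
  set γ := Real.pi / (2 * N) with hγ
  have hγ0 : 0 < γ := by positivity
  have hγ4 : γ ≤ Real.pi / 4 :=
    div_le_div_of_nonneg_left Real.pi_pos.le (by norm_num) (by linarith)
  have hs : 0 < Real.sin γ := Real.sin_pos_of_pos_of_lt_pi hγ0 (by linarith [Real.pi_pos])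
  have hc : 0 < Real.cos γ :=
    Real.cos_pos_of_mem_Ioo ⟨by linarith [Real.pi_pos], by linarith [Real.pi_pos]⟩
  have e : bP N = Real.cos γ ^ (N - 1) / Real.sin γ := by
    obtain ⟨m, rfl⟩ : ∃ m, N = m + 1 := ⟨N - 1, by omega⟩
    have : Real.pi / (m + 1 : ℕ) = 2 * γ := by rw [hγ]; field_simp
    rw [bP, ← hγ, this, Real.sin_two_mul, Real.rpow_natCast, Nat.add_sub_cancel]
    field_simp
    ring
  exact ⟨e, by rw [e]; positivity⟩

/-- Riesz type theorem with asymptotically sharp constant, even-integer case: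
bound for `‖v‖_p`. -/
theorem riesz_sharp_even_v_bound
    (p K : ℝ) (hp : 2 ≤ p) (hpeven : ∃ n : ℤ, p = 2 * (n : ℝ)) (hK : 1 ≤ K)
    (hsmall : (K ^ 2 - 1) * bP p * cP p < 1)
    (f h g : ℂ → ℂ)
    (hh : DifferentiableOn ℂ h (Metric.ball 0 1))
    (hg : DifferentiableOn ℂ g (Metric.ball 0 1))
    (hg0 : g 0 = 0)
    (hfdec : ∀ z ∈ Metric.ball (0:ℂ) 1, f z = h z + (starRingEnd ℂ) (g z))
    (hqr : ∀ z ∈ Metric.ball (0:ℂ) 1,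
      (‖deriv h z‖ + ‖deriv g z‖) ^ 2 ≤ K * (‖deriv h z‖ ^ 2 - ‖deriv g z‖ ^ 2))
    (hu : MemHp p (fun z => (f z).re))
    (hcos : Real.cos (p * (Complex.arg (f 0) - Real.pi / 2)) ≤ 0) :
    hardyNorm p (fun z => (f z).im) ≤
      ((aP p + (K ^ 2 - 1) * bP p * cP p) / (1 - (K ^ 2 - 1) * bP p * cP p)) ^ (1 / p) *
        hardyNorm p (fun z => (f z).re) := by
  obtain ⟨n, hn⟩ := hpeven
  obtain ⟨k, rfl⟩ : ∃ k : ℕ, n = (k + 1 : ℕ) := by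
    have : 1 ≤ n := by
      have : (1:ℝ) ≤ n := by linarith
      exact_mod_cast this
    exact ⟨(n - 1).toNat, by omega⟩
  have hpN : p = ((2 * (k + 1) : ℕ) : ℝ) := by rw [hn]; push_cast; ring
  have hcp : cP p = 2 ^ (k - 1) := by rw [← cP_two_mul_add_one k, hn]; push_cast; rfl
  obtain ⟨hb, hb0⟩ := bP_natCast (N := 2 * (k + 1)) (by omega)
  have ha := aP_natCast (2 * (k + 1))
  rw [← hpN] at hb hb0 ha
  rw [hcp] at hsmall ⊢
  have hκ : 0 ≤ K ^ 2 - 1 := by nlinarith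
  have ha0 : 0 ≤ aP p := by
    rw [ha]; exact (even_two_mul (k + 1)).pow_nonneg _
  have hden : 0 < 1 - (K ^ 2 - 1) * bP p * 2 ^ (k - 1) := by linarith
  set C := (aP p + (K ^ 2 - 1) * bP p * 2 ^ (k - 1)) / (1 - (K ^ 2 - 1) * bP p * 2 ^ (k - 1))
    with hC
  have hC0 : 0 ≤ C := by positivity
  have hz : (0 : ℂ) ∈ Metric.ball (0 : ℂ) 1 := by simp
  have h0 : ((-I * (h 0 + (starRingEnd ℂ) (g 0))) ^ (2 * (k + 1))).re ≤ 0 := by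
    rw [← hfdec 0 hz, neg_I_mul_pow_re, ← hpN]
    exact mul_nonpos_of_nonneg_of_nonpos (by positivity) hcos
  have habs : ∀ x : ℝ, ‖x‖ ^ p = x ^ (2 * (k + 1)) := by
    intro x
    rw [hpN, Real.rpow_natCast, Real.norm_eq_abs, (even_two_mul (k + 1)).pow_abs]
  refine csSup_le ((nonempty_Ico.2 one_pos).image _) ?_
  rintro _ ⟨r, hr, rfl⟩
  refine le_trans ?_ (mul_le_mul_of_nonneg_left (le_csSup hu ⟨r, hr, rfl⟩)
    (Real.rpow_nonneg hC0 _))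
  have hfr : ∀ t : ℝ, f ((r : ℂ) * Complex.exp (t * I)) =
      h (r * Complex.exp (t * I)) + (starRingEnd ℂ) (g (r * Complex.exp (t * I))) := by
    intro t
    refine hfdec _ ?_
    simpa [Complex.norm_exp_ofReal_mul_I, abs_of_nonneg hr.1] using hr.2
  have key := integral_im_pow_le (k := k) (r := r) hK (by rw [hpN]; push_cast; rfl)
    hb ha hb0 hh hg hqr h0 hr (funext hfr)
  simp only [Mp, habs]
  set Jv := ∫ t in (0:ℝ)..(2 * Real.pi), (f (r * Complex.exp (t * I))).im ^ (2 * (k + 1))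
  have hJu : 0 ≤ ∫ t in (0:ℝ)..(2 * Real.pi), (f (r * Complex.exp (t * I))).re ^ (2 * (k + 1)) :=
    intervalIntegral.integral_nonneg (by positivity) fun t _ =>
      (even_two_mul (k + 1)).pow_nonneg _
  have hJv : 0 ≤ Jv :=
    intervalIntegral.integral_nonneg (by positivity) fun t _ =>
      (even_two_mul (k + 1)).pow_nonneg _
  set Ju := ∫ t in (0:ℝ)..(2 * Real.pi), (f (r * Complex.exp (t * I))).re ^ (2 * (k + 1))
  have hle : Jv ≤ C * Ju := by
    rw [hC, div_mul_eq_mul_div, le_div_iff₀ hden]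
    linarith
  rw [← Real.mul_rpow hC0 (by positivity)]
  refine Real.rpow_le_rpow (by positivity) ?_ (by positivity)
  calc 1 / (2 * Real.pi) * Jv ≤ 1 / (2 * Real.pi) * (C * Ju) := by gcongr
    _ = _ := by ring
end

section
/- Let p ≥ 2 and let f = u + iv be a complex-valued harmonic mapping on the unit disk 𝔻 with v(0) = 0 and u in h^p. Assume that for every 0 ≤ r < 1 one has (1/(2π)) ∫₀^{2π} Φ_p(f(r e^{it})) dt ≥ Φ_p(f(0)) (in particular this holds when z ↦ Φ_p(f(z)) is subharmonic). Then ‖f‖_p ≤ csc(π/(2p)) ‖u‖_p and ‖v‖_p ≤ cot(π/(2p)) ‖u‖_p. -/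
open Complex MeasureTheory Set

/-- Auxiliary function defining `φ` on `[-π/2, π/2]`. -/
noncomputable def phiAux (p t : ℝ) : ℝ :=
  if Real.pi / 2 - Real.pi / p ≤ |t| then -Real.cos (p * (Real.pi / 2 - |t|))
  else max |Real.cos (p * (Real.pi / 2 - t))| |Real.cos (p * (Real.pi / 2 + t))|

/-- The function `φ` on `[-π, π]` (extended by `φ(t) = φ(π - |t|)` for `π/2 ≤ |t| ≤ π`). -/
noncomputable def phiP (p t : ℝ) : ℝ :=
  if |t| ≤ Real.pi / 2 then phiAux p t else phiAux p (Real.pi - |t|)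

/-- The Verbitsky subharmonic function `Φ_p(r e^{it}) = r^p φ(t)`. -/
noncomputable def PhiP (p : ℝ) (z : ℂ) : ℝ := ‖z‖ ^ p * phiP p (Complex.arg z)

lemma antitoneOn_sin_mul_mul_sin_rpow_neg {m : ℝ} (hm : 1 ≤ m) :
    AntitoneOn (fun x => Real.sin (m * x) * Real.sin x ^ (-m)) (Ioc 0 (Real.pi / (m + 1))) := by
  have hpi := Real.pi_pos
  have hlt : Real.pi / (m + 1) < Real.pi := div_lt_self hpi (by linarith)
  have hsin : ∀ x ∈ Ioc 0 (Real.pi / (m + 1)), 0 < Real.sin x := fun x hx =>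
    Real.sin_pos_of_pos_of_lt_pi hx.1 (hx.2.trans_lt hlt)
  have hder : ∀ x ∈ Ioc 0 (Real.pi / (m + 1)),
      HasDerivAt (fun x => Real.sin (m * x) * Real.sin x ^ (-m))
        (-(m * Real.sin x ^ (-m - 1) * Real.sin ((m - 1) * x))) x := by
    intro x hx
    have h1 : HasDerivAt (fun x => Real.sin (m * x)) (Real.cos (m * x) * m) x := by
      simpa using ((hasDerivAt_id x).const_mul m).sin
    have h2 := (Real.hasDerivAt_sin x).rpow_const (p := -m) (Or.inl (hsin x hx).ne')
    refine (h1.mul h2).congr_deriv ?_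
    have h3 : Real.sin x ^ (-m) = Real.sin x ^ (-m - 1) * Real.sin x := by
      rw [← Real.rpow_add_one (hsin x hx).ne']; ring_nf
    rw [h3, show (m - 1) * x = m * x - x by ring, Real.sin_sub]
    ring
  refine antitoneOn_of_deriv_nonpos (convex_Ioc _ _)
    (fun x hx => (hder x hx).continuousAt.continuousWithinAt)
    (fun x hx => (hder x (interior_subset hx)).differentiableAt.differentiableWithinAt) ?_
  intro x hx
  have hx' := interior_subset hx
  rw [(hder x hx').deriv]
  have h4 : x * (m + 1) ≤ Real.pi := (le_div_iff₀ (by linarith)).1 hx'.2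
  have h5 : 0 ≤ Real.sin ((m - 1) * x) :=
    Real.sin_nonneg_of_nonneg_of_le_pi (mul_nonneg (by linarith) hx'.1.le)
      (by nlinarith [hx'.1])
  have h6 := Real.rpow_nonneg (hsin x hx').le (-m - 1)
  have : 0 ≤ m * Real.sin x ^ (-m - 1) * Real.sin ((m - 1) * x) := by positivity
  linarith

lemma hasDerivAt_tan_rpow_add_cos_mul_cos_rpow_neg {p x : ℝ} (K b : ℝ) (hp : 1 ≤ p)
    (hsin : 0 ≤ Real.sin x) (hcos : 0 < Real.cos x) :
    HasDerivAt (fun x => K * Real.tan x ^ p + b * (Real.cos (p * x) * Real.cos x ^ (-p)))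
      (p * Real.cos x ^ (-p - 1) *
        (K * Real.sin x ^ (p - 1) - b * Real.sin ((p - 1) * x))) x := by
  have h1 : HasDerivAt (fun x => Real.cos (p * x)) (-Real.sin (p * x) * p) x := by
    simpa using ((hasDerivAt_id x).const_mul p).cos
  have h2 := (Real.hasDerivAt_cos x).rpow_const (p := -p) (Or.inl hcos.ne')
  have h3 := (Real.hasDerivAt_tan hcos.ne').rpow_const (p := p) (Or.inr hp)
  refine ((h3.const_mul K).add ((h1.mul h2).const_mul b)).congr_deriv ?_
  have h4 : Real.cos x ^ (-p) = Real.cos x ^ (-p - 1) * Real.cos x := by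
    rw [← Real.rpow_add_one hcos.ne']; ring_nf
  have h5 : Real.tan x ^ (p - 1) * (1 / Real.cos x ^ 2)
      = Real.cos x ^ (-p - 1) * Real.sin x ^ (p - 1) := by
    rw [Real.tan_eq_sin_div_cos, Real.div_rpow hsin hcos.le, ← Real.rpow_natCast (Real.cos x) 2,
      show -p - 1 = -((p - 1) + (2 : ℕ)) by push_cast; ring, Real.rpow_neg hcos.le,
      Real.rpow_add hcos]
    have := Real.rpow_pos_of_pos hcos (p - 1)
    have := Real.rpow_pos_of_pos hcos ((2 : ℕ) : ℝ)
    field_simp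
  rw [h4, show (p - 1) * x = p * x - x by ring, Real.sin_sub]
  linear_combination (K * p) * h5

/-- The constant multiplying `Φ_p` in the pointwise inequality behind the Riesz estimates. -/
noncomputable def rieszConst (p : ℝ) : ℝ :=
  Real.cos (Real.pi / (2 * p)) ^ (p - 1) / Real.sin (Real.pi / (2 * p))

lemma pi_div_two_mul_mem_Ioo {p : ℝ} (hp : 2 ≤ p) :
    Real.pi / (2 * p) ∈ Ioo 0 (Real.pi / 2) := by
  have hpi := Real.pi_pos
  refine ⟨by positivity, ?_⟩
  exact div_lt_div_of_pos_left hpi (by norm_num) (by linarith)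

lemma sin_pi_div_two_mul_pos {p : ℝ} (hp : 2 ≤ p) : 0 < Real.sin (Real.pi / (2 * p)) :=
  Real.sin_pos_of_pos_of_lt_pi (pi_div_two_mul_mem_Ioo hp).1
    (by linarith [(pi_div_two_mul_mem_Ioo hp).2, Real.pi_pos])

lemma cos_pi_div_two_mul_pos {p : ℝ} (hp : 2 ≤ p) : 0 < Real.cos (Real.pi / (2 * p)) :=
  Real.cos_pos_of_mem_Ioo ⟨by linarith [(pi_div_two_mul_mem_Ioo hp).1, Real.pi_pos],
    (pi_div_two_mul_mem_Ioo hp).2⟩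

lemma cot_pi_div_two_mul_pos {p : ℝ} (hp : 2 ≤ p) : 0 < Real.cot (Real.pi / (2 * p)) := by
  rw [Real.cot_eq_cos_div_sin]
  exact div_pos (cos_pi_div_two_mul_pos hp) (sin_pi_div_two_mul_pos hp)

lemma rieszConst_pos {p : ℝ} (hp : 2 ≤ p) : 0 < rieszConst p :=
  div_pos (Real.rpow_pos_of_pos (cos_pi_div_two_mul_pos hp) _) (sin_pi_div_two_mul_pos hp)

lemma one_le_cot_rpow_mul_tan_rpow_add {p x : ℝ} (hp : 2 < p) (hx0 : 0 ≤ x)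
    (hx : x ≤ Real.pi / p) :
    1 ≤ Real.cot (Real.pi / (2 * p)) ^ p * Real.tan x ^ p +
      rieszConst p * (Real.cos (p * x) * Real.cos x ^ (-p)) := by
  have hpi := Real.pi_pos
  have hp0 : 0 < p := by linarith
  set α := Real.pi / (2 * p) with hα
  have hS := sin_pi_div_two_mul_pos hp.le
  have hC := cos_pi_div_two_mul_pos hp.le
  have hα0 := (pi_div_two_mul_mem_Ioo hp.le).1
  rw [← hα] at hS hC hα0
  have hpα : p * α = Real.pi / 2 := by rw [hα]; field_simp
  have h2α : Real.pi / p = 2 * α := by rw [hα]; field_simp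
  have hlt : Real.pi / p < Real.pi / 2 := div_lt_div_of_pos_left hpi (by norm_num) hp
  set K := Real.cot α ^ p with hK
  set b := rieszConst p with hb
  have hbpos : 0 < b := rieszConst_pos hp.le
  set L : ℝ → ℝ := fun x => K * Real.tan x ^ p + b * (Real.cos (p * x) * Real.cos x ^ (-p))
    with hL
  have hSC : b * Real.sin ((p - 1) * α) = K * Real.sin α ^ (p - 1) := by
    rw [sub_mul, one_mul, hpα, Real.sin_pi_div_two_sub, hK, hb, rieszConst, ← hα,
      Real.cot_eq_cos_div_sin, Real.div_rpow hC.le hS.le, Real.rpow_sub_one hC.ne',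
      Real.rpow_sub_one hS.ne']
    have := Real.rpow_pos_of_pos hS p
    field_simp
  have hLα : L α = 1 := by
    simp only [hL, hpα, Real.cos_pi_div_two, zero_mul, mul_zero, add_zero]
    rw [hK, Real.cot_eq_cos_div_sin, Real.tan_eq_sin_div_cos,
      ← Real.mul_rpow (by positivity) (by positivity)]
    rw [show Real.cos α / Real.sin α * (Real.sin α / Real.cos α) = 1 by field_simp,
      Real.one_rpow]
  have hcos : ∀ y ∈ Icc 0 (Real.pi / p), 0 < Real.cos y := fun y hy =>
    Real.cos_pos_of_mem_Ioo ⟨by linarith [hy.1], hy.2.trans_lt hlt⟩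
  have hsin : ∀ y ∈ Icc 0 (Real.pi / p), 0 ≤ Real.sin y := fun y hy =>
    Real.sin_nonneg_of_nonneg_of_le_pi hy.1 (by linarith [hy.2])
  have hder : ∀ y ∈ Icc 0 (Real.pi / p), HasDerivAt L (p * Real.cos y ^ (-p - 1) *
        (K * Real.sin y ^ (p - 1) - b * Real.sin ((p - 1) * y))) y := fun y hy =>
    hasDerivAt_tan_rpow_add_cos_mul_cos_rpow_neg K b (by linarith) (hsin y hy) (hcos y hy)
  have hanti := antitoneOn_sin_mul_mul_sin_rpow_neg (m := p - 1) (by linarith)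
  rw [sub_add_cancel] at hanti
  have hspos : ∀ y ∈ Ioc 0 (Real.pi / p), 0 < Real.sin y := fun y hy =>
    Real.sin_pos_of_pos_of_lt_pi hy.1 (by linarith [hy.2])
  have hquot : ∀ y ∈ Ioc 0 (Real.pi / p), Real.sin ((p - 1) * y) =
      (Real.sin ((p - 1) * y) * Real.sin y ^ (-(p - 1))) * Real.sin y ^ (p - 1) := by
    intro y hy
    rw [mul_assoc, ← Real.rpow_add (hspos y hy), neg_add_cancel, Real.rpow_zero, mul_one]
  have hαmem : α ∈ Ioc 0 (Real.pi / p) := ⟨hα0, by linarith⟩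
  have hKeq : K = b * (Real.sin ((p - 1) * α) * Real.sin α ^ (-(p - 1))) := by
    rw [← mul_assoc, hSC, mul_assoc, ← Real.rpow_add hS, add_neg_cancel, Real.rpow_zero, mul_one]
  have hfac : ∀ y ∈ Ioc 0 (Real.pi / p), K * Real.sin y ^ (p - 1) - b * Real.sin ((p - 1) * y) =
      b * Real.sin y ^ (p - 1) * (Real.sin ((p - 1) * α) * Real.sin α ^ (-(p - 1)) -
        Real.sin ((p - 1) * y) * Real.sin y ^ (-(p - 1))) := by
    intro y hy
    linear_combination Real.sin y ^ (p - 1) * hKeq - b * hquot y hy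
  have hpow : ∀ y ∈ Ioc 0 (Real.pi / p), 0 ≤ b * Real.sin y ^ (p - 1) := fun y hy =>
    mul_nonneg hbpos.le (Real.rpow_nonneg (hspos y hy).le _)
  have hcpow : ∀ y ∈ Ioc 0 (Real.pi / p), 0 ≤ p * Real.cos y ^ (-p - 1) := fun y hy =>
    mul_nonneg hp0.le (Real.rpow_nonneg (hcos y ⟨hy.1.le, hy.2⟩).le _)
  change 1 ≤ L x
  rw [← hLα]
  rcases le_total x α with hxα | hxα
  · have hsub : Icc 0 α ⊆ Icc 0 (Real.pi / p) := Icc_subset_Icc_right hαmem.2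
    refine antitoneOn_of_deriv_nonpos (convex_Icc 0 α)
      (fun y hy => (hder y (hsub hy)).continuousAt.continuousWithinAt)
      (fun y hy => (hder y (hsub (interior_subset hy))).differentiableAt.differentiableWithinAt)
      ?_ ⟨hx0, hxα⟩ ⟨hα0.le, le_rfl⟩ hxα
    intro y hy
    rw [interior_Icc] at hy
    have hy' : y ∈ Ioc 0 (Real.pi / p) := ⟨hy.1, hy.2.le.trans hαmem.2⟩
    rw [(hder y ⟨hy'.1.le, hy'.2⟩).deriv, hfac y hy']
    exact mul_nonpos_of_nonneg_of_nonpos (hcpow y hy')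
      (mul_nonpos_of_nonneg_of_nonpos (hpow y hy') (sub_nonpos.2 (hanti hy' hαmem hy.2.le)))
  · have hsub : Icc α (Real.pi / p) ⊆ Icc 0 (Real.pi / p) := Icc_subset_Icc_left hα0.le
    refine monotoneOn_of_deriv_nonneg (convex_Icc α (Real.pi / p))
      (fun y hy => (hder y (hsub hy)).continuousAt.continuousWithinAt)
      (fun y hy => (hder y (hsub (interior_subset hy))).differentiableAt.differentiableWithinAt)
      ?_ ⟨le_rfl, hαmem.2⟩ ⟨hxα, hx⟩ hxα
    intro y hy
    rw [interior_Icc] at hy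
    have hy' : y ∈ Ioc 0 (Real.pi / p) := ⟨hα0.trans hy.1, hy.2.le⟩
    rw [(hder y ⟨hy'.1.le, hy'.2⟩).deriv, hfac y hy']
    exact mul_nonneg (hcpow y hy')
      (mul_nonneg (hpow y hy') (sub_nonneg.2 (hanti hαmem hy' hy.1.le)))

lemma cos_rpow_le_cot_rpow_mul_sin_rpow_add {p x : ℝ} (hp : 2 ≤ p) (hx0 : 0 ≤ x)
    (hx : x ≤ Real.pi / p) :
    Real.cos x ^ p ≤ Real.cot (Real.pi / (2 * p)) ^ p * Real.sin x ^ p +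
      rieszConst p * Real.cos (p * x) := by
  have hpi := Real.pi_pos
  rcases hp.eq_or_lt with rfl | hp
  · have h4 : Real.pi / (2 * 2) = Real.pi / 4 := by ring
    have hs : Real.sqrt 2 / 2 ≠ 0 := by positivity
    simp only [rieszConst, h4, Real.cot_eq_cos_div_sin, Real.cos_pi_div_four,
      Real.sin_pi_div_four, div_self hs, Real.rpow_two]
    norm_num
    rw [Real.cos_two_mul]
    nlinarith [Real.sin_sq_add_cos_sq x]
  · have hlt : Real.pi / p < Real.pi / 2 := div_lt_div_of_pos_left hpi (by norm_num) hp
    have hcos : 0 < Real.cos x := Real.cos_pos_of_mem_Ioo ⟨by linarith, by linarith⟩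
    have hsin : 0 ≤ Real.sin x := Real.sin_nonneg_of_nonneg_of_le_pi hx0 (by linarith)
    have h := one_le_cot_rpow_mul_tan_rpow_add hp hx0 hx
    have hc := Real.rpow_pos_of_pos hcos p
    rw [Real.tan_eq_sin_div_cos, Real.div_rpow hsin hcos.le, Real.rpow_neg hcos.le] at h
    have h' := mul_le_mul_of_nonneg_right h hc.le
    rw [one_mul] at h'
    refine h'.trans_eq ?_
    field_simp

lemma phiAux_abs (p t : ℝ) : phiAux p |t| = phiAux p t := by
  rcases abs_cases t with ⟨h, _⟩ | ⟨h, _⟩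
  · rw [h]
  · rw [h]
    simp only [phiAux, abs_neg, sub_neg_eq_add, ← sub_eq_add_neg]
    rw [max_comm]

lemma abs_phiAux_le_one (p t : ℝ) : |phiAux p t| ≤ 1 := by
  unfold phiAux
  split_ifs
  · rw [abs_neg]; exact Real.abs_cos_le_one _
  · rw [abs_of_nonneg (le_max_of_le_left (abs_nonneg _))]
    exact max_le (Real.abs_cos_le_one _) (Real.abs_cos_le_one _)

lemma abs_phiP_le_one (p t : ℝ) : |phiP p t| ≤ 1 := by
  unfold phiP
  split_ifs <;> exact abs_phiAux_le_one _ _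

lemma measurable_phiAux (p : ℝ) : Measurable (phiAux p) := by
  unfold phiAux
  refine Measurable.ite (measurableSet_le (by fun_prop) (by fun_prop)) (by fun_prop) ?_
  exact Measurable.max (by fun_prop) (by fun_prop)

lemma measurable_phiP (p : ℝ) : Measurable (phiP p) := by
  unfold phiP
  refine Measurable.ite (measurableSet_le (by fun_prop) (by fun_prop)) (measurable_phiAux p) ?_
  exact (measurable_phiAux p).comp (by fun_prop)

lemma measurable_PhiP (p : ℝ) : Measurable (PhiP p) := by
  unfold PhiP
  exact (measurable_norm.pow_const p).mul ((measurable_phiP p).comp Complex.measurable_arg)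

lemma abs_PhiP_le (p : ℝ) (z : ℂ) : |PhiP p z| ≤ ‖z‖ ^ p := by
  rw [PhiP, abs_mul, abs_of_nonneg (Real.rpow_nonneg (norm_nonneg z) p)]
  exact mul_le_of_le_one_right (Real.rpow_nonneg (norm_nonneg z) p) (abs_phiP_le_one p _)

lemma sin_rpow_le_of_nonneg {p s : ℝ} (hp : 2 ≤ p) (hs0 : 0 ≤ s) (hs : s ≤ Real.pi / 2) :
    Real.sin s ^ p ≤ Real.cot (Real.pi / (2 * p)) ^ p * Real.cos s ^ p -
      rieszConst p * phiAux p s := by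
  have hpi := Real.pi_pos
  have hp0 : 0 < p := by linarith
  rcases le_or_gt (Real.pi / 2 - Real.pi / p) s with h | h
  · have := cos_rpow_le_cot_rpow_mul_sin_rpow_add hp (x := Real.pi / 2 - s)
      (by linarith) (by linarith)
    rw [Real.cos_pi_div_two_sub, Real.sin_pi_div_two_sub] at this
    rw [phiAux, abs_of_nonneg hs0, if_pos h]
    linarith
  · have hle := cos_rpow_le_cot_rpow_mul_sin_rpow_add hp (x := Real.pi / p)
      (by positivity) le_rfl
    rw [mul_div_cancel₀ _ hp0.ne', Real.cos_pi, ← Real.sin_pi_div_two_sub,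
      ← Real.cos_pi_div_two_sub (Real.pi / p)] at hle
    have hq : 0 < Real.pi / p := by positivity
    have h1 : Real.sin s ^ p ≤ Real.sin (Real.pi / 2 - Real.pi / p) ^ p :=
      Real.rpow_le_rpow (Real.sin_nonneg_of_nonneg_of_le_pi hs0 (by linarith))
        (Real.sin_le_sin_of_le_of_le_pi_div_two (by linarith) (by linarith) h.le) hp0.le
    have h2 : Real.cos (Real.pi / 2 - Real.pi / p) ^ p ≤ Real.cos s ^ p :=
      Real.rpow_le_rpow (Real.cos_nonneg_of_mem_Icc ⟨by linarith, by linarith⟩)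
        (Real.cos_le_cos_of_nonneg_of_le_pi hs0 (by linarith) h.le) hp0.le
    have h3 := mul_le_mul_of_nonneg_left h2
      (Real.rpow_nonneg (cot_pi_div_two_mul_pos hp).le p)
    have h4 := mul_le_mul_of_nonneg_left (abs_le.1 (abs_phiAux_le_one p s)).2
      (rieszConst_pos hp).le
    linarith

lemma abs_sin_rpow_le {p t : ℝ} (hp : 2 ≤ p) (ht : |t| ≤ Real.pi) :
    |Real.sin t| ^ p ≤ Real.cot (Real.pi / (2 * p)) ^ p * |Real.cos t| ^ p -
      rieszConst p * phiP p t := by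
  rw [Real.abs_sin_eq_sin_abs_of_abs_le_pi ht, ← Real.cos_abs t, phiP]
  split_ifs with h
  · rw [abs_of_nonneg (Real.cos_nonneg_of_mem_Icc ⟨by linarith [abs_nonneg t, Real.pi_pos], h⟩),
      ← phiAux_abs]
    exact sin_rpow_le_of_nonneg hp (abs_nonneg t) h
  · push Not at h
    have := sin_rpow_le_of_nonneg hp (s := Real.pi - |t|) (by linarith) (by linarith)
    rw [Real.sin_pi_sub, Real.cos_pi_sub] at this
    rwa [abs_of_nonpos (Real.cos_nonpos_of_pi_div_two_le_of_le h.le (by linarith [Real.pi_pos]))]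

lemma abs_im_rpow_le {p : ℝ} (hp : 2 ≤ p) (z : ℂ) :
    |z.im| ^ p ≤ Real.cot (Real.pi / (2 * p)) ^ p * |z.re| ^ p - rieszConst p * PhiP p z := by
  have h := mul_le_mul_of_nonneg_left (abs_sin_rpow_le hp (Complex.abs_arg_le_pi z))
    (Real.rpow_nonneg (norm_nonneg z) p)
  rw [← Complex.norm_mul_cos_arg z, ← Complex.norm_mul_sin_arg z, abs_mul, abs_mul, abs_norm,
    Real.mul_rpow (norm_nonneg z) (abs_nonneg _), Real.mul_rpow (norm_nonneg z) (abs_nonneg _),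
    PhiP]
  linarith

lemma PhiP_ofReal_nonneg {p : ℝ} (hp : 2 ≤ p) (x : ℝ) : 0 ≤ PhiP p x := by
  have hpi := Real.pi_pos
  have h0 : 0 ≤ phiAux p 0 := by
    unfold phiAux
    split_ifs with h
    · rw [abs_zero, sub_nonpos, div_le_div_iff_of_pos_left hpi (by norm_num) (by linarith)] at h
      obtain rfl : p = 2 := le_antisymm h hp
      simp [mul_div_cancel₀]
    · exact le_max_of_le_left (abs_nonneg _)
  refine mul_nonneg (Real.rpow_nonneg (norm_nonneg _) _) ?_
  rcases le_or_gt 0 x with hx | hx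
  · rw [Complex.arg_ofReal_of_nonneg hx, phiP, if_pos (by simp; positivity)]
    exact h0
  · rw [Complex.arg_ofReal_of_neg hx, phiP, abs_of_pos hpi, if_neg (by linarith), sub_self]
    exact h0

lemma norm_rpow_le_add {p a b : ℝ} (hp : 2 ≤ p) (ha : 0 < a) (hb : 0 < b)
    (hab : a ^ 2 + b ^ 2 = 1) (z : ℂ) :
    ‖z‖ ^ p ≤ a ^ 2 / a ^ p * |z.im| ^ p + b ^ 2 / b ^ p * |z.re| ^ p := by
  have hconv := (convexOn_rpow (p := p / 2) (by linarith)).2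
    (x := (|z.im| / a) ^ 2) (y := (|z.re| / b) ^ 2) (by simp; positivity) (by simp; positivity)
    (sq_nonneg a) (sq_nonneg b) hab
  have hpow : ∀ y : ℝ, 0 ≤ y → (y ^ 2) ^ (p / 2) = y ^ p := fun y hy => by
    rw [← Real.rpow_natCast y 2, ← Real.rpow_mul hy]; congr 1; push_cast; ring
  have hsum : a ^ 2 * (|z.im| / a) ^ 2 + b ^ 2 * (|z.re| / b) ^ 2 = ‖z‖ ^ 2 := by
    rw [Complex.sq_norm, Complex.normSq_apply, div_pow, div_pow, sq_abs, sq_abs]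
    field_simp
    ring
  simp only [smul_eq_mul] at hconv
  rw [hsum, hpow _ (norm_nonneg z), hpow _ (by positivity), hpow _ (by positivity),
    Real.div_rpow (abs_nonneg _) ha.le, Real.div_rpow (abs_nonneg _) hb.le] at hconv
  exact hconv.trans_eq (by ring)

lemma circleIntegral_norm_rpow_nonneg {E : Type*} [NormedAddCommGroup E] (p r : ℝ) (f : ℂ → E) :
    0 ≤ ∫ θ in (0:ℝ)..(2 * Real.pi), ‖f ((r : ℂ) * Complex.exp ((θ : ℂ) * Complex.I))‖ ^ p :=
  intervalIntegral.integral_nonneg Real.two_pi_pos.le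
    (fun _ _ => Real.rpow_nonneg (norm_nonneg _) _)

lemma hardyNorm_le_mul_of_integral_le {E F : Type*} [NormedAddCommGroup E]
    [NormedAddCommGroup F] {p k : ℝ} (hp : 0 < p) (hk : 0 ≤ k) {f : ℂ → E} {u : ℂ → F}
    (hu : MemHp p u)
    (h : ∀ r ∈ Ico (0 : ℝ) 1,
      ∫ θ in (0:ℝ)..(2 * Real.pi), ‖f ((r : ℂ) * Complex.exp ((θ : ℂ) * Complex.I))‖ ^ p ≤
        k ^ p * ∫ θ in (0:ℝ)..(2 * Real.pi),
          ‖u ((r : ℂ) * Complex.exp ((θ : ℂ) * Complex.I))‖ ^ p) :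
    hardyNorm p f ≤ k * hardyNorm p u := by
  have hpi := Real.pi_pos
  refine csSup_le ((nonempty_Ico.2 one_pos).image _) ?_
  rintro _ ⟨r, hr, rfl⟩
  refine le_trans ?_ (mul_le_mul_of_nonneg_left (le_csSup hu ⟨r, hr, rfl⟩) hk)
  have hf0 := circleIntegral_norm_rpow_nonneg p r f
  have hu0 := circleIntegral_norm_rpow_nonneg p r u
  have hk' : k = (k ^ p) ^ (1 / p) := by
    rw [one_div, Real.rpow_rpow_inv hk hp.ne']
  simp only [Mp]
  rw [hk', ← Real.mul_rpow (by positivity) (by positivity)]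
  refine Real.rpow_le_rpow (by positivity) ?_ (by positivity)
  rw [mul_left_comm]
  exact mul_le_mul_of_nonneg_left (h r hr) (by positivity)

/-- Riesz type estimates for harmonic mappings `f` for which `Φ_p ∘ f` satisfies the
sub-mean-value inequality at the origin. -/
theorem riesz_type_subharmonic_composition
    (p : ℝ) (hp : 2 ≤ p) (f h g : ℂ → ℂ)
    (hh : DifferentiableOn ℂ h (Metric.ball 0 1))
    (hg : DifferentiableOn ℂ g (Metric.ball 0 1))
    (hfdec : ∀ z ∈ Metric.ball (0:ℂ) 1, f z = h z + (starRingEnd ℂ) (g z))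
    (hv0 : (f 0).im = 0)
    (hu : MemHp p (fun z => (f z).re))
    (hsub : ∀ r : ℝ, 0 ≤ r → r < 1 →
      PhiP p (f 0) ≤ (1 / (2 * Real.pi)) *
        ∫ t in (0:ℝ)..(2 * Real.pi), PhiP p (f ((r : ℂ) * Complex.exp ((t : ℂ) * Complex.I)))) :
    hardyNorm p f ≤ (Real.sin (Real.pi / (2 * p)))⁻¹ * hardyNorm p (fun z => (f z).re) ∧
    hardyNorm p (fun z => (f z).im) ≤
      Real.cot (Real.pi / (2 * p)) * hardyNorm p (fun z => (f z).re) := by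
  have hpi := Real.pi_pos
  have hp0 : 0 < p := by linarith
  have hS := sin_pi_div_two_mul_pos hp
  have hC := cos_pi_div_two_mul_pos hp
  have hcot := cot_pi_div_two_mul_pos hp
  have hfcont : ContinuousOn f (Metric.ball 0 1) :=
    (hh.continuousOn.add (Complex.continuous_conj.comp_continuousOn hg.continuousOn)).congr hfdec
  have hcirc : ∀ r ∈ Ico (0 : ℝ) 1,
      Continuous fun θ : ℝ => f ((r : ℂ) * Complex.exp ((θ : ℂ) * Complex.I)) := by
    intro r hr
    refine hfcont.comp_continuous (by fun_prop) fun θ => ?_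
    rw [mem_ball_zero_iff, norm_mul, Complex.norm_exp_ofReal_mul_I, mul_one, Complex.norm_real,
      Real.norm_of_nonneg hr.1]
    exact hr.2
  have hpow_int : ∀ {w : ℝ → ℝ}, Continuous w →
      IntervalIntegrable (fun θ => |w θ| ^ p) volume 0 (2 * Real.pi) := fun hw =>
    (hw.abs.rpow_const fun _ => Or.inr hp0.le).intervalIntegrable _ _
  have him : ∀ r ∈ Ico (0 : ℝ) 1,
      ∫ θ in (0:ℝ)..(2 * Real.pi), |(f ((r : ℂ) * Complex.exp ((θ : ℂ) * Complex.I))).im| ^ p ≤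
        Real.cot (Real.pi / (2 * p)) ^ p * ∫ θ in (0:ℝ)..(2 * Real.pi),
          |(f ((r : ℂ) * Complex.exp ((θ : ℂ) * Complex.I))).re| ^ p := by
    intro r hr
    have hc := hcirc r hr
    have hΦ : IntervalIntegrable
        (fun θ : ℝ => PhiP p (f ((r : ℂ) * Complex.exp ((θ : ℂ) * Complex.I))))
        volume 0 (2 * Real.pi) := by
      refine (hpow_int hc.norm).mono_fun
        ((measurable_PhiP p).comp hc.measurable).aestronglyMeasurable (ae_of_all _ fun θ => ?_)
      simp only [Real.norm_eq_abs, abs_norm]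
      exact (abs_PhiP_le p _).trans (le_abs_self _)
    have hΦ0 : 0 ≤ ∫ θ in (0:ℝ)..(2 * Real.pi),
        PhiP p (f ((r : ℂ) * Complex.exp ((θ : ℂ) * Complex.I))) := by
      have h0 : f 0 = ((f 0).re : ℂ) := Complex.ext rfl (by simpa using hv0)
      have h1 := hsub r hr.1 hr.2
      rw [h0] at h1
      exact nonneg_of_mul_nonneg_right ((PhiP_ofReal_nonneg hp _).trans h1) (by positivity)
    have hre := hpow_int (Complex.continuous_re.comp hc)
    have hle := intervalIntegral.integral_mono (by positivity)
      (hpow_int (Complex.continuous_im.comp hc))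
      ((hre.const_mul (Real.cot (Real.pi / (2 * p)) ^ p)).sub (hΦ.const_mul (rieszConst p)))
      (fun θ => abs_im_rpow_le hp _)
    rw [intervalIntegral.integral_sub (hre.const_mul _) (hΦ.const_mul _),
      intervalIntegral.integral_const_mul, intervalIntegral.integral_const_mul] at hle
    exact hle.trans (sub_le_self _ (mul_nonneg (rieszConst_pos hp).le hΦ0))
  refine ⟨hardyNorm_le_mul_of_integral_le hp0 (inv_pos.2 hS).le hu fun r hr => ?_,
    hardyNorm_le_mul_of_integral_le hp0 hcot.le hu him⟩
  have hc := hcirc r hr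
  have hre := hpow_int (Complex.continuous_re.comp hc)
  have him' := hpow_int (Complex.continuous_im.comp hc)
  set C := Real.cos (Real.pi / (2 * p))
  set S := Real.sin (Real.pi / (2 * p))
  have hle := intervalIntegral.integral_mono (by positivity)
    ((hc.norm.rpow_const fun _ => Or.inr hp0.le).intervalIntegrable _ _)
    ((him'.const_mul (C ^ 2 / C ^ p)).add (hre.const_mul (S ^ 2 / S ^ p)))
    (fun θ => norm_rpow_le_add hp hC hS (Real.cos_sq_add_sin_sq _) _)
  rw [intervalIntegral.integral_add (him'.const_mul _) (hre.const_mul _),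
    intervalIntegral.integral_const_mul, intervalIntegral.integral_const_mul] at hle
  refine hle.trans ((add_le_add_left (mul_le_mul_of_nonneg_left (him r hr)
    (by positivity)) _).trans_eq ?_)
  have hCp := Real.rpow_pos_of_pos hC p
  have hSp := Real.rpow_pos_of_pos hS p
  rw [Real.cot_eq_cos_div_sin, Real.div_rpow hC.le hS.le, Real.inv_rpow hS.le]
  simp only [Function.comp_def, Real.norm_eq_abs]
  have hCS : C ^ 2 + S ^ 2 = 1 := Real.cos_sq_add_sin_sq _
  generalize ∫ θ in (0:ℝ)..(2 * Real.pi),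
    |(f ((r : ℂ) * Complex.exp ((θ : ℂ) * Complex.I))).re| ^ p = J
  field_simp
  linear_combination J * hCS
end

section
/- Let p ≥ 2 and let f = u + iv be holomorphic on the unit disk 𝔻 with v(0) = 0 and u = Re f in h^p. Then ‖f‖_p ≤ csc(π/(2p)) ‖u‖_p and ‖v‖_p ≤ cot(π/(2p)) ‖u‖_p. -/
open Complex MeasureTheory Set

lemma antitoneOn_cos_mul_div_cos_rpow {p m : ℝ} (hp : 2 < p) (hm : 0 ≤ m) (hmp : m ≤ p - 1) :
    AntitoneOn (fun x : ℝ => Real.cos ((p - 1) * x) / Real.cos x ^ m) (Icc 0 (Real.pi / p)) := by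
  have hpi := Real.pi_pos
  have hp0 : 0 < p := by linarith
  have hlt : Real.pi / p < Real.pi / 2 := by gcongr
  have hcos : ∀ x ∈ Icc 0 (Real.pi / p), 0 < Real.cos x := fun x hx =>
    Real.cos_pos_of_mem_Ioo ⟨by linarith [hx.1], by linarith [hx.2]⟩
  have hder : ∀ x ∈ Icc 0 (Real.pi / p),
      HasDerivAt (fun x : ℝ => Real.cos ((p - 1) * x) / Real.cos x ^ m)
        ((-((p - 1 - m) * Real.sin ((p - 1) * x) * Real.cos x)
          - m * Real.sin ((p - 2) * x)) / Real.cos x ^ (m + 1)) x := by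
    intro x hx
    have hc := hcos x hx
    have h1 : HasDerivAt (fun x : ℝ => Real.cos ((p - 1) * x))
        (-Real.sin ((p - 1) * x) * (p - 1)) x := by
      simpa using ((hasDerivAt_id x).const_mul (p - 1)).cos
    have h2 := (Real.hasDerivAt_cos x).rpow_const (p := m) (Or.inl hc.ne')
    refine (h1.div h2 (Real.rpow_pos_of_pos hc m).ne').congr_deriv ?_
    have e1 : Real.sin ((p - 2) * x) =
        Real.sin ((p - 1) * x) * Real.cos x - Real.cos ((p - 1) * x) * Real.sin x := by
      rw [← Real.sin_sub]; congr 1; ring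
    have e2 : Real.cos x ^ (m - 1) = Real.cos x ^ m / Real.cos x := Real.rpow_sub_one hc.ne' m
    have e3 : Real.cos x ^ (m + 1) = Real.cos x ^ m * Real.cos x := Real.rpow_add_one hc.ne' m
    have h4 := (Real.rpow_pos_of_pos hc m).ne'
    rw [e1, e2, e3]
    field_simp
    ring
  refine antitoneOn_of_deriv_nonpos (convex_Icc _ _)
    (fun x hx => (hder x hx).continuousAt.continuousWithinAt)
    (fun x hx => (hder x (interior_subset hx)).differentiableAt.differentiableWithinAt) ?_
  intro x hx
  have hx' := interior_subset hx
  rw [(hder x hx').deriv]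
  have hc := hcos x hx'
  have hxp : x * p ≤ Real.pi := (le_div_iff₀ hp0).1 hx'.2
  have s1 : 0 ≤ Real.sin ((p - 1) * x) :=
    Real.sin_nonneg_of_nonneg_of_le_pi (mul_nonneg (by linarith) hx'.1) (by nlinarith [hx'.1])
  have s2 : 0 ≤ Real.sin ((p - 2) * x) :=
    Real.sin_nonneg_of_nonneg_of_le_pi (mul_nonneg (by linarith) hx'.1) (by nlinarith [hx'.1])
  refine div_nonpos_of_nonpos_of_nonneg ?_ (Real.rpow_nonneg hc.le _)
  have := mul_nonneg (mul_nonneg (sub_nonneg.2 hmp) s1) hc.le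
  have := mul_nonneg hm s2
  linarith

lemma le_add_mul_cos_div_sin_rpow {p m : ℝ} (hp : 2 < p) (hm : 0 ≤ m) (hmp : m ≤ p - 1)
    {G : ℝ → ℝ} (hG : ∀ x ∈ Ioo 0 (Real.pi / 2),
      HasDerivAt G (-p * Real.cos x ^ m / Real.sin x ^ (p + 1)) x)
    {x : ℝ} (hx : x ∈ Ioc 0 (Real.pi / p)) :
    G x ≤ G (Real.pi / (2 * p)) + Real.cos (Real.pi / (2 * p)) ^ m / Real.sin (Real.pi / (2 * p)) *
      (Real.cos (p * x) / Real.sin x ^ p) := by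
  have hpi := Real.pi_pos
  have hp0 : 0 < p := by linarith
  have hlt : Real.pi / p < Real.pi / 2 := by gcongr
  set a := Real.pi / (2 * p) with ha
  have ha0 : 0 < a := by positivity
  have ha2 : Real.pi / p = 2 * a := by rw [ha]; field_simp
  have hpa : p * a = Real.pi / 2 := by rw [ha]; field_simp
  rw [ha2] at hx hlt
  have hR := antitoneOn_cos_mul_div_cos_rpow hp hm hmp
  rw [ha2] at hR
  have hqa : Real.cos ((p - 1) * a) = Real.sin a := by
    rw [← Real.cos_pi_div_two_sub, ← hpa]; congr 1; ring
  have hsin : ∀ y ∈ Ioc 0 (2 * a), 0 < Real.sin y := fun y hy =>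
    Real.sin_pos_of_pos_of_lt_pi hy.1 (by linarith [hy.2])
  have hcos : ∀ y ∈ Ioc 0 (2 * a), 0 < Real.cos y := fun y hy =>
    Real.cos_pos_of_mem_Ioo ⟨by linarith [hy.1], by linarith [hy.2]⟩
  have hmema : a ∈ Ioc 0 (2 * a) := ⟨ha0, by linarith⟩
  have hsa := hsin a hmema
  have hca := hcos a hmema
  set D := Real.cos a ^ m / Real.sin a with hD
  have hD0 : 0 < D := div_pos (Real.rpow_pos_of_pos hca m) hsa
  set h : ℝ → ℝ := fun y => D * (Real.cos (p * y) / Real.sin y ^ p) - G y with hh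
  have hder : ∀ y ∈ Ioc 0 (2 * a), HasDerivAt h
      (-(p * Real.cos y ^ m / Real.sin y ^ (p + 1)) *
        (D * (Real.cos ((p - 1) * y) / Real.cos y ^ m) - 1)) y := by
    intro y hy
    have hs := hsin y hy
    have hc := hcos y hy
    have h1 : HasDerivAt (fun x : ℝ => Real.cos (p * x)) (-Real.sin (p * y) * p) y := by
      simpa using ((hasDerivAt_id y).const_mul p).cos
    have h2 := (Real.hasDerivAt_sin y).rpow_const (p := p) (Or.inl hs.ne')
    have h3 := (h1.div h2 (Real.rpow_pos_of_pos hs p).ne').const_mul D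
    refine (h3.sub (hG y ⟨hy.1, by linarith [hy.2]⟩)).congr_deriv ?_
    have e1 : Real.cos ((p - 1) * y) =
        Real.cos (p * y) * Real.cos y + Real.sin (p * y) * Real.sin y := by
      rw [← Real.cos_sub]; congr 1; ring
    have e2 : Real.sin y ^ (p - 1) = Real.sin y ^ p / Real.sin y := Real.rpow_sub_one hs.ne' p
    have e3 : Real.sin y ^ (p + 1) = Real.sin y ^ p * Real.sin y := Real.rpow_add_one hs.ne' p
    have h4 := (Real.rpow_pos_of_pos hs p).ne'
    have h5 := (Real.rpow_pos_of_pos hc m).ne'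
    rw [e1, e2, e3]
    field_simp
    ring
  have hDa : D * (Real.cos ((p - 1) * a) / Real.cos a ^ m) = 1 := by
    have h5 := (Real.rpow_pos_of_pos hca m).ne'
    rw [hqa, hD]; field_simp
  have hfac : ∀ y ∈ Ioc 0 (2 * a), 0 ≤ p * Real.cos y ^ m / Real.sin y ^ (p + 1) := fun y hy =>
    div_nonneg (mul_nonneg hp0.le (Real.rpow_nonneg (hcos y hy).le _))
      (Real.rpow_nonneg (hsin y hy).le _)
  have key : h a ≤ h x := by
    rcases le_total x a with hxa | hxa
    · have hsub : Icc x a ⊆ Ioc 0 (2 * a) := fun y hy =>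
        ⟨by linarith [hx.1, hy.1], by linarith [hy.2]⟩
      refine antitoneOn_of_deriv_nonpos (convex_Icc x a)
        (fun y hy => (hder y (hsub hy)).continuousAt.continuousWithinAt)
        (fun y hy => (hder y (hsub (interior_subset hy))).differentiableAt.differentiableWithinAt)
        ?_ ⟨le_rfl, hxa⟩ ⟨hxa, le_rfl⟩ hxa
      intro y hy
      have hy' := interior_subset hy
      have hy2 := hsub hy'
      rw [(hder y hy2).deriv]
      have := hR ⟨hy2.1.le, hy2.2⟩ ⟨ha0.le, hmema.2⟩ hy'.2
      have := mul_le_mul_of_nonneg_left this hD0.le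
      simp only [hDa] at this
      exact mul_nonpos_of_nonpos_of_nonneg (neg_nonpos.2 (hfac y hy2)) (by linarith)
    · have hsub : Icc a x ⊆ Ioc 0 (2 * a) := fun y hy =>
        ⟨by linarith [hy.1], by linarith [hy.2, hx.2]⟩
      refine monotoneOn_of_deriv_nonneg (convex_Icc a x)
        (fun y hy => (hder y (hsub hy)).continuousAt.continuousWithinAt)
        (fun y hy => (hder y (hsub (interior_subset hy))).differentiableAt.differentiableWithinAt)
        ?_ ⟨le_rfl, hxa⟩ ⟨hxa, le_rfl⟩ hxa
      intro y hy
      have hy' := interior_subset hy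
      have hy2 := hsub hy'
      rw [(hder y hy2).deriv]
      have := hR ⟨ha0.le, hmema.2⟩ ⟨hy2.1.le, hy2.2⟩ hy'.1
      have := mul_le_mul_of_nonneg_left this hD0.le
      simp only [hDa] at this
      exact mul_nonneg_of_nonpos_of_nonpos (neg_nonpos.2 (hfac y hy2)) (by linarith)
  simp only [hh, hpa, Real.cos_pi_div_two, zero_div, mul_zero, zero_sub] at key
  linarith

lemma one_le_cos_rpow_div_sin {p m : ℝ} (hp : 2 < p) (hm : 0 ≤ m) (hmp : m ≤ p - 1) :
    1 ≤ Real.cos (Real.pi / (2 * p)) ^ m / Real.sin (Real.pi / (2 * p)) := by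
  have hpi := Real.pi_pos
  have hp0 : 0 < p := by linarith
  have hlt : Real.pi / (2 * p) < Real.pi / 2 := by gcongr; linarith
  have ha0 : 0 < Real.pi / (2 * p) := by positivity
  have hqa : Real.cos ((p - 1) * (Real.pi / (2 * p))) = Real.sin (Real.pi / (2 * p)) := by
    rw [← Real.cos_pi_div_two_sub]; congr 1; field_simp
  have := antitoneOn_cos_mul_div_cos_rpow hp hm hmp (a := 0) (b := Real.pi / (2 * p))
    ⟨le_rfl, by positivity⟩ ⟨ha0.le, by gcongr; linarith⟩ ha0.le
  have hs : 0 < Real.sin (Real.pi / (2 * p)) := Real.sin_pos_of_pos_of_lt_pi ha0 (by linarith)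
  have hc : 0 < Real.cos (Real.pi / (2 * p)) ^ m :=
    Real.rpow_pos_of_pos (Real.cos_pos_of_mem_Ioo ⟨by linarith, hlt⟩) m
  simp only [hqa, mul_zero, Real.cos_zero, Real.one_rpow, div_one] at this
  rw [div_le_one hc] at this
  rwa [one_le_div hs]

lemma mul_sin_rpow_le {p m : ℝ} (hp : 2 < p) (hm : 0 ≤ m) (hmp : m ≤ p - 1)
    {G : ℝ → ℝ} (hG : ∀ x ∈ Ioo 0 (Real.pi / 2),
      HasDerivAt G (-p * Real.cos x ^ m / Real.sin x ^ (p + 1)) x)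
    (hanti : AntitoneOn G (Ioc 0 (Real.pi / 2)))
    {x : ℝ} (hx : x ∈ Ioc 0 (Real.pi / 2)) :
    G x * Real.sin x ^ p ≤ G (Real.pi / (2 * p)) * Real.sin x ^ p +
      Real.cos (Real.pi / (2 * p)) ^ m / Real.sin (Real.pi / (2 * p)) *
        Real.cos (min (x * p) Real.pi) := by
  have hpi := Real.pi_pos
  have hp0 : 0 < p := by linarith
  have hlt : Real.pi / p < Real.pi / 2 := by gcongr
  have hsx : 0 < Real.sin x := Real.sin_pos_of_pos_of_lt_pi hx.1 (by linarith [hx.2])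
  have hspx := Real.rpow_pos_of_pos hsx p
  rcases le_total (x * p) Real.pi with hxp | hxp
  · have := le_add_mul_cos_div_sin_rpow hp hm hmp hG ⟨hx.1, (le_div_iff₀ hp0).2 hxp⟩
    have := mul_le_mul_of_nonneg_right this hspx.le
    rw [min_eq_left hxp, mul_comm x p]
    refine this.trans_eq ?_
    rw [add_mul, mul_assoc _ (_ / _) (_ ^ p), div_mul_cancel₀ _ hspx.ne']
  · have hD := one_le_cos_rpow_div_sin hp hm hmp
    set D := Real.cos (Real.pi / (2 * p)) ^ m / Real.sin (Real.pi / (2 * p))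
    have hb0 : 0 < Real.pi / p := by positivity
    have hb : Real.pi / p ≤ x := (div_le_iff₀ hp0).2 hxp
    have h1 := le_add_mul_cos_div_sin_rpow hp hm hmp hG ⟨hb0, le_rfl⟩
    have h2 := hanti ⟨hb0, hlt.le⟩ hx hb
    have hsb : 0 < Real.sin (Real.pi / p) := Real.sin_pos_of_pos_of_lt_pi hb0 (by linarith)
    have h3 : Real.sin (Real.pi / p) ≤ Real.sin x :=
      Real.sin_le_sin_of_le_of_le_pi_div_two (by linarith) hx.2 hb
    have h4 : Real.sin (Real.pi / p) ^ p ≤ Real.sin x ^ p := by gcongr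
    have h5 := Real.rpow_pos_of_pos hsb p
    rw [min_eq_right hxp, Real.cos_pi]
    rw [mul_div_cancel₀ _ hp0.ne', Real.cos_pi] at h1
    have h6 : 1 ≤ 1 / Real.sin (Real.pi / p) ^ p * Real.sin x ^ p := by
      rw [one_div, inv_mul_eq_div, one_le_div h5]; exact h4
    have h7 := mul_le_mul_of_nonneg_right (h2.trans h1) hspx.le
    have h8 := mul_le_mul_of_nonneg_left h6 (zero_le_one.trans hD)
    have h9 : -1 / Real.sin (Real.pi / p) ^ p = -(1 / Real.sin (Real.pi / p) ^ p) := neg_div _ _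
    rw [h9] at h7
    linarith

lemma cos_rpow_le {p : ℝ} (hp : 2 < p) {x : ℝ} (hx : x ∈ Icc 0 (Real.pi / 2)) :
    Real.cos x ^ p ≤ Real.cot (Real.pi / (2 * p)) ^ p * Real.sin x ^ p +
      Real.cos (Real.pi / (2 * p)) ^ (p - 1) / Real.sin (Real.pi / (2 * p)) *
        Real.cos (min (x * p) Real.pi) := by
  have hpi := Real.pi_pos
  have hp0 : 0 < p := by linarith
  rcases hx.1.eq_or_lt with rfl | h0
  · have := one_le_cos_rpow_div_sin hp (by linarith : 0 ≤ p - 1) le_rfl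
    simpa [Real.zero_rpow hp0.ne', hpi.le] using this
  have hsin : ∀ y ∈ Ioc 0 (Real.pi / 2), 0 < Real.sin y := fun y hy =>
    Real.sin_pos_of_pos_of_lt_pi hy.1 (by linarith [hy.2])
  have hcos : ∀ y ∈ Ioc 0 (Real.pi / 2), 0 ≤ Real.cos y := fun y hy =>
    Real.cos_nonneg_of_mem_Icc ⟨by linarith [hy.1], by linarith [hy.2]⟩
  have := mul_sin_rpow_le hp (by linarith : 0 ≤ p - 1) le_rfl
    (G := fun y => (Real.cos y / Real.sin y) ^ p) ?_ ?_ ⟨h0, hx.2⟩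
  · simp only [← Real.cot_eq_cos_div_sin] at this
    refine le_trans (le_of_eq ?_) this
    rw [Real.cot_eq_cos_div_sin, Real.div_rpow (hcos x ⟨h0, hx.2⟩) (hsin x ⟨h0, hx.2⟩).le,
      div_mul_cancel₀ _ (Real.rpow_pos_of_pos (hsin x ⟨h0, hx.2⟩) p).ne']
  · intro y hy
    have hs := hsin y ⟨hy.1, hy.2.le⟩
    have hc : 0 < Real.cos y := Real.cos_pos_of_mem_Ioo ⟨by linarith [hy.1], hy.2⟩
    have h1 := ((Real.hasDerivAt_cos y).div (Real.hasDerivAt_sin y) hs.ne').rpow_const (p := p)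
      (Or.inr (by linarith))
    refine h1.congr_deriv ?_
    have e3 : Real.sin y ^ (p + 1) = Real.sin y ^ (p - 1) * Real.sin y ^ 2 := by
      rw [← Real.rpow_natCast, ← Real.rpow_add hs]; congr 1; push_cast; ring
    have h4 := (Real.rpow_pos_of_pos hs (p - 1)).ne'
    simp only [Pi.div_apply]
    rw [e3, Real.div_rpow hc.le hs.le]
    have e4 := Real.sin_sq_add_cos_sq y
    field_simp
    linear_combination (-1) * e4
  · intro y hy z hz hyz
    simp only
    have := hcos z hz
    have := hsin y hy
    gcongr
    · exact div_nonneg (hcos z hz) (hsin z hz).le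
    · exact hcos y hy
    · exact Real.cos_le_cos_of_nonneg_of_le_pi hy.1.le (by linarith [hz.2]) hyz
    · exact Real.sin_le_sin_of_le_of_le_pi_div_two (by linarith [hy.1]) hz.2 hyz

lemma one_le_inv_sin_rpow_mul {p : ℝ} (hp : 2 < p) {x : ℝ} (hx : x ∈ Icc 0 (Real.pi / 2)) :
    1 ≤ (Real.sin (Real.pi / (2 * p)))⁻¹ ^ p * Real.sin x ^ p +
      Real.cos (Real.pi / (2 * p)) ^ (1 : ℝ) / Real.sin (Real.pi / (2 * p)) *
        Real.cos (min (x * p) Real.pi) := by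
  have hpi := Real.pi_pos
  have hp0 : 0 < p := by linarith
  rcases hx.1.eq_or_lt with rfl | h0
  · have := one_le_cos_rpow_div_sin hp zero_le_one (by linarith : 1 ≤ p - 1)
    simpa [Real.zero_rpow hp0.ne', hpi.le] using this
  have hsin : ∀ y ∈ Ioc 0 (Real.pi / 2), 0 < Real.sin y := fun y hy =>
    Real.sin_pos_of_pos_of_lt_pi hy.1 (by linarith [hy.2])
  have := mul_sin_rpow_le hp zero_le_one (by linarith : 1 ≤ p - 1)
    (G := fun y => (Real.sin y)⁻¹ ^ p) ?_ ?_ ⟨h0, hx.2⟩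
  · refine le_trans (le_of_eq ?_) this
    rw [Real.inv_rpow (hsin x ⟨h0, hx.2⟩).le,
      inv_mul_cancel₀ (Real.rpow_pos_of_pos (hsin x ⟨h0, hx.2⟩) p).ne']
  · intro y hy
    have hs := hsin y ⟨hy.1, hy.2.le⟩
    have h1 := ((Real.hasDerivAt_sin y).inv hs.ne').rpow_const (p := p)
      (Or.inr (by linarith))
    refine h1.congr_deriv ?_
    have e3 : Real.sin y ^ (p + 1) = Real.sin y ^ (p - 1) * Real.sin y ^ 2 := by
      rw [← Real.rpow_natCast, ← Real.rpow_add hs]; congr 1; push_cast; ring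
    have h4 := (Real.rpow_pos_of_pos hs (p - 1)).ne'
    simp only [Pi.inv_apply]
    rw [e3, Real.inv_rpow hs.le, Real.rpow_one]
    field_simp
  · intro y hy z hz hyz
    simp only
    have := hsin y hy
    have := hsin z hz
    gcongr
    exact Real.sin_le_sin_of_le_of_le_pi_div_two (by linarith [hy.1]) hz.2 hyz

lemma exists_entire_re_approx {g : ℂ → ℝ} (hg : ContinuousOn g (Metric.sphere 0 1)) {ε : ℝ}
    (hε : 0 < ε) :
    ∃ P : ℂ → ℂ, Differentiable ℂ P ∧ ∀ z ∈ Metric.sphere (0 : ℂ) 1, |(P z).re - g z| < ε := by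
  have : Fact (0 < (1 : ℝ)) := ⟨one_pos⟩
  let e := AddCircle.homeomorphCircle (one_ne_zero (α := ℝ))
  have hmem : ∀ t, (e t : ℂ) ∈ Metric.sphere (0 : ℂ) 1 := fun t => by
    simpa using Circle.norm_coe (e t)
  let G : C(AddCircle (1 : ℝ), ℂ) := ⟨fun t => ((g (e t) : ℝ) : ℂ),
    Complex.continuous_ofReal.comp (hg.comp_continuous
      (continuous_subtype_val.comp e.continuous) hmem)⟩
  have hG : G ∈ (Submodule.span ℂ (range (@fourier (1 : ℝ)))).topologicalClosure := by
    rw [span_fourier_closure_eq_top]; trivial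
  obtain ⟨h, hh, hd⟩ := Metric.mem_closure_iff.1 hG ε hε
  have hrep : ∀ h ∈ Submodule.span ℂ (range (@fourier (1 : ℝ))), ∃ P Q : ℂ → ℂ,
      Differentiable ℂ P ∧ Differentiable ℂ Q ∧
        ∀ t, h t = P (e t) + (starRingEnd ℂ) (Q (e t)) := by
    intro h hh
    induction hh using Submodule.span_induction with
    | mem x hx =>
      obtain ⟨n, rfl⟩ := hx
      obtain ⟨n, rfl | rfl⟩ := n.eq_nat_or_neg
      · refine ⟨fun z => z ^ n, fun _ => 0, by fun_prop, by fun_prop, fun t => ?_⟩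
        simp [e, AddCircle.homeomorphCircle_apply, fourier_apply, AddCircle.toCircle_nsmul]
      · refine ⟨fun _ => 0, fun z => z ^ n, by fun_prop, by fun_prop, fun t => ?_⟩
        rw [fourier_neg]
        simp [e, AddCircle.homeomorphCircle_apply, fourier_apply, AddCircle.toCircle_nsmul]
    | zero => exact ⟨fun _ => 0, fun _ => 0, by fun_prop, by fun_prop, fun t => by simp⟩
    | add x y _ _ hx hy =>
      obtain ⟨P, Q, hP, hQ, h1⟩ := hx
      obtain ⟨P', Q', hP', hQ', h2⟩ := hy
      refine ⟨fun z => P z + P' z, fun z => Q z + Q' z, by fun_prop, by fun_prop, fun t => ?_⟩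
      simp only [ContinuousMap.add_apply, h1, h2, map_add]
      ring
    | smul c x _ hx =>
      obtain ⟨P, Q, hP, hQ, h1⟩ := hx
      refine ⟨fun z => c * P z, fun z => (starRingEnd ℂ) c * Q z, by fun_prop, by fun_prop,
        fun t => ?_⟩
      simp only [ContinuousMap.smul_apply, h1, map_mul, smul_eq_mul, Complex.conj_conj]
      ring
  obtain ⟨P, Q, hP, hQ, hPQ⟩ := hrep h hh
  refine ⟨fun z => P z + Q z, by fun_prop, fun z hz => ?_⟩
  have hz1 : z ∈ Submonoid.unitSphere ℂ := hz
  obtain ⟨t, ht⟩ := e.surjective ⟨z, hz1⟩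
  have hz' : (e t : ℂ) = z := by rw [ht]
  have hdt := (ContinuousMap.dist_apply_le_dist t).trans_lt hd
  rw [dist_comm, dist_eq_norm] at hdt
  refine lt_of_le_of_lt ?_ hdt
  refine le_trans (le_of_eq ?_) (Complex.abs_re_le_norm _)
  rw [hPQ]
  simp [G, hz']

lemma le_circleAverage_of_support {F : ℂ → ℝ} (hF : ContinuousOn F (Metric.closedBall 0 1))
    (hsupp : ∀ z₀ ∈ Metric.ball (0 : ℂ) 1, ∀ ε > 0, ∃ K : ℂ → ℂ, AnalyticAt ℂ K z₀ ∧
      (K z₀).re = F z₀ ∧ ∀ᶠ z in nhds z₀, (K z).re ≤ F z + ε * ‖z - z₀‖ ^ 2) :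
    F 0 ≤ Real.circleAverage F 0 1 := by
  refine le_of_forall_pos_le_add fun δ hδ => ?_
  obtain ⟨ε, hε, rfl⟩ : ∃ ε > 0, δ = 3 * ε := ⟨δ / 3, by positivity, by ring⟩
  have hsph : Metric.sphere (0 : ℂ) 1 ⊆ Metric.closedBall 0 1 := Metric.sphere_subset_closedBall
  obtain ⟨P, hP, hPF⟩ := exists_entire_re_approx (hF.mono hsph) hε
  have hPc : Continuous fun z => (P z).re := Complex.continuous_re.comp hP.continuous
  obtain ⟨z₀, hz₀, hmax⟩ := (isCompact_closedBall (0 : ℂ) 1).exists_isMaxOn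
    ⟨0, by simp⟩ (f := fun z => F z + ε * ‖z‖ ^ 2 - (P z).re)
    ((hF.add (by fun_prop)).sub hPc.continuousOn)
  have hz₀s : z₀ ∈ Metric.sphere (0 : ℂ) 1 := by
    by_contra hns
    have hball : z₀ ∈ Metric.ball (0 : ℂ) 1 := by
      rw [← Metric.closedBall_sdiff_sphere]; exact ⟨hz₀, hns⟩
    obtain ⟨K, hK, hK0, hKle⟩ := hsupp z₀ hball (ε / 2) (by positivity)
    set H : ℂ → ℂ := fun z => K z - P z + 2 * ε * ((starRingEnd ℂ) z₀ * z) with hH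
    have hHan : AnalyticAt ℂ H z₀ := by
      have : AnalyticAt ℂ P z₀ := hP.analyticAt z₀
      fun_prop
    have hHre : ∀ z, (H z).re = (K z).re - (P z).re + ε * (‖z‖ ^ 2 + ‖z₀‖ ^ 2 - ‖z - z₀‖ ^ 2) := by
      intro z
      simp only [hH, ← Complex.normSq_eq_norm_sq, Complex.normSq_apply]
      simp
      ring
    have hbd : ∀ᶠ z in nhds z₀, (H z).re + ε / 2 * ‖z - z₀‖ ^ 2 ≤ (H z₀).re := by
      filter_upwards [hKle, Metric.isOpen_ball.mem_nhds hball] with z h1 h2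
      have h3 : F z + ε * ‖z‖ ^ 2 - (P z).re ≤ F z₀ + ε * ‖z₀‖ ^ 2 - (P z₀).re :=
        hmax (Metric.ball_subset_closedBall h2)
      rw [hHre, hHre, hK0]
      simp
      nlinarith
    have hexp : ∀ᶠ z in nhds z₀, cexp (H z) = cexp (H z₀) := by
      refine Complex.eventually_eq_of_isLocalMax_norm (f := fun z => cexp (H z)) ?_ ?_
      · filter_upwards [hHan.eventually_analyticAt] with z hz
        exact hz.differentiableAt.cexp
      · filter_upwards [hbd] with z hz
        simp only [Function.comp, Complex.norm_exp, Real.exp_le_exp]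
        nlinarith [sq_nonneg ‖z - z₀‖]
    have heq : ∀ᶠ z in nhds z₀, z = z₀ := by
      filter_upwards [hbd, hexp] with z h1 h2
      have h3 := congrArg norm h2
      rw [Complex.norm_exp, Complex.norm_exp, Real.exp_eq_exp] at h3
      have h4 : ‖z - z₀‖ ^ 2 ≤ 0 := by nlinarith
      have h5 : ‖z - z₀‖ = 0 := by nlinarith [norm_nonneg (z - z₀)]
      exact sub_eq_zero.1 (norm_eq_zero.1 h5)
    have h6 : ∀ᶠ z in nhdsWithin z₀ {z₀}ᶜ, False := by
      filter_upwards [heq.filter_mono nhdsWithin_le_nhds, self_mem_nhdsWithin] with z h1 h2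
      exact h2 h1
    exact h6.exists.elim fun _ h => h
  have h0 : F 0 ≤ (P 0).re + 2 * ε := by
    have h1 : F 0 + ε * ‖(0 : ℂ)‖ ^ 2 - (P 0).re ≤ F z₀ + ε * ‖z₀‖ ^ 2 - (P z₀).re :=
      hmax (by simp)
    have h2 := abs_lt.1 (hPF z₀ hz₀s)
    have h3 : ‖z₀‖ = 1 := by simpa using hz₀s
    rw [h3] at h1
    simp at h1
    linarith
  have hPi : CircleIntegrable (fun z => (P z).re) 0 1 := hPc.continuousOn.circleIntegrable zero_le_one
  have hFi : CircleIntegrable F 0 1 := (hF.mono hsph).circleIntegrable zero_le_one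
  have hci : CircleIntegrable P 0 1 := hP.continuous.continuousOn.circleIntegrable zero_le_one
  have hmean : Real.circleAverage (fun z => (P z).re) 0 1 = (P 0).re := by
    have h1 : Real.circleAverage P 0 1 = P 0 := by
      exact DiffContOnCl.circleAverage hP.diffContOnCl
    have h2 := Complex.reCLM.circleAverage_comp_comm hci
    rw [h1] at h2
    exact h2
  have hle : Real.circleAverage (fun z => (P z).re) 0 1 ≤
      Real.circleAverage (F + fun _ => ε) 0 1 := by
    refine Real.circleAverage_mono hPi (hFi.add (circleIntegrable_const _ _ _)) ?_
    intro z hz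
    have := (abs_lt.1 (hPF z (by simpa using hz))).2
    simp only [Pi.add_apply]
    linarith
  rw [Real.circleAverage_add hFi (circleIntegrable_const _ _ _), Real.circleAverage_const, hmean]
    at hle
  linarith

/-- The subharmonic function used to compare `Re w` with `Im w` and `w`: it is
equal to `-‖w‖ ^ p cos (p ψ)` where the angle `ψ` between `w` and the imaginary axis is at most
`π / p`, and to `‖w‖ ^ p` elsewhere. -/
noncomputable def rieszMinorant (p : ℝ) (w : ℂ) : ℝ :=
  -(‖w‖ ^ p * Real.cos (min (Complex.arg (⟨|w.im|, |w.re|⟩ : ℂ) * p) Real.pi))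

lemma norm_mk_abs_im_abs_re (w : ℂ) : ‖(⟨|w.im|, |w.re|⟩ : ℂ)‖ = ‖w‖ := by
  rw [← sq_eq_sq₀ (norm_nonneg _) (norm_nonneg _), ← Complex.normSq_eq_norm_sq,
    ← Complex.normSq_eq_norm_sq, Complex.normSq_apply, Complex.normSq_apply]
  simp only [abs_mul_abs_self]
  ring

lemma arg_mk_abs_im_abs_re_mem (w : ℂ) :
    Complex.arg (⟨|w.im|, |w.re|⟩ : ℂ) ∈ Icc 0 (Real.pi / 2) :=
  ⟨Complex.arg_nonneg_iff.2 (abs_nonneg _), Complex.arg_le_pi_div_two_iff.2 (Or.inl (abs_nonneg _))⟩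

lemma norm_mul_cos_arg_mk (w : ℂ) :
    ‖w‖ * Real.cos (Complex.arg (⟨|w.im|, |w.re|⟩ : ℂ)) = |w.im| := by
  rw [← norm_mk_abs_im_abs_re, Complex.norm_mul_cos_arg]

lemma norm_mul_sin_arg_mk (w : ℂ) :
    ‖w‖ * Real.sin (Complex.arg (⟨|w.im|, |w.re|⟩ : ℂ)) = |w.re| := by
  rw [← norm_mk_abs_im_abs_re, Complex.norm_mul_sin_arg]

lemma abs_rieszMinorant_le (p : ℝ) (w : ℂ) : |rieszMinorant p w| ≤ ‖w‖ ^ p := by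
  rw [rieszMinorant, abs_neg, abs_mul, abs_of_nonneg (Real.rpow_nonneg (norm_nonneg w) p)]
  exact mul_le_of_le_one_right (Real.rpow_nonneg (norm_nonneg w) p) (Real.abs_cos_le_one _)

lemma continuousAt_arg_mk_abs {w : ℂ} (hw : w ≠ 0) :
    ContinuousAt (fun w : ℂ => Complex.arg (⟨|w.im|, |w.re|⟩ : ℂ)) w := by
  have hcont : Continuous fun w : ℂ => (⟨|w.im|, |w.re|⟩ : ℂ) := by
    have : (fun w : ℂ => (⟨|w.im|, |w.re|⟩ : ℂ)) =
        fun w : ℂ => ((|w.im| : ℝ) : ℂ) + ((|w.re| : ℝ) : ℂ) * I := by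
      ext w; exact Complex.mk_eq_add_mul_I _ _
    rw [this]; fun_prop
  refine (Complex.continuousAt_arg ?_).comp hcont.continuousAt
  rw [Complex.mem_slitPlane_iff]
  by_cases h : w.re = 0
  · left
    have : w.im ≠ 0 := fun h' => hw (Complex.ext h h')
    simpa using this
  · right; simpa using h

lemma continuous_rieszMinorant {p : ℝ} (hp : 0 < p) : Continuous (rieszMinorant p) := by
  rw [continuous_iff_continuousAt]
  intro w
  have hnorm : Continuous fun w : ℂ => ‖w‖ ^ p :=
    continuous_norm.rpow_const fun _ => Or.inr hp.le
  rcases eq_or_ne w 0 with rfl | hw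
  · have h0 : rieszMinorant p 0 = 0 := by simp [rieszMinorant, Real.zero_rpow hp.ne']
    rw [ContinuousAt, h0]
    refine squeeze_zero_norm (abs_rieszMinorant_le p) ?_
    simpa [Real.zero_rpow hp.ne'] using hnorm.tendsto 0
  · exact (hnorm.continuousAt.mul (Real.continuous_cos.continuousAt.comp
      (((continuousAt_arg_mk_abs hw).mul_const p).min continuousAt_const))).neg

lemma rieszMinorant_nonneg_of_im_eq_zero {p : ℝ} (hp : 2 ≤ p) {w : ℂ} (hw : w.im = 0) :
    0 ≤ rieszMinorant p w := by
  rcases eq_or_ne w 0 with rfl | h0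
  · simp [rieszMinorant, Real.zero_rpow (by linarith : p ≠ 0)]
  have hre : w.re ≠ 0 := fun h => h0 (Complex.ext h hw)
  have harg : Complex.arg (⟨|w.im|, |w.re|⟩ : ℂ) = Real.pi / 2 := by
    rw [Complex.arg_eq_pi_div_two_iff]
    simp [hw, hre]
  rw [rieszMinorant, harg, min_eq_right (by nlinarith [Real.pi_pos]), Real.cos_pi]
  have := Real.rpow_nonneg (norm_nonneg w) p
  linarith

lemma neg_cos_le_neg_cos_min {t : ℝ} : -Real.cos t ≤ -Real.cos (min t Real.pi) := by
  rcases le_total t Real.pi with h | h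
  · rw [min_eq_left h]
  · rw [min_eq_right h, Real.cos_pi]
    linarith [Real.neg_one_le_cos t]

/-- If multiplication by `∓ I` rotates `w` into the right half-plane, then the result has, up to sign, the argument
measured by `rieszMinorant`. -/
lemma re_cpow_rotate {p : ℝ} {w : ℂ} {s : ℝ} (hs : s = 1 ∨ s = -1) (hw : 0 < s * w.im) :
    ((-(s * I) * w) ^ (p : ℂ)).re =
      ‖w‖ ^ p * Real.cos (Complex.arg (⟨|w.im|, |w.re|⟩ : ℂ) * p) := by
  have hs1 : |s| = 1 := by rcases hs with rfl | rfl <;> simp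
  have him : |w.im| = s * w.im := by
    rw [← abs_of_pos hw, abs_mul, hs1, one_mul]
  have hnorm : ‖-(s * I) * w‖ = ‖w‖ := by simp [hs1]
  have hre' : (-(s * I) * w).re = |w.im| := by rw [him]; simp
  have him' : (-(s * I) * w).im = -(s * w.re) := by simp
  have habs : |w.re| = |(-(s * I) * w).im| := by rw [him', abs_neg, abs_mul, hs1, one_mul]
  rw [Complex.cpow_ofReal_re, hnorm]
  congr 1
  set W := -(s * I) * w
  rcases le_total 0 W.im with h | h
  · have : (⟨|w.im|, |w.re|⟩ : ℂ) = W := Complex.ext hre'.symm (by rw [habs, abs_of_nonneg h])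
    rw [this]
  · have hconj : (⟨|w.im|, |w.re|⟩ : ℂ) = (starRingEnd ℂ) W :=
      Complex.ext (by simp [hre']) (by simp [habs, abs_of_nonpos h])
    have hne : W.arg ≠ Real.pi := by
      intro h'
      have h2 := (Complex.arg_eq_pi_iff.1 h').1
      rw [hre'] at h2
      exact absurd (abs_nonneg w.im) (not_le.2 h2)
    rw [hconj, Complex.arg_conj, if_neg hne, neg_mul, Real.cos_neg]

lemma exists_support_rieszMinorant {p : ℝ} (hp : 2 < p) {w₀ : ℂ} (hw₀ : w₀ ≠ 0) :
    ∃ k : ℂ → ℂ, AnalyticAt ℂ k w₀ ∧ (k w₀).re = rieszMinorant p w₀ ∧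
      ∀ᶠ w in nhds w₀, (k w).re ≤ rieszMinorant p w := by
  have hp0 : 0 < p := by linarith
  rcases le_or_gt (Complex.arg (⟨|w₀.im|, |w₀.re|⟩ : ℂ) * p) Real.pi with h | h
  · have him : w₀.im ≠ 0 := by
      intro h0
      have hre : w₀.re ≠ 0 := fun h' => hw₀ (Complex.ext h' h0)
      have harg : Complex.arg (⟨|w₀.im|, |w₀.re|⟩ : ℂ) = Real.pi / 2 := by
        rw [Complex.arg_eq_pi_div_two_iff]
        simp [h0, hre]
      rw [harg] at h
      nlinarith [Real.pi_pos]
    obtain ⟨s, hs, hpos⟩ : ∃ s : ℝ, (s = 1 ∨ s = -1) ∧ 0 < s * w₀.im := by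
      rcases him.lt_or_gt with h | h
      · exact ⟨-1, Or.inr rfl, by linarith⟩
      · exact ⟨1, Or.inl rfl, by linarith⟩
    refine ⟨fun w => -((-(s * I) * w) ^ (p : ℂ)), ?_, ?_, ?_⟩
    · refine ((analyticAt_const.mul analyticAt_id).cpow analyticAt_const ?_).neg
      rw [Complex.mem_slitPlane_iff]
      left
      simpa using hpos
    · simp only [Complex.neg_re, re_cpow_rotate hs hpos, rieszMinorant, min_eq_left h]
    · have : ∀ᶠ w in nhds w₀, 0 < s * w.im :=
        (continuous_const.mul Complex.continuous_im).continuousAt.eventually (lt_mem_nhds hpos)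
      filter_upwards [this] with w hw
      rw [Complex.neg_re, re_cpow_rotate hs hw, rieszMinorant, ← mul_neg, ← mul_neg]
      exact mul_le_mul_of_nonneg_left neg_cos_le_neg_cos_min (Real.rpow_nonneg (norm_nonneg w) p)
  · refine ⟨fun w => ((‖w₀‖ ^ p : ℝ) : ℂ) * (w / w₀) ^ (p : ℂ), ?_, ?_, ?_⟩
    · refine analyticAt_const.mul ((analyticAt_id.div analyticAt_const hw₀).cpow
        analyticAt_const ?_)
      simp [div_self hw₀]
    · rw [Complex.re_ofReal_mul, Complex.cpow_ofReal_re, rieszMinorant, min_eq_right h.le,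
        Real.cos_pi]
      simp [div_self hw₀]
    · filter_upwards [((continuousAt_arg_mk_abs hw₀).mul_const p).eventually
        (lt_mem_nhds h)] with w hw
      rw [Complex.re_ofReal_mul, Complex.cpow_ofReal_re, rieszMinorant, min_eq_right hw.le,
        Real.cos_pi, norm_div, Real.div_rpow (norm_nonneg _) (norm_nonneg _), ← mul_assoc,
        mul_div_cancel₀ _ (Real.rpow_pos_of_pos (norm_pos_iff.2 hw₀) p).ne']
      have := mul_le_of_le_one_right (Real.rpow_nonneg (norm_nonneg w) p)
        (Real.cos_le_one ((w / w₀).arg * p))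
      linarith

lemma exists_support_rieszMinorant_comp {p : ℝ} (hp : 2 < p) {g : ℂ → ℂ} {z₀ : ℂ}
    (hg : AnalyticAt ℂ g z₀) {ε : ℝ} (hε : 0 < ε) :
    ∃ K : ℂ → ℂ, AnalyticAt ℂ K z₀ ∧ (K z₀).re = rieszMinorant p (g z₀) ∧
      ∀ᶠ z in nhds z₀, (K z).re ≤ rieszMinorant p (g z) + ε * ‖z - z₀‖ ^ 2 := by
  have hp0 : 0 < p := by linarith
  by_cases h0 : g z₀ = 0
  · refine ⟨fun _ => 0, analyticAt_const, ?_, ?_⟩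
    · simp [h0, rieszMinorant, Real.zero_rpow hp0.ne']
    · obtain ⟨C, hC0, hC⟩ := hg.differentiableAt.isBigO_sub.exists_pos
      have hsmall : Filter.Tendsto (fun z => ‖g z‖ ^ (p - 2)) (nhds z₀) (nhds 0) := by
        have h1 : ContinuousAt (fun z => ‖g z‖ ^ (p - 2)) z₀ :=
          hg.continuousAt.norm.rpow_const (Or.inr (by linarith))
        have h2 := h1.tendsto
        rwa [h0, norm_zero, Real.zero_rpow (by linarith : p - 2 ≠ 0)] at h2
      filter_upwards [hC.bound, hsmall.eventually (gt_mem_nhds (by positivity : 0 < ε / C ^ 2))]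
        with z h1 h2
      rw [h0, sub_zero] at h1
      have h3 := (abs_le.1 (abs_rieszMinorant_le p (g z))).1
      have h4 : ‖g z‖ ^ p = ‖g z‖ ^ (p - 2) * ‖g z‖ ^ 2 := by
        rw [← Real.rpow_natCast, ← Real.rpow_add' (norm_nonneg _) (by push_cast; linarith)]
        congr 1; push_cast; ring
      have h5 : ‖g z‖ ^ p ≤ ε / C ^ 2 * (C * ‖z - z₀‖) ^ 2 := by
        rw [h4]
        gcongr
      have h6 : ε / C ^ 2 * (C * ‖z - z₀‖) ^ 2 = ε * ‖z - z₀‖ ^ 2 := by field_simp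
      simp only [Complex.zero_re]
      linarith
  · obtain ⟨k, hk, hk0, hkle⟩ := exists_support_rieszMinorant hp h0
    refine ⟨k ∘ g, hk.comp hg, hk0, ?_⟩
    filter_upwards [hg.continuousAt.eventually hkle] with z hz
    have : 0 ≤ ε * ‖z - z₀‖ ^ 2 := by positivity
    simp only [Function.comp]
    linarith

lemma abs_im_rpow_le_s5 {p : ℝ} (hp : 2 < p) (w : ℂ) :
    |w.im| ^ p ≤ Real.cot (Real.pi / (2 * p)) ^ p * |w.re| ^ p -
      Real.cos (Real.pi / (2 * p)) ^ (p - 1) / Real.sin (Real.pi / (2 * p)) *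
        rieszMinorant p w := by
  have hmem := arg_mk_abs_im_abs_re_mem w
  have h := mul_le_mul_of_nonneg_left (cos_rpow_le hp hmem) (Real.rpow_nonneg (norm_nonneg w) p)
  have hpi := Real.pi_pos
  have hc := Real.mul_rpow (z := p) (norm_nonneg w)
    (Real.cos_nonneg_of_mem_Icc ⟨by linarith [hmem.1], hmem.2⟩)
  have hs := Real.mul_rpow (z := p) (norm_nonneg w)
    (Real.sin_nonneg_of_nonneg_of_le_pi hmem.1 (by linarith [hmem.2]))
  rw [norm_mul_cos_arg_mk] at hc
  rw [norm_mul_sin_arg_mk] at hs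
  rw [hc, hs, rieszMinorant]
  linarith

lemma norm_rpow_le {p : ℝ} (hp : 2 < p) (w : ℂ) :
    ‖w‖ ^ p ≤ (Real.sin (Real.pi / (2 * p)))⁻¹ ^ p * |w.re| ^ p -
      Real.cos (Real.pi / (2 * p)) ^ (1 : ℝ) / Real.sin (Real.pi / (2 * p)) *
        rieszMinorant p w := by
  have hmem := arg_mk_abs_im_abs_re_mem w
  have h := mul_le_mul_of_nonneg_left (one_le_inv_sin_rpow_mul hp hmem)
    (Real.rpow_nonneg (norm_nonneg w) p)
  have hpi := Real.pi_pos
  rw [← norm_mul_sin_arg_mk, Real.mul_rpow (norm_nonneg w)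
    (Real.sin_nonneg_of_nonneg_of_le_pi hmem.1 (by linarith [hmem.2])), rieszMinorant]
  linarith

/-- For `p ≥ 2`, both sharp Riesz inequalities hold pointwise up to a function of `w` whose
composition with a holomorphic function satisfies the sub-mean value inequality. -/
lemma exists_minorant {p : ℝ} (hp : 2 ≤ p) :
    ∃ Φ : ℂ → ℝ, Continuous Φ ∧ (∀ w : ℂ, w.im = 0 → 0 ≤ Φ w) ∧
      (∀ (g : ℂ → ℂ) (z₀ : ℂ), AnalyticAt ℂ g z₀ → ∀ ε > 0, ∃ K : ℂ → ℂ, AnalyticAt ℂ K z₀ ∧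
        (K z₀).re = Φ (g z₀) ∧ ∀ᶠ z in nhds z₀, (K z).re ≤ Φ (g z) + ε * ‖z - z₀‖ ^ 2) ∧
      (∃ D ≥ 0, ∀ w : ℂ,
        |w.im| ^ p + D * Φ w ≤ Real.cot (Real.pi / (2 * p)) ^ p * |w.re| ^ p) ∧
      ∃ D ≥ 0, ∀ w : ℂ,
        ‖w‖ ^ p + D * Φ w ≤ (Real.sin (Real.pi / (2 * p)))⁻¹ ^ p * |w.re| ^ p := by
  rcases hp.eq_or_lt with rfl | hp
  · have h4 : Real.pi / (2 * 2) = Real.pi / 4 := by norm_num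
    have hre : ∀ w : ℂ, (w ^ 2).re = w.re ^ 2 - w.im ^ 2 := fun w => by rw [pow_two]; simp; ring
    refine ⟨fun w => (w ^ 2).re, by fun_prop, fun w hw => ?_, fun g z₀ hg ε hε =>
      ⟨fun z => g z ^ 2, hg.pow 2, rfl, Filter.Eventually.of_forall fun z => ?_⟩,
      ⟨1, zero_le_one, fun w => ?_⟩, ⟨1, zero_le_one, fun w => ?_⟩⟩
    · simp only [hre, hw]; nlinarith [sq_nonneg w.re]
    · have : 0 ≤ ε * ‖z - z₀‖ ^ 2 := by positivity
      simp only
      linarith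
    · simp only [hre]
      rw [h4, Real.cot_eq_cos_div_sin, Real.cos_pi_div_four, Real.sin_pi_div_four,
        div_self (by positivity)]
      simp
    · simp only [hre]
      rw [h4, Real.sin_pi_div_four]
      simp only [Real.rpow_two, sq_abs, inv_pow, div_pow, Real.sq_sqrt zero_le_two]
      rw [← Complex.normSq_eq_norm_sq, Complex.normSq_apply]
      norm_num
      linarith
  · have hpi := Real.pi_pos
    have hp0 : 0 < p := by linarith
    have hlt : Real.pi / (2 * p) < Real.pi / 2 := by gcongr; linarith
    have ha0 : 0 < Real.pi / (2 * p) := by positivity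
    have hs : 0 < Real.sin (Real.pi / (2 * p)) := Real.sin_pos_of_pos_of_lt_pi ha0 (by linarith)
    have hc : 0 < Real.cos (Real.pi / (2 * p)) := Real.cos_pos_of_mem_Ioo ⟨by linarith, hlt⟩
    refine ⟨rieszMinorant p, continuous_rieszMinorant hp0,
      fun w hw => rieszMinorant_nonneg_of_im_eq_zero hp.le hw,
      fun g z₀ hg ε hε => exists_support_rieszMinorant_comp hp hg hε,
      ⟨Real.cos (Real.pi / (2 * p)) ^ (p - 1) / Real.sin (Real.pi / (2 * p)), by positivity,
        fun w => ?_⟩,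
      ⟨Real.cos (Real.pi / (2 * p)) ^ (1 : ℝ) / Real.sin (Real.pi / (2 * p)), by positivity,
        fun w => ?_⟩⟩
    · linarith [abs_im_rpow_le_s5 hp w]
    · linarith [norm_rpow_le hp w]

lemma Mp_le_mul_Mp {p D C r : ℝ} (hp : 0 < p) (hD : 0 ≤ D) (hC : 0 ≤ C) {E : Type*}
    [NormedAddCommGroup E] {h : ℂ → E} {u Ψ : ℂ → ℝ}
    (hh : Continuous fun θ : ℝ => h (r * cexp (θ * I)))
    (hu : Continuous fun θ : ℝ => u (r * cexp (θ * I)))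
    (hΨ : Continuous fun θ : ℝ => Ψ (r * cexp (θ * I)))
    (hmean : 0 ≤ ∫ θ in (0 : ℝ)..(2 * Real.pi), Ψ (r * cexp (θ * I)))
    (hle : ∀ θ : ℝ, ‖h (r * cexp (θ * I))‖ ^ p + D * Ψ (r * cexp (θ * I)) ≤
      C ^ p * ‖u (r * cexp (θ * I))‖ ^ p) :
    Mp p r h ≤ C * Mp p r u := by
  have hpi := Real.two_pi_pos
  have hh' := hh.norm.rpow_const fun _ => Or.inr hp.le
  have hu' := hu.norm.rpow_const fun _ => Or.inr hp.le
  have hint := intervalIntegral.integral_mono_on (μ := volume) hpi.le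
    ((hh'.add (hΨ.const_mul D)).intervalIntegrable 0 (2 * Real.pi))
    ((hu'.const_mul (C ^ p)).intervalIntegrable 0 (2 * Real.pi)) fun θ _ => hle θ
  simp only [Pi.add_apply] at hint
  rw [intervalIntegral.integral_add (hh'.intervalIntegrable _ _)
    ((hΨ.const_mul D).intervalIntegrable _ _), intervalIntegral.integral_const_mul,
    intervalIntegral.integral_const_mul] at hint
  have hI : 0 ≤ ∫ θ in (0 : ℝ)..(2 * Real.pi), ‖h (r * cexp (θ * I))‖ ^ p :=
    intervalIntegral.integral_nonneg hpi.le fun θ _ => Real.rpow_nonneg (norm_nonneg _) p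
  have hJ : 0 ≤ ∫ θ in (0 : ℝ)..(2 * Real.pi), ‖u (r * cexp (θ * I))‖ ^ p :=
    intervalIntegral.integral_nonneg hpi.le fun θ _ => Real.rpow_nonneg (norm_nonneg _) p
  have hDm := mul_nonneg hD hmean
  have hc : C = (C ^ p) ^ (1 / p) := by
    rw [← Real.rpow_mul hC, mul_one_div_cancel hp.ne', Real.rpow_one]
  rw [Mp, Mp]
  conv_rhs => rw [hc]
  rw [← Real.mul_rpow (Real.rpow_nonneg hC p) (by positivity)]
  refine Real.rpow_le_rpow (by positivity) ?_ (by positivity)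
  rw [mul_left_comm]
  gcongr
  linarith

lemma hardyNorm_le_mul_hardyNorm {p C : ℝ} (hC : 0 ≤ C) {E : Type*} [NormedAddCommGroup E]
    {h : ℂ → E} {u : ℂ → ℝ} (hu : MemHp p u)
    (hle : ∀ r ∈ Ico (0 : ℝ) 1, Mp p r h ≤ C * Mp p r u) :
    hardyNorm p h ≤ C * hardyNorm p u := by
  refine csSup_le (Set.Nonempty.image _ ⟨0, by simp⟩) ?_
  rintro _ ⟨r, hr, rfl⟩
  exact (hle r hr).trans (mul_le_mul_of_nonneg_left (le_csSup hu (mem_image_of_mem _ hr)) hC)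

/-- Verbitsky's inequalities: Riesz type estimates with sharp constants for
analytic functions. -/
theorem riesz_verbitsky_analytic
    (p : ℝ) (hp : 2 ≤ p) (f : ℂ → ℂ)
    (hf : DifferentiableOn ℂ f (Metric.ball 0 1))
    (hv0 : (f 0).im = 0)
    (hu : MemHp p (fun z => (f z).re)) :
    hardyNorm p f ≤ (Real.sin (Real.pi / (2 * p)))⁻¹ * hardyNorm p (fun z => (f z).re) ∧
    hardyNorm p (fun z => (f z).im) ≤
      Real.cot (Real.pi / (2 * p)) * hardyNorm p (fun z => (f z).re) := by
  have hpi := Real.pi_pos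
  have hp0 : 0 < p := by linarith
  have hlt : Real.pi / (2 * p) < Real.pi / 2 := by gcongr; linarith
  have ha0 : 0 < Real.pi / (2 * p) := by positivity
  have hs : 0 < Real.sin (Real.pi / (2 * p)) := Real.sin_pos_of_pos_of_lt_pi ha0 (by linarith)
  have hc : 0 < Real.cos (Real.pi / (2 * p)) := Real.cos_pos_of_mem_Ioo ⟨by linarith, hlt⟩
  have hcot : 0 ≤ Real.cot (Real.pi / (2 * p)) := by
    rw [Real.cot_eq_cos_div_sin]; positivity
  obtain ⟨Φ, hΦ, hΦ0, hΦsupp, ⟨D₁, hD₁, him⟩, ⟨D₂, hD₂, hnorm⟩⟩ := exists_minorant hp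
  have hmaps : ∀ r ∈ Ico (0 : ℝ) 1, ∀ z ∈ Metric.closedBall (0 : ℂ) 1,
      (r : ℂ) * z ∈ Metric.ball (0 : ℂ) 1 := by
    intro r hr z hz
    have hz1 : ‖z‖ ≤ 1 := by simpa using hz
    rw [mem_ball_zero_iff, norm_mul, Complex.norm_real, Real.norm_of_nonneg hr.1]
    nlinarith [hr.1, hr.2, norm_nonneg z]
  have hcirc : ∀ r ∈ Ico (0 : ℝ) 1, Continuous fun θ : ℝ => f (r * cexp (θ * I)) := fun r hr =>
    hf.continuousOn.comp_continuous (by fun_prop) fun θ => hmaps r hr _ (by simp)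
  have hmean : ∀ r ∈ Ico (0 : ℝ) 1,
      0 ≤ ∫ θ in (0 : ℝ)..(2 * Real.pi), Φ (f (r * cexp (θ * I))) := by
    intro r hr
    have hsub := le_circleAverage_of_support (F := fun z => Φ (f (r * z)))
      (hΦ.comp_continuousOn (hf.continuousOn.comp (by fun_prop) (hmaps r hr))) fun z₀ hz₀ ε hε => by
        refine hΦsupp (fun z => f (r * z)) z₀ ?_ ε hε
        have h1 : AnalyticAt ℂ f (r * z₀) := hf.analyticAt
          (Metric.isOpen_ball.mem_nhds (hmaps r hr z₀ (Metric.ball_subset_closedBall hz₀)))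
        exact h1.comp_of_eq (analyticAt_const.mul analyticAt_id) rfl
    have h0 : 0 ≤ Φ (f (r * 0)) := hΦ0 _ (by simpa using hv0)
    have h1 := h0.trans hsub
    simp only [Real.circleAverage, circleMap, smul_eq_mul, zero_add, Complex.ofReal_one,
      one_mul] at h1
    exact nonneg_of_mul_nonneg_right h1 (by positivity)
  refine ⟨hardyNorm_le_mul_hardyNorm (inv_nonneg.2 hs.le) hu fun r hr => ?_,
    hardyNorm_le_mul_hardyNorm hcot hu fun r hr => ?_⟩
  · exact Mp_le_mul_Mp (Ψ := fun z => Φ (f z)) hp0 hD₂ (inv_nonneg.2 hs.le) (hcirc r hr)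
      (Complex.continuous_re.comp (hcirc r hr)) (hΦ.comp (hcirc r hr)) (hmean r hr)
      fun θ => hnorm _
  · exact Mp_le_mul_Mp (Ψ := fun z => Φ (f z)) hp0 hD₁ hcot
      (Complex.continuous_im.comp (hcirc r hr))
      (Complex.continuous_re.comp (hcirc r hr)) (hΦ.comp (hcirc r hr)) (hmean r hr)
      fun θ => him _
end

section
/- (Kolmogorov type theorem for harmonic (K,K')-quasiregular mappings.) Let K ≥ 1 and K' ≥ 0 and let f = u + iv be a harmonic (K,K')-quasiregular mapping on the unit disk 𝔻 with v(0) = 0. If u ∈ h¹, then v ∈ h^q for every 0 < q < 1. -/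
open Complex MeasureTheory Set

open Filter Topology

theorem HasLineDerivAt.hasDerivAt_add_smul {φ : ℂ → ℝ} {φ' : ℝ} {a e : ℂ} {t : ℝ}
    (h : HasLineDerivAt ℝ φ φ' (a + t • e) e) :
    HasDerivAt (fun s : ℝ => φ (a + s • e)) φ' t := by
  have h1 : HasDerivAt (fun s : ℝ => φ (a + t • e + s • e)) φ' (t - t) := by
    rw [sub_self]; exact h
  have h2 := h1.comp_sub_const t t
  refine h2.congr_of_eventuallyEq (Eventually.of_forall fun s => ?_)
  simp only [add_assoc, ← add_smul]
  ring_nf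

/-- Differentiation under the integral sign over vertical segments. -/
theorem hasDerivAt_integral_vertical {φ φ₁ : ℂ → ℝ} {b : ℝ}
    (hφ : ContinuousOn φ {w | w.re < 0}) (hφ₁ : ContinuousOn φ₁ {w | w.re < 0})
    (hd : ∀ w : ℂ, w.re < 0 → HasLineDerivAt ℝ φ (φ₁ w) w 1) {x : ℝ} (hx : x < 0) :
    HasDerivAt (fun x : ℝ => ∫ θ in (0 : ℝ)..b, φ (θ * I + x • 1))
      (∫ θ in (0 : ℝ)..b, φ₁ (θ * I + x • 1)) x := by
  have hcont : ∀ ψ : ℂ → ℝ, ContinuousOn ψ {w | w.re < 0} → ∀ x < 0,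
      Continuous fun θ : ℝ => ψ (θ * I + (x : ℝ) • 1) := by
    intro ψ hψ x hx
    refine hψ.comp_continuous (by fun_prop) fun θ => ?_
    simpa using hx
  obtain ⟨C, hC⟩ : ∃ C, ∀ p ∈ Icc (2 * x) (x / 2) ×ˢ uIcc 0 b,
      ‖φ₁ ((p.2 : ℂ) * I + p.1 • 1)‖ ≤ C := by
    refine (isCompact_Icc.prod isCompact_uIcc).exists_bound_of_continuousOn ?_
    refine hφ₁.comp (by fun_prop) fun p hp => ?_
    have : p.1 < 0 := hp.1.2.trans_lt (by linarith)
    simpa using this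
  refine (intervalIntegral.hasDerivAt_integral_of_dominated_loc_of_deriv_le
    (F := fun (x θ : ℝ) => φ (θ * I + x • 1)) (F' := fun (x θ : ℝ) => φ₁ (θ * I + x • 1))
    (bound := fun _ => C) (s := Icc (2 * x) (x / 2)) (Icc_mem_nhds (by linarith) (by linarith))
    ?_ ?_ ?_ ?_ ?_ ?_).2
  · filter_upwards [gt_mem_nhds hx] with y hy
    exact (hcont φ hφ y hy).aestronglyMeasurable
  · exact (hcont φ hφ x hx).intervalIntegrable _ _
  · exact (hcont φ₁ hφ₁ x hx).aestronglyMeasurable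
  · exact Eventually.of_forall fun θ hθ y hy => hC (y, θ) ⟨hy, uIoc_subset_uIcc hθ⟩
  · exact intervalIntegrable_const
  · refine Eventually.of_forall fun θ _ y hy => HasLineDerivAt.hasDerivAt_add_smul (hd _ ?_)
    have : y < 0 := hy.2.trans_lt (by linarith)
    simpa using this

/-- A function with nonpositive second derivative on the negative half-line that is bounded below
near `-∞` is antitone. -/
theorem antitoneOn_of_second_deriv_nonpos_of_bddBelow {m m₁ m₂ : ℝ → ℝ} {c t₀ : ℝ}
    (h1 : ∀ x < 0, HasDerivAt m (m₁ x) x) (h2 : ∀ x < 0, HasDerivAt m₁ (m₂ x) x)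
    (hneg : ∀ x < 0, m₂ x ≤ 0) (hbdd : ∀ x < t₀, c ≤ m x) : AntitoneOn m (Iio 0) := by
  have hm₁ : AntitoneOn m₁ (Iio 0) := by
    refine antitoneOn_of_deriv_nonpos (convex_Iio 0)
      (fun x hx => (h2 x hx).continuousAt.continuousWithinAt) ?_ ?_
    · rw [interior_Iio]
      exact fun x hx => (h2 x hx).differentiableAt.differentiableWithinAt
    · rw [interior_Iio]
      intro x hx
      rw [(h2 x hx).deriv]
      exact hneg x hx
  have hm₁neg : ∀ s < 0, m₁ s ≤ 0 := by
    intro s hs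
    by_contra! hpos
    have key : ∀ x < s, m x ≤ m s - m₁ s * (s - x) := by
      intro x hx
      have := (convex_Iic s).mul_sub_le_image_sub_of_le_deriv (f := m) (C := m₁ s)
        (fun y hy => (h1 y (lt_of_le_of_lt hy hs)).continuousAt.continuousWithinAt)
        (fun y hy => by
          have hy' : y ∈ Iic s := interior_subset hy
          exact (h1 y (lt_of_le_of_lt hy' hs)).differentiableAt.differentiableWithinAt)
        (fun y hy => by
          have hy' : y ∈ Iic s := interior_subset hy
          rw [(h1 y (lt_of_le_of_lt hy' hs)).deriv]
          exact hm₁ (lt_of_le_of_lt hy' hs) hs hy')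
        x hx.le s self_mem_Iic hx.le
      linarith
    set x := min (t₀ - 1) (min (s - 1) (s - (m s - c + 1) / m₁ s)) with hxdef
    have hx1 : x < t₀ := (min_le_left _ _).trans_lt (by linarith)
    have hx2 : x < s := ((min_le_right _ _).trans (min_le_left _ _)).trans_lt (by linarith)
    have hx3 : x ≤ s - (m s - c + 1) / m₁ s := (min_le_right _ _).trans (min_le_right _ _)
    have h3 : (m s - c + 1) / m₁ s ≤ s - x := by linarith
    rw [div_le_iff₀ hpos] at h3
    have := key x hx2
    have := hbdd x hx1
    linarith
  refine antitoneOn_of_deriv_nonpos (convex_Iio 0)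
    (fun x hx => (h1 x hx).continuousAt.continuousWithinAt) ?_ ?_
  · rw [interior_Iio]
    exact fun x hx => (h1 x hx).differentiableAt.differentiableWithinAt
  · rw [interior_Iio]
    intro x hx
    rw [(h1 x hx).deriv]
    exact hm₁neg x hx

/-- The super-mean-value property on circles centred at the origin, for a function whose pull-back
under the exponential map has nonpositive Laplacian `φ₁₁ + φ₂₂` on the left half-plane. -/
theorem integral_circle_le_of_laplacian_nonpos {P : ℂ → ℝ} {φ₁ φ₁₁ φ₂ φ₂₂ : ℂ → ℝ}
    (hP : ContinuousOn P (Metric.ball 0 1))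
    (hφ₁ : ContinuousOn φ₁ {w | w.re < 0}) (hφ₁₁ : ContinuousOn φ₁₁ {w | w.re < 0})
    (hφ₂₂ : ContinuousOn φ₂₂ {w | w.re < 0})
    (hd₁ : ∀ w : ℂ, w.re < 0 → HasLineDerivAt ℝ (fun w => P (exp w)) (φ₁ w) w 1)
    (hd₁₁ : ∀ w : ℂ, w.re < 0 → HasLineDerivAt ℝ φ₁ (φ₁₁ w) w 1)
    (hd₂ : ∀ w : ℂ, w.re < 0 → HasLineDerivAt ℝ (fun w => P (exp w)) (φ₂ w) w I)
    (hd₂₂ : ∀ w : ℂ, w.re < 0 → HasLineDerivAt ℝ φ₂ (φ₂₂ w) w I)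
    (hlap : ∀ w : ℂ, w.re < 0 → φ₁₁ w + φ₂₂ w ≤ 0) {r : ℝ} (hr : r ∈ Ico (0 : ℝ) 1) :
    ∫ θ in (0 : ℝ)..(2 * Real.pi), P (r * exp (θ * I)) ≤ 2 * Real.pi * P 0 := by
  have hpi := Real.two_pi_pos
  rcases hr.1.eq_or_lt with rfl | hr0
  · simp
  have hmaps : MapsTo (fun w : ℂ => exp w) {w | w.re < 0} (Metric.ball 0 1) := by
    intro w hw
    simpa [Complex.norm_exp] using hw
  have hφ : ContinuousOn (fun w => P (exp w)) {w | w.re < 0} :=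
    hP.comp (by fun_prop) hmaps
  have hcont : ∀ ψ : ℂ → ℝ, ContinuousOn ψ {w | w.re < 0} → ∀ x < 0,
      Continuous fun θ : ℝ => ψ (θ * I + (x : ℝ) • 1) := by
    intro ψ hψ x hx
    refine hψ.comp_continuous (by fun_prop) fun θ => ?_
    simpa using hx
  set m : ℝ → ℝ := fun x => ∫ θ in (0 : ℝ)..(2 * Real.pi), P (exp (θ * I + x • 1)) with hm
  have h1 : ∀ x < 0, HasDerivAt m (∫ θ in (0 : ℝ)..(2 * Real.pi), φ₁ (θ * I + x • 1)) x :=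
    fun x hx => hasDerivAt_integral_vertical hφ hφ₁ hd₁ hx
  have h2 : ∀ x < 0, HasDerivAt (fun x : ℝ => ∫ θ in (0 : ℝ)..(2 * Real.pi), φ₁ (θ * I + x • 1))
      (∫ θ in (0 : ℝ)..(2 * Real.pi), φ₁₁ (θ * I + x • 1)) x :=
    fun x hx => hasDerivAt_integral_vertical hφ₁ hφ₁₁ hd₁₁ hx
  have hvert : ∀ (ψ ψ' : ℂ → ℝ), (∀ w : ℂ, w.re < 0 → HasLineDerivAt ℝ ψ (ψ' w) w I) →
      ∀ x < 0, ∀ θ : ℝ, HasDerivAt (fun θ : ℝ => ψ (θ * I + (x : ℝ) • 1))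
        (ψ' (θ * I + (x : ℝ) • 1)) θ := by
    intro ψ ψ' hψ x hx θ
    have : HasDerivAt (fun s : ℝ => ψ (x + s • I)) (ψ' (x + θ • I)) θ :=
      HasLineDerivAt.hasDerivAt_add_smul (hψ _ (by simpa using hx))
    simpa [add_comm] using this
  have hper : ∀ x < 0, φ₂ (((2 * Real.pi : ℝ) : ℂ) * I + (x : ℝ) • 1) =
      φ₂ (((0 : ℝ) : ℂ) * I + (x : ℝ) • 1) := by
    intro x hx
    have ha := hvert _ _ hd₂ x hx (2 * Real.pi)
    have hb := (hvert _ _ hd₂ x hx (2 * Real.pi - 2 * Real.pi)).comp_sub_const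
      (2 * Real.pi) (2 * Real.pi)
    rw [sub_self] at hb
    refine ha.unique (hb.congr_of_eventuallyEq (Eventually.of_forall fun s => ?_))
    dsimp only
    congr 1
    rw [← Complex.exp_periodic (((s - 2 * Real.pi : ℝ) : ℂ) * I + (x : ℝ) • 1)]
    congr 1
    push_cast
    ring
  have hneg : ∀ x < 0, ∫ θ in (0 : ℝ)..(2 * Real.pi), φ₁₁ (θ * I + (x : ℝ) • 1) ≤ 0 := by
    intro x hx
    have h22 : ∫ θ in (0 : ℝ)..(2 * Real.pi), φ₂₂ (θ * I + (x : ℝ) • 1) = 0 := by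
      rw [intervalIntegral.integral_eq_sub_of_hasDerivAt (fun θ _ => hvert _ _ hd₂₂ x hx θ)
        ((hcont _ hφ₂₂ x hx).intervalIntegrable _ _), hper x hx, sub_self]
    have hmono : ∫ θ in (0 : ℝ)..(2 * Real.pi), φ₁₁ (θ * I + (x : ℝ) • 1) ≤
        ∫ θ in (0 : ℝ)..(2 * Real.pi), -φ₂₂ (θ * I + (x : ℝ) • 1) := by
      refine intervalIntegral.integral_mono_on hpi.le
        ((hcont _ hφ₁₁ x hx).intervalIntegrable _ _)
        ((hcont _ hφ₂₂ x hx).neg.intervalIntegrable _ _) fun θ _ => ?_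
      have := hlap (θ * I + (x : ℝ) • 1) (by simpa using hx)
      linarith
    rwa [intervalIntegral.integral_neg, h22, neg_zero] at hmono
  have hnear : ∀ ε > 0, ∃ t₀ < 0, ∀ x < t₀,
      2 * Real.pi * (P 0 - ε) ≤ m x ∧ m x ≤ 2 * Real.pi * (P 0 + ε) := by
    intro ε hε
    have hP0 : ContinuousAt P 0 := hP.continuousAt (Metric.ball_mem_nhds _ one_pos)
    obtain ⟨δ, hδ, hPδ⟩ := Metric.continuousAt_iff.1 hP0 ε hε
    refine ⟨min (-1) (Real.log δ), (min_le_left _ _).trans_lt (by norm_num), fun x hx => ?_⟩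
    have hx0 : x < 0 := (hx.trans_le (min_le_left _ _)).trans (by norm_num)
    have hxδ : Real.exp x < δ :=
      (Real.lt_log_iff_exp_lt hδ).1 (hx.trans_le (min_le_right _ _))
    have hpt : ∀ θ : ℝ, |P (exp (θ * I + (x : ℝ) • 1)) - P 0| < ε := by
      intro θ
      have := hPδ (x := exp (θ * I + (x : ℝ) • 1)) (by simpa [Complex.norm_exp] using hxδ)
      rwa [Real.dist_eq] at this
    have hint := (hcont _ hφ x hx0).intervalIntegrable (μ := volume) 0 (2 * Real.pi)
    constructor
    · have := intervalIntegral.integral_mono_on hpi.le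
        (intervalIntegrable_const (c := P 0 - ε)) hint
        (fun θ _ => by linarith [(abs_lt.1 (hpt θ)).1])
      simpa [hm, mul_sub] using this
    · have := intervalIntegral.integral_mono_on hpi.le hint
        (intervalIntegrable_const (c := P 0 + ε))
        (fun θ _ => by linarith [(abs_lt.1 (hpt θ)).2])
      simpa [hm, mul_add] using this
  obtain ⟨t₁, -, ht₁⟩ := hnear 1 one_pos
  have hanti := antitoneOn_of_second_deriv_nonpos_of_bddBelow h1 h2 hneg (fun x hx => (ht₁ x hx).1)
  have hlog : Real.log r < 0 := Real.log_neg hr0 hr.2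
  have hmr : ∫ θ in (0 : ℝ)..(2 * Real.pi), P (r * exp (θ * I)) = m (Real.log r) := by
    refine intervalIntegral.integral_congr fun θ _ => ?_
    rw [real_smul, mul_one, exp_add, ← ofReal_exp, Real.exp_log hr0, mul_comm]
  rw [hmr]
  refine le_of_forall_pos_le_add fun ε hε => ?_
  obtain ⟨t₀, ht₀, h⟩ := hnear (ε / (2 * Real.pi)) (by positivity)
  have hlt : min (t₀ - 1) (Real.log r) < t₀ := (min_le_left _ _).trans_lt (by linarith)
  calc m (Real.log r) ≤ m (min (t₀ - 1) (Real.log r)) :=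
        hanti (hlt.trans ht₀) hlog (min_le_right _ _)
    _ ≤ 2 * Real.pi * (P 0 + ε / (2 * Real.pi)) := (h _ hlt).2
    _ = 2 * Real.pi * P 0 + ε := by field_simp

/-- The function `(1 + (Re F)² + (Im G)²) ^ p`. -/
noncomputable def gaugePow (F G : ℂ → ℂ) (p : ℝ) (w : ℂ) : ℝ :=
  (1 + (F w).re ^ 2 + (G w).im ^ 2) ^ p

/-- The derivative of `gaugePow F G p` in direction `e`. -/
noncomputable def gaugePowDeriv (F G : ℂ → ℂ) (p : ℝ) (e w : ℂ) : ℝ :=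
  p * gaugePow F G (p - 1) w *
    (2 * ((F w).re * (e * deriv F w).re + (G w).im * (e * deriv G w).im))

/-- The second derivative of `gaugePow F G p` in direction `e`. -/
noncomputable def gaugePowDeriv₂ (F G : ℂ → ℂ) (p : ℝ) (e w : ℂ) : ℝ :=
  p * gaugePow F G (p - 1) w *
    (2 * ((e * deriv F w).re ^ 2 + (F w).re * (e * (e * deriv (deriv F) w)).re +
      ((e * deriv G w).im ^ 2 + (G w).im * (e * (e * deriv (deriv G) w)).im))) +
  p * (p - 1) * gaugePow F G (p - 2) w *
    (2 * ((F w).re * (e * deriv F w).re + (G w).im * (e * deriv G w).im)) ^ 2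

theorem one_add_sq_add_sq_pos (x y : ℝ) : 0 < 1 + x ^ 2 + y ^ 2 := by positivity

theorem hasDerivAt_line {F : ℂ → ℂ} {w : ℂ} (hF : DifferentiableAt ℂ F w) (e : ℂ) :
    HasDerivAt (fun t : ℝ => F (w + t • e)) (e * deriv F w) 0 := by
  have h1 : HasDerivAt (fun t : ℝ => w + t • e) e 0 := by
    simpa using ((hasDerivAt_id (0 : ℝ)).smul_const e).const_add w
  have h2 : HasDerivAt F (deriv F w) (w + (0 : ℝ) • e) := by simpa using hF.hasDerivAt
  exact (h2.comp_of_eq (0 : ℝ) h1 rfl).congr_deriv (mul_comm _ _)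

theorem hasDerivAt_line_re {F : ℂ → ℂ} {w : ℂ} (hF : DifferentiableAt ℂ F w) (e : ℂ) :
    HasDerivAt (fun t : ℝ => (F (w + t • e)).re) (e * deriv F w).re 0 :=
  reCLM.hasFDerivAt.comp_hasDerivAt _ (hasDerivAt_line hF e)

theorem hasDerivAt_line_im {F : ℂ → ℂ} {w : ℂ} (hF : DifferentiableAt ℂ F w) (e : ℂ) :
    HasDerivAt (fun t : ℝ => (F (w + t • e)).im) (e * deriv F w).im 0 :=
  imCLM.hasFDerivAt.comp_hasDerivAt _ (hasDerivAt_line hF e)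

theorem hasLineDerivAt_gaugePow {F G : ℂ → ℂ} {w : ℂ} (hF : DifferentiableAt ℂ F w)
    (hG : DifferentiableAt ℂ G w) (p : ℝ) (e : ℂ) :
    HasLineDerivAt ℝ (gaugePow F G p) (gaugePowDeriv F G p e w) w e := by
  have h := ((((hasDerivAt_line_re hF e).pow 2).const_add 1).add
    ((hasDerivAt_line_im hG e).pow 2)).rpow_const (p := p) (Or.inl (one_add_sq_add_sq_pos _ _).ne')
  refine h.congr_deriv ?_
  simp only [gaugePowDeriv, gaugePow, zero_smul, add_zero, Pi.add_apply, Pi.pow_apply]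
  push_cast
  ring

theorem hasLineDerivAt_gaugePowDeriv {F G : ℂ → ℂ} {w : ℂ} (hF : DifferentiableAt ℂ F w)
    (hG : DifferentiableAt ℂ G w) (hF' : DifferentiableAt ℂ (deriv F) w)
    (hG' : DifferentiableAt ℂ (deriv G) w) (p : ℝ) (e : ℂ) :
    HasLineDerivAt ℝ (gaugePowDeriv F G p e) (gaugePowDeriv₂ F G p e w) w e := by
  have h0 : HasDerivAt (fun t : ℝ => gaugePow F G (p - 1) (w + t • e)) _ 0 :=
    hasLineDerivAt_gaugePow hF hG (p - 1) e
  have hF₂ := hasDerivAt_line_re (hF'.const_mul e) e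
  have hG₂ := hasDerivAt_line_im (hG'.const_mul e) e
  rw [deriv_const_mul _ hF'] at hF₂
  rw [deriv_const_mul _ hG'] at hG₂
  have h := (h0.const_mul p).mul ((((hasDerivAt_line_re hF e).mul hF₂).add
    ((hasDerivAt_line_im hG e).mul hG₂)).const_mul 2)
  refine h.congr_deriv ?_
  have hp : p - 1 - 1 = p - 2 := by ring
  simp only [gaugePowDeriv, gaugePowDeriv₂, zero_smul, add_zero, Pi.add_apply, Pi.mul_apply, hp]
  ring

theorem gaugePow_continuousOn {F G : ℂ → ℂ} {s : Set ℂ} (hF : ContinuousOn F s)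
    (hG : ContinuousOn G s) (p : ℝ) : ContinuousOn (gaugePow F G p) s := by
  have hre := continuous_re.comp_continuousOn hF
  have him := continuous_im.comp_continuousOn hG
  exact ((continuousOn_const.add (hre.pow 2)).add (him.pow 2)).rpow_const
    fun w _ => Or.inl (one_add_sq_add_sq_pos _ _).ne'

theorem gaugePowDeriv_continuousOn {F G : ℂ → ℂ} {s : Set ℂ} (hF : ContinuousOn F s)
    (hG : ContinuousOn G s) (hF' : ContinuousOn (deriv F) s) (hG' : ContinuousOn (deriv G) s)
    (p : ℝ) (e : ℂ) : ContinuousOn (gaugePowDeriv F G p e) s := by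
  have h := gaugePow_continuousOn hF hG (p - 1)
  unfold gaugePowDeriv
  fun_prop

theorem gaugePowDeriv₂_continuousOn {F G : ℂ → ℂ} {s : Set ℂ} (hF : ContinuousOn F s)
    (hG : ContinuousOn G s) (hF' : ContinuousOn (deriv F) s) (hG' : ContinuousOn (deriv G) s)
    (hF'' : ContinuousOn (deriv (deriv F)) s) (hG'' : ContinuousOn (deriv (deriv G)) s)
    (p : ℝ) (e : ℂ) : ContinuousOn (gaugePowDeriv₂ F G p e) s := by
  have h := gaugePow_continuousOn hF hG (p - 1)
  have h' := gaugePow_continuousOn hF hG (p - 2)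
  unfold gaugePowDeriv₂
  fun_prop

/-- The Laplacian of `gaugePow F G p`. -/
theorem gaugePow_laplacian (F G : ℂ → ℂ) (p : ℝ) (w : ℂ) :
    gaugePowDeriv₂ F G p 1 w + gaugePowDeriv₂ F G p I w =
      2 * p * gaugePow F G (p - 1) w * (‖deriv F w‖ ^ 2 + ‖deriv G w‖ ^ 2) +
      4 * p * (p - 1) * gaugePow F G (p - 2) w *
        (((F w).re * (deriv F w).re + (G w).im * (deriv G w).im) ^ 2 +
          (-(F w).re * (deriv F w).im + (G w).im * (deriv G w).re) ^ 2) := by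
  simp only [gaugePowDeriv₂, one_mul, mul_re, mul_im, I_re, I_im, zero_mul, zero_sub,
    zero_add, Complex.sq_norm, Complex.normSq_apply]
  ring

theorem gaugePow_nonneg (F G : ℂ → ℂ) (p : ℝ) (w : ℂ) : 0 ≤ gaugePow F G p w :=
  (Real.rpow_pos_of_pos (one_add_sq_add_sq_pos _ _) p).le

theorem gaugePow_laplacian_le (F G : ℂ → ℂ) {p : ℝ} (hp0 : 0 ≤ p) (hp1 : p ≤ 1) (w : ℂ) :
    gaugePowDeriv₂ F G p 1 w + gaugePowDeriv₂ F G p I w ≤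
      2 * p * gaugePow F G (p - 1) w * (‖deriv F w‖ ^ 2 + ‖deriv G w‖ ^ 2) := by
  rw [gaugePow_laplacian]
  have h : 0 ≤ p * (1 - p) * gaugePow F G (p - 2) w *
        (((F w).re * (deriv F w).re + (G w).im * (deriv G w).im) ^ 2 +
          (-(F w).re * (deriv F w).im + (G w).im * (deriv G w).re) ^ 2) :=
    mul_nonneg (mul_nonneg (mul_nonneg hp0 (by linarith)) (gaugePow_nonneg F G _ w))
      (by positivity)
  linarith

theorem gaugePow_sub_two_mul (F : ℂ → ℂ) (p : ℝ) (w : ℂ) :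
    gaugePow F 0 (p - 2) w * (1 + (F w).re ^ 2) = gaugePow F 0 (p - 1) w := by
  have h : (0 : ℝ) < 1 + (F w).re ^ 2 := by positivity
  have := Real.rpow_add h (p - 2) 1
  rw [Real.rpow_one] at this
  simp only [gaugePow, Pi.zero_apply, zero_im, ne_eq, OfNat.ofNat_ne_zero, not_false_eq_true,
    zero_pow, add_zero]
  rw [← this]
  congr 1
  ring

theorem gaugePow_zero_laplacian (F : ℂ → ℂ) (p : ℝ) (w : ℂ) :
    gaugePowDeriv₂ F 0 p 1 w + gaugePowDeriv₂ F 0 p I w =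
      2 * p * ((2 * p - 1) * gaugePow F 0 (p - 1) w + 2 * (1 - p) * gaugePow F 0 (p - 2) w) *
        ‖deriv F w‖ ^ 2 := by
  have hd : deriv (0 : ℂ → ℂ) w = 0 := by simp
  rw [gaugePow_laplacian, hd, ← gaugePow_sub_two_mul]
  simp only [norm_zero, Pi.zero_apply, zero_im, Complex.sq_norm, Complex.normSq_apply]
  ring

theorem gaugePow_laplacian_comparison (F : ℂ → ℂ) {q : ℝ} (hq0 : 0 < q) (hq1 : q < 1) (w : ℂ) :
    q * (1 - q) * gaugePow F 0 (q / 2 - 1) w * ‖deriv F w‖ ^ 2 ≤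
      q * (2 - q) * (gaugePowDeriv₂ F 0 (1 / 2) 1 w + gaugePowDeriv₂ F 0 (1 / 2) I w) -
      (gaugePowDeriv₂ F 0 (q / 2) 1 w + gaugePowDeriv₂ F 0 (q / 2) I w) := by
  rw [gaugePow_zero_laplacian, gaugePow_zero_laplacian]
  have h : gaugePow F 0 (q / 2 - 2) w ≤ gaugePow F 0 (1 / 2 - 2) w :=
    Real.rpow_le_rpow_of_exponent_le
      (by nlinarith [sq_nonneg (F w).re, sq_nonneg ((0 : ℂ → ℂ) w).im])
      (by linarith)
  have h' : 0 ≤ q * (2 - q) * ‖deriv F w‖ ^ 2 *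
      (gaugePow F 0 (1 / 2 - 2) w - gaugePow F 0 (q / 2 - 2) w) :=
    mul_nonneg (mul_nonneg (mul_nonneg hq0.le (by linarith)) (by positivity)) (by linarith)
  linarith

theorem gaugePow_le_gaugePow_zero (F G : ℂ → ℂ) {p : ℝ} (hp : p ≤ 0) (w : ℂ) :
    gaugePow F G p w ≤ gaugePow F 0 p w := by
  refine Real.rpow_le_rpow_of_nonpos (one_add_sq_add_sq_pos _ _) ?_ hp
  simp [sq_nonneg]

theorem gaugePow_le_one (F G : ℂ → ℂ) {p : ℝ} (hp : p ≤ 0) (w : ℂ) :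
    gaugePow F G p w ≤ 1 := by
  refine Real.rpow_le_one_of_one_le_of_nonpos ?_ hp
  nlinarith [sq_nonneg (F w).re, sq_nonneg (G w).im]

theorem hasLineDerivAt_norm_exp_sq (w e : ℂ) :
    HasLineDerivAt ℝ (fun w => ‖exp w‖ ^ 2) (2 * e.re * ‖exp w‖ ^ 2) w e := by
  have h1 : HasDerivAt (fun t : ℝ => (w + t • e).re) (e * deriv (fun z : ℂ => z) w).re 0 :=
    hasDerivAt_line_re differentiableAt_id e
  rw [show deriv (fun z : ℂ => z) w = 1 from congrFun deriv_id' w, mul_one] at h1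
  have h := h1.exp.pow 2
  simp only [HasLineDerivAt, Complex.norm_exp]
  refine h.congr_deriv ?_
  simp
  ring

/-- The circle means of `(1 + (Re F)² + (Im G)²) ^ (q / 2)` are controlled by those of
`√(1 + (Re F)²)` when `|G'|² ≤ a |F'|² + b`. -/
theorem integral_gaugePow_le {F G : ℂ → ℂ} {a b q : ℝ}
    (hF : DifferentiableOn ℂ F (Metric.ball 0 1)) (hG : DifferentiableOn ℂ G (Metric.ball 0 1))
    (ha : 0 ≤ a) (hb : 0 ≤ b)
    (hFG : ∀ z ∈ Metric.ball (0 : ℂ) 1, ‖deriv G z‖ ^ 2 ≤ a * ‖deriv F z‖ ^ 2 + b)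
    (hq0 : 0 < q) (hq1 : q < 1) {r : ℝ} (hr : r ∈ Ico (0 : ℝ) 1) :
    ∫ θ in (0 : ℝ)..(2 * Real.pi),
      (gaugePow F G (q / 2) (r * exp (θ * I)) - (1 + a) / (1 - q) *
        (q * (2 - q) * gaugePow F 0 (1 / 2) (r * exp (θ * I)) -
          gaugePow F 0 (q / 2) (r * exp (θ * I))) - b * ‖(r : ℂ) * exp (θ * I)‖ ^ 2) ≤
    2 * Real.pi * (gaugePow F G (q / 2) 0 - (1 + a) / (1 - q) *
        (q * (2 - q) * gaugePow F 0 (1 / 2) 0 - gaugePow F 0 (q / 2) 0)) := by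
  set c := (1 + a) / (1 - q) with hc
  have hS : IsOpen {w : ℂ | w.re < 0} := isOpen_lt continuous_re continuous_const
  have hmaps : MapsTo (fun w : ℂ => exp w) {w | w.re < 0} (Metric.ball 0 1) := by
    intro w hw
    simpa [Complex.norm_exp] using hw
  set f : ℂ → ℂ := fun w => F (exp w) with hf
  set g : ℂ → ℂ := fun w => G (exp w) with hg
  have hexp : DifferentiableOn ℂ (fun w : ℂ => exp w) {w | w.re < 0} :=
    differentiable_exp.differentiableOn
  have hfS : DifferentiableOn ℂ f {w | w.re < 0} := hF.comp hexp hmaps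
  have hgS : DifferentiableOn ℂ g {w | w.re < 0} := hG.comp hexp hmaps
  have hfS' := hfS.deriv hS
  have hgS' := hgS.deriv hS
  have h0S : DifferentiableOn ℂ (0 : ℂ → ℂ) {w | w.re < 0} := differentiableOn_const 0
  have h0S' := h0S.deriv hS
  have hderiv : ∀ (H : ℂ → ℂ), DifferentiableOn ℂ H (Metric.ball 0 1) → ∀ w : ℂ, w.re < 0 →
      ‖deriv (fun w => H (exp w)) w‖ ^ 2 = ‖deriv H (exp w)‖ ^ 2 * ‖exp w‖ ^ 2 := by
    intro H hH w hw
    have h1 := (hH.differentiableAt (Metric.isOpen_ball.mem_nhds (hmaps hw))).hasDerivAt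
    have h2 : HasDerivAt (fun w => H (exp w)) (deriv H (exp w) * exp w) w :=
      h1.comp w (Complex.hasDerivAt_exp w)
    rw [h2.deriv, norm_mul, mul_pow]
  have hfg : ∀ w : ℂ, w.re < 0 →
      ‖deriv g w‖ ^ 2 ≤ a * ‖deriv f w‖ ^ 2 + b * ‖exp w‖ ^ 2 := by
    intro w hw
    rw [hderiv F hF w hw, hderiv G hG w hw]
    calc _ ≤ (a * ‖deriv F (exp w)‖ ^ 2 + b) * ‖exp w‖ ^ 2 :=
          mul_le_mul_of_nonneg_right (hFG _ (hmaps hw)) (by positivity)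
      _ = _ := by ring
  have hd₁ : ∀ (e w : ℂ), w.re < 0 → HasLineDerivAt ℝ
      (fun w => gaugePow f g (q / 2) w -
        c * (q * (2 - q) * gaugePow f 0 (1 / 2) w - gaugePow f 0 (q / 2) w) - b * ‖exp w‖ ^ 2)
      (gaugePowDeriv f g (q / 2) e w - c * (q * (2 - q) * gaugePowDeriv f 0 (1 / 2) e w -
        gaugePowDeriv f 0 (q / 2) e w) - b * (2 * e.re * ‖exp w‖ ^ 2)) w e := by
    intro e w hw
    have hn := hS.mem_nhds hw
    have hfw := hfS.differentiableAt hn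
    have hgw := hgS.differentiableAt hn
    have h0w := h0S.differentiableAt hn
    exact (HasDerivAt.sub (hasLineDerivAt_gaugePow hfw hgw _ e) (((HasDerivAt.const_mul _
      (hasLineDerivAt_gaugePow hfw h0w _ e)).sub
        (hasLineDerivAt_gaugePow hfw h0w _ e)).const_mul _)).sub
          (HasDerivAt.const_mul _ (hasLineDerivAt_norm_exp_sq w e))
  have hd₂ : ∀ (e w : ℂ), w.re < 0 → HasLineDerivAt ℝ
      (fun w => gaugePowDeriv f g (q / 2) e w - c * (q * (2 - q) * gaugePowDeriv f 0 (1 / 2) e w -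
        gaugePowDeriv f 0 (q / 2) e w) - b * (2 * e.re * ‖exp w‖ ^ 2))
      (gaugePowDeriv₂ f g (q / 2) e w - c * (q * (2 - q) * gaugePowDeriv₂ f 0 (1 / 2) e w -
        gaugePowDeriv₂ f 0 (q / 2) e w) - b * (2 * e.re * (2 * e.re * ‖exp w‖ ^ 2))) w e := by
    intro e w hw
    have hn := hS.mem_nhds hw
    have hfw := hfS.differentiableAt hn
    have hgw := hgS.differentiableAt hn
    have h0w := h0S.differentiableAt hn
    have hfw' := hfS'.differentiableAt hn
    have hgw' := hgS'.differentiableAt hn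
    have h0w' := h0S'.differentiableAt hn
    exact (HasDerivAt.sub (hasLineDerivAt_gaugePowDeriv hfw hgw hfw' hgw' _ e)
      (((HasDerivAt.const_mul _ (hasLineDerivAt_gaugePowDeriv hfw h0w hfw' h0w' _ e)).sub
        (hasLineDerivAt_gaugePowDeriv hfw h0w hfw' h0w' _ e)).const_mul _)).sub
          (HasDerivAt.const_mul _ (HasDerivAt.const_mul _ (hasLineDerivAt_norm_exp_sq w e)))
  have hfc := hfS.continuousOn
  have hgc := hgS.continuousOn
  have h0c := h0S.continuousOn
  have hfc' := hfS'.continuousOn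
  have hgc' := hgS'.continuousOn
  have h0c' := h0S'.continuousOn
  have hfc'' := (hfS'.deriv hS).continuousOn
  have hgc'' := (hgS'.deriv hS).continuousOn
  have h0c'' := (h0S'.deriv hS).continuousOn
  have hnc : ContinuousOn (fun w : ℂ => ‖exp w‖ ^ 2) {w | w.re < 0} := by fun_prop
  have hc₁ : ∀ e : ℂ, ContinuousOn (fun w => gaugePowDeriv f g (q / 2) e w -
      c * (q * (2 - q) * gaugePowDeriv f 0 (1 / 2) e w -
        gaugePowDeriv f 0 (q / 2) e w) - b * (2 * e.re * ‖exp w‖ ^ 2)) {w | w.re < 0} := fun e =>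
    ((gaugePowDeriv_continuousOn hfc hgc hfc' hgc' _ e).sub (((continuousOn_const.mul
      (gaugePowDeriv_continuousOn hfc h0c hfc' h0c' _ e)).sub
        (gaugePowDeriv_continuousOn hfc h0c hfc' h0c' _ e)).const_smul c)).sub
          (continuousOn_const.mul (continuousOn_const.mul hnc))
  have hc₂ : ∀ e : ℂ, ContinuousOn (fun w => gaugePowDeriv₂ f g (q / 2) e w -
      c * (q * (2 - q) * gaugePowDeriv₂ f 0 (1 / 2) e w -
        gaugePowDeriv₂ f 0 (q / 2) e w) - b * (2 * e.re * (2 * e.re * ‖exp w‖ ^ 2)))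
      {w | w.re < 0} := fun e =>
    ((gaugePowDeriv₂_continuousOn hfc hgc hfc' hgc' hfc'' hgc'' _ e).sub (((continuousOn_const.mul
      (gaugePowDeriv₂_continuousOn hfc h0c hfc' h0c' hfc'' h0c'' _ e)).sub
        (gaugePowDeriv₂_continuousOn hfc h0c hfc' h0c' hfc'' h0c'' _ e)).const_smul c)).sub
          (continuousOn_const.mul (continuousOn_const.mul (continuousOn_const.mul hnc)))
  have h0 : ContinuousOn (0 : ℂ → ℂ) (Metric.ball 0 1) := continuousOn_const
  have hP : ContinuousOn (fun z => gaugePow F G (q / 2) z -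
      c * (q * (2 - q) * gaugePow F 0 (1 / 2) z - gaugePow F 0 (q / 2) z) - b * ‖z‖ ^ 2)
      (Metric.ball 0 1) :=
    ((gaugePow_continuousOn hF.continuousOn hG.continuousOn _).sub (((continuousOn_const.mul
      (gaugePow_continuousOn hF.continuousOn h0 _)).sub
        (gaugePow_continuousOn hF.continuousOn h0 _)).const_smul c)).sub
          (continuousOn_const.mul (continuous_norm.pow 2).continuousOn)
  have hlap : ∀ w : ℂ, w.re < 0 →
      (gaugePowDeriv₂ f g (q / 2) 1 w - c * (q * (2 - q) * gaugePowDeriv₂ f 0 (1 / 2) 1 w -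
        gaugePowDeriv₂ f 0 (q / 2) 1 w) - b * (2 * (1 : ℂ).re * (2 * (1 : ℂ).re * ‖exp w‖ ^ 2))) +
      (gaugePowDeriv₂ f g (q / 2) I w - c * (q * (2 - q) * gaugePowDeriv₂ f 0 (1 / 2) I w -
        gaugePowDeriv₂ f 0 (q / 2) I w) - b * (2 * I.re * (2 * I.re * ‖exp w‖ ^ 2))) ≤ 0 := by
    intro w hw
    have hc0 : 0 ≤ c := div_nonneg (by linarith) (by linarith)
    have hc1 : c * (1 - q) = 1 + a := div_mul_cancel₀ _ (by linarith)
    have h1 := gaugePow_laplacian_le f g (p := q / 2) (by linarith) (by linarith) w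
    have h2 := mul_le_mul_of_nonneg_left (gaugePow_laplacian_comparison f hq0 hq1 w) hc0
    have h3 := gaugePow_le_gaugePow_zero f g (p := q / 2 - 1) (by linarith) w
    have h4 := gaugePow_le_one f g (p := q / 2 - 1) (by linarith) w
    have hN := gaugePow_nonneg f g (q / 2 - 1) w
    have h5 : gaugePow f g (q / 2 - 1) w * (‖deriv f w‖ ^ 2 + ‖deriv g w‖ ^ 2) ≤
        (1 + a) * ‖deriv f w‖ ^ 2 * gaugePow f 0 (q / 2 - 1) w + b * ‖exp w‖ ^ 2 := by
      calc _ ≤ gaugePow f g (q / 2 - 1) w *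
            ((1 + a) * ‖deriv f w‖ ^ 2 + b * ‖exp w‖ ^ 2) :=
            mul_le_mul_of_nonneg_left (by linarith [hfg w hw]) hN
        _ = (1 + a) * ‖deriv f w‖ ^ 2 * gaugePow f g (q / 2 - 1) w +
            b * ‖exp w‖ ^ 2 * gaugePow f g (q / 2 - 1) w := by ring
        _ ≤ _ := add_le_add (mul_le_mul_of_nonneg_left h3 (by positivity))
            (mul_le_of_le_one_right (by positivity) h4)
    have h6 := mul_le_mul_of_nonneg_left h5 hq0.le
    have h7 : c * (q * (1 - q) * gaugePow f 0 (q / 2 - 1) w * ‖deriv f w‖ ^ 2) =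
        q * ((1 + a) * ‖deriv f w‖ ^ 2 * gaugePow f 0 (q / 2 - 1) w) := by
      rw [← hc1]; ring
    have h8 : q * (b * ‖exp w‖ ^ 2) ≤ 4 * (b * ‖exp w‖ ^ 2) :=
      mul_le_mul_of_nonneg_right (by linarith) (by positivity)
    simp only [one_re, I_re]
    linarith
  have := integral_circle_le_of_laplacian_nonpos hP (hc₁ 1) (hc₂ 1) (hc₂ I)
    (hd₁ 1) (hd₂ 1) (hd₁ I) (hd₂ I) hlap hr
  simpa using this

theorem abs_rpow_le_gaugePow (F G : ℂ → ℂ) {q : ℝ} (hq : 0 ≤ q) (w : ℂ) :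
    |(G w).im| ^ q ≤ gaugePow F G (q / 2) w := by
  have h : |(G w).im| ^ q = ((G w).im ^ 2) ^ (q / 2) := by
    rw [← sq_abs, ← Real.rpow_natCast, ← Real.rpow_mul (abs_nonneg _)]
    congr 1
    push_cast
    ring
  rw [h]
  exact Real.rpow_le_rpow (sq_nonneg _) (by nlinarith [sq_nonneg (F w).re]) (by linarith)

theorem gaugePow_zero_half_le (F : ℂ → ℂ) (w : ℂ) :
    gaugePow F 0 (1 / 2) w ≤ 1 + |(F w).re| := by
  rw [gaugePow, ← Real.sqrt_eq_rpow]
  refine Real.sqrt_le_iff.2 ⟨by positivity, ?_⟩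
  simp only [Pi.zero_apply, zero_im, ne_eq, OfNat.ofNat_ne_zero, not_false_eq_true, zero_pow,
    add_zero]
  nlinarith [sq_abs (F w).re, abs_nonneg (F w).re]

theorem sq_norm_sub_le_of_quasiregular {K K' : ℝ} {x y : ℂ}
    (hxy : (‖x‖ + ‖y‖) ^ 2 ≤ K * (‖x‖ ^ 2 - ‖y‖ ^ 2) + K') :
    ‖x - y‖ ^ 2 ≤ K ^ 2 * ‖x + y‖ ^ 2 + 2 * K' := by
  have h1 : ‖x - y‖ ^ 2 ≤ (‖x‖ + ‖y‖) ^ 2 :=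
    pow_le_pow_left₀ (norm_nonneg _) (norm_sub_le x y) 2
  have h2 : (‖x‖ - ‖y‖) ^ 2 ≤ ‖x + y‖ ^ 2 := by
    rw [← sq_abs]
    refine pow_le_pow_left₀ (abs_nonneg _) ?_ 2
    simpa using abs_norm_sub_norm_le x (-y)
  have h3 := mul_le_mul_of_nonneg_left h2 (sq_nonneg K)
  nlinarith [sq_nonneg ((‖x‖ + ‖y‖) - K * (‖x‖ - ‖y‖))]

/-- Kolmogorov's theorem for a pair of holomorphic functions with `|G'|² ≤ a |F'|² + b`, in terms of
integrals over circles. -/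
theorem exists_integral_abs_im_rpow_le {F G : ℂ → ℂ} {a b q M : ℝ}
    (hF : DifferentiableOn ℂ F (Metric.ball 0 1)) (hG : DifferentiableOn ℂ G (Metric.ball 0 1))
    (ha : 0 ≤ a) (hb : 0 ≤ b)
    (hFG : ∀ z ∈ Metric.ball (0 : ℂ) 1, ‖deriv G z‖ ^ 2 ≤ a * ‖deriv F z‖ ^ 2 + b)
    (hM : ∀ r ∈ Ico (0 : ℝ) 1, ∫ θ in (0 : ℝ)..(2 * Real.pi), |(F (r * exp (θ * I))).re| ≤ M)
    (hq0 : 0 < q) (hq1 : q < 1) :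
    ∃ B, ∀ r ∈ Ico (0 : ℝ) 1,
      ∫ θ in (0 : ℝ)..(2 * Real.pi), |(G (r * exp (θ * I))).im| ^ q ≤ B := by
  set c := (1 + a) / (1 - q) with hc
  have hc0 : 0 ≤ c := div_nonneg (by linarith) (by linarith)
  have hY : 0 ≤ c * (q * (2 - q)) := mul_nonneg hc0 (mul_nonneg hq0.le (by linarith))
  refine ⟨2 * Real.pi * (gaugePow F G (q / 2) 0 - c *
    (q * (2 - q) * gaugePow F 0 (1 / 2) 0 - gaugePow F 0 (q / 2) 0)) +
    c * (q * (2 - q)) * M + 2 * Real.pi * (c * (q * (2 - q)) + b), fun r hr => ?_⟩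
  have hmem : ∀ θ : ℝ, (r : ℂ) * exp (θ * I) ∈ Metric.ball (0 : ℂ) 1 := by
    intro θ
    simpa [Complex.norm_exp, abs_of_nonneg hr.1] using hr.2
  have hcont : ∀ {E : Type} [TopologicalSpace E] {H : ℂ → E}, ContinuousOn H (Metric.ball 0 1) →
      Continuous fun θ : ℝ => H (r * exp (θ * I)) := by
    intro E _ H hH
    exact hH.comp_continuous (by fun_prop) hmem
  have hFc := hcont hF.continuousOn
  have hGc := hcont hG.continuousOn
  have h0 : ContinuousOn (0 : ℂ → ℂ) (Metric.ball 0 1) := continuousOn_const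
  have hmain := integral_gaugePow_le hF hG ha hb hFG hq0 hq1 hr
  rw [← hc] at hmain
  have hu : Continuous fun θ : ℝ => |(F (r * exp (θ * I))).re| :=
    (continuous_re.comp hFc).abs
  have hv : Continuous fun θ : ℝ => |(G (r * exp (θ * I))).im| ^ q :=
    (continuous_im.comp hGc).abs.rpow_const fun _ => Or.inr hq0.le
  have h1 := hcont (gaugePow_continuousOn hF.continuousOn hG.continuousOn (q / 2))
  have h2 := hcont (gaugePow_continuousOn hF.continuousOn h0 (q / 2))
  have h3 := hcont (gaugePow_continuousOn hF.continuousOn h0 (1 / 2))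
  have hcomp : ∫ θ in (0 : ℝ)..(2 * Real.pi), (|(G (r * exp (θ * I))).im| ^ q -
        c * (q * (2 - q)) * |(F (r * exp (θ * I))).re| - (c * (q * (2 - q)) + b)) ≤
      ∫ θ in (0 : ℝ)..(2 * Real.pi), (gaugePow F G (q / 2) (r * exp (θ * I)) - c *
        (q * (2 - q) * gaugePow F 0 (1 / 2) (r * exp (θ * I)) -
          gaugePow F 0 (q / 2) (r * exp (θ * I))) - b * ‖(r : ℂ) * exp (θ * I)‖ ^ 2) := by
    refine intervalIntegral.integral_mono_on Real.two_pi_pos.le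
      (Continuous.intervalIntegrable (by fun_prop) _ _)
      (Continuous.intervalIntegrable (by fun_prop) _ _) fun θ _ => ?_
    set z := (r : ℂ) * exp (θ * I) with hz
    have e1 := abs_rpow_le_gaugePow F G hq0.le z
    have e2 := mul_le_mul_of_nonneg_left (gaugePow_zero_half_le F z) hY
    have e3 := mul_nonneg hc0 (gaugePow_nonneg F 0 (q / 2) z)
    have e4 : b * ‖z‖ ^ 2 ≤ b := by
      refine mul_le_of_le_one_right hb (pow_le_one₀ (norm_nonneg _) ?_)
      have := hmem θ
      rw [mem_ball_zero_iff] at this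
      exact this.le
    linarith
  rw [intervalIntegral.integral_sub (Continuous.intervalIntegrable (by fun_prop) _ _)
      intervalIntegrable_const,
    intervalIntegral.integral_sub (hv.intervalIntegrable _ _)
      (Continuous.intervalIntegrable (by fun_prop) _ _),
    intervalIntegral.integral_const_mul, intervalIntegral.integral_const, smul_eq_mul,
    sub_zero] at hcomp
  have := mul_le_mul_of_nonneg_left (hM r hr) hY
  linarith

/-- Kolmogorov type theorem for harmonic (K,K')-quasiregular mappings. -/
theorem kolmogorov_type_harmonic_KKprime_qr
    (K K' : ℝ) (hK : 1 ≤ K) (hK' : 0 ≤ K')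
    (f h g : ℂ → ℂ)
    (hh : DifferentiableOn ℂ h (Metric.ball 0 1))
    (hg : DifferentiableOn ℂ g (Metric.ball 0 1))
    (hg0 : g 0 = 0)
    (hfdec : ∀ z ∈ Metric.ball (0:ℂ) 1, f z = h z + (starRingEnd ℂ) (g z))
    (hqr : ∀ z ∈ Metric.ball (0:ℂ) 1,
      (‖deriv h z‖ + ‖deriv g z‖) ^ 2 ≤ K * (‖deriv h z‖ ^ 2 - ‖deriv g z‖ ^ 2) + K')
    (hv0 : (f 0).im = 0)
    (hu : MemHp 1 (fun z => (f z).re)) :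
    ∀ q : ℝ, 0 < q → q < 1 → MemHp q (fun z => (f z).im) := by
  intro q hq0 hq1
  have hpi := Real.two_pi_pos
  have hball : ∀ r ∈ Ico (0 : ℝ) 1, ∀ θ : ℝ,
      (r : ℂ) * exp (θ * I) ∈ Metric.ball (0 : ℂ) 1 := by
    intro r hr θ
    simpa [Complex.norm_exp, abs_of_nonneg hr.1] using hr.2
  obtain ⟨M, hM⟩ := hu
  have hM' : ∀ r ∈ Ico (0 : ℝ) 1,
      ∫ θ in (0 : ℝ)..(2 * Real.pi), |((h + g) (r * exp (θ * I))).re| ≤ 2 * Real.pi * M := by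
    intro r hr
    have h1 : Mp 1 r (fun z => (f z).re) ≤ M := hM (mem_image_of_mem _ hr)
    simp only [Mp, Real.rpow_one, div_one, Real.norm_eq_abs] at h1
    rw [one_div, inv_mul_le_iff₀ hpi] at h1
    refine (intervalIntegral.integral_congr fun θ _ => ?_).trans_le h1
    simp [hfdec _ (hball r hr θ)]
  obtain ⟨B, hB⟩ := exists_integral_abs_im_rpow_le (hh.add hg) (hh.sub hg) (sq_nonneg K)
    (b := 2 * K') (by linarith) (fun z hz => by
      have hn := Metric.isOpen_ball.mem_nhds hz
      rw [deriv_add (hh.differentiableAt hn) (hg.differentiableAt hn),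
        deriv_sub (hh.differentiableAt hn) (hg.differentiableAt hn)]
      exact sq_norm_sub_le_of_quasiregular (hqr z hz)) hM' hq0 hq1
  refine ⟨(1 / (2 * Real.pi) * B) ^ (1 / q), ?_⟩
  rintro _ ⟨r, hr, rfl⟩
  have hint : ∫ θ in (0 : ℝ)..(2 * Real.pi), ‖(f (r * exp (θ * I))).im‖ ^ q ≤ B := by
    refine (intervalIntegral.integral_congr fun θ _ => ?_).trans_le (hB r hr)
    simp [hfdec _ (hball r hr θ), sub_eq_add_neg]
  refine Real.rpow_le_rpow (mul_nonneg (by positivity) ?_)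
    (mul_le_mul_of_nonneg_left hint (by positivity)) (by positivity)
  exact intervalIntegral.integral_nonneg hpi.le fun θ _ => by positivity
end
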